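/- (Generation of a modulus of continuity) Let f₀ ∈ Ẇ^{1,∞}(ℝ²) with ‖∇_x f₀‖_{L∞} < 1/√5, and let f : [0,T]×ℝ² → ℝ be a sufficiently smooth solution of the 3D Muskat equation with initial data f₀, with f ∈ C([0,T]; C³₀(ℝ²)). Let ω = ω_{δ,γ} be a modulus for which the strict modulus inequality of the paper (Lemma 5.4, with the constants A, c, λ determined by ‖∇_x f₀‖_{L∞}) holds, set C := ω^{−1}(2‖∇_x f₀‖_{L∞}) / (2‖∇_x f₀‖_{L∞}) and ω̄(r) := ω(Cr). Then: (i) for any δ' ≥ 0, if |∇_x f₀(x) − ∇_x f₀(y)| ≤ ω̄(|x−y|/δ') for all x ≠ y, then |∇_x f(t,x) − ∇_x f(t,y)| ≤ ω̄(|x−y|/(t+δ')) for all t ∈ [0,T] and x ≠ y; (ii) in particular (δ' = 0), |∇_x f(t,x) − ∇_x f(t,y)| < ω̄(|x−y|/t) for all t ∈ (0,T] and x ≠ y ∈ ℝ². -/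

import Mathlib

open MeasureTheory Filter Set
open scoped RealInnerProductSpace Topology

noncomputable section

/-- The horizontal slice `ℝ²` (the interface variable space for the 3D Muskat problem). -/
abbrev E2 := EuclideanSpace ℝ (Fin 2)

/-- The integrand of the `d`-dimensional Muskat equation:
`(δ_h g(x) − ∇g(x)·h) / (δ_h g(x)² + |h|²)^{d/2}`. -/
def muskatIntegrand (d : ℕ) {n : ℕ} (g : EuclideanSpace ℝ (Fin n) → ℝ)
    (x h : EuclideanSpace ℝ (Fin n)) : ℝ :=
  (g (x + h) - g x - ⟪gradient g x, h⟫) /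
    ((g (x + h) - g x) ^ 2 + ‖h‖ ^ 2) ^ ((d : ℝ) / 2)

/-- Principal value (over symmetric annuli `1/R < ‖h‖ < R` as `R → ∞`) of the integral of `F`. -/
def HasPV {n : ℕ} (F : EuclideanSpace ℝ (Fin n) → ℝ) (I : ℝ) : Prop :=
  Tendsto (fun R : ℝ => ∫ h in {h : EuclideanSpace ℝ (Fin n) | R⁻¹ < ‖h‖ ∧ ‖h‖ < R}, F h)
    atTop (𝓝 I)

/-- A sufficiently smooth, decaying solution of the 3D Muskat equation on `[0,T]`:
`f ∈ C([0,T]; C³₀(ℝ²))` (continuity in time in the `C³` sup norms, with all derivatives up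
to order 3 vanishing at infinity), differentiable in time, and solving the Muskat equation
in the principal value sense on `(0,T)`. -/
def SmoothDecaySol (T : ℝ) (f : ℝ → E2 → ℝ) : Prop :=
  (∀ t ∈ Icc 0 T, ContDiff ℝ 3 (f t)) ∧
  (∀ t ∈ Icc 0 T, ∀ i : ℕ, i ≤ 3 →
    Tendsto (fun x : E2 => ‖iteratedFDeriv ℝ i (f t) x‖) (cocompact E2) (𝓝 0)) ∧
  (∀ t₁ ∈ Icc 0 T, ∀ ε > (0 : ℝ), ∃ δ > (0 : ℝ), ∀ t ∈ Icc 0 T, |t - t₁| < δ →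
    ∀ i : ℕ, i ≤ 3 → ∀ x : E2,
      ‖iteratedFDeriv ℝ i (f t) x - iteratedFDeriv ℝ i (f t₁) x‖ ≤ ε) ∧
  (∀ t ∈ Ioo 0 T, ∀ x : E2, DifferentiableAt ℝ (fun s => f s x) t) ∧
  (∀ t ∈ Ioo 0 T, ∀ x : E2, HasPV (muskatIntegrand 3 (f t) x) (deriv (fun s => f s x) t))

/-- The modulus of continuity `ω_{δ,γ}` of Kiselev–Nazarov–Volberg, formula (5.7) of the
paper. -/
def omegaMod (δ γ r : ℝ) : ℝ :=
  if r ≤ δ then r - r ^ ((3 : ℝ) / 2)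
  else δ - δ ^ ((3 : ℝ) / 2) + γ * (Real.log (4 + Real.log (r / δ)) - Real.log 4)

/-! ### Part 1: the modulus -/

structure PH (δ γ : ℝ) : Prop where
  pos : 0 < δ
  le : δ ≤ 1 / 1000
  eq : γ = δ / 16

/-- A supergradient of the modulus. -/
def omegaP (δ γ r : ℝ) : ℝ :=
  if r ≤ δ then 1 - 3 / 2 * Real.sqrt r else γ / (r * (4 + Real.log (r / δ)))

lemma rpow_three_half {r : ℝ} (hr : 0 ≤ r) : r ^ ((3 : ℝ) / 2) = r * Real.sqrt r := by
  rw [show (3 : ℝ) / 2 = 1 + 1 / 2 by norm_num, Real.rpow_add_of_nonneg hr (by norm_num) (by norm_num),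
    Real.rpow_one, ← Real.sqrt_eq_rpow]

lemma omega_small {δ γ r : ℝ} (h0 : 0 ≤ r) (h : r ≤ δ) : omegaMod δ γ r = r - r * Real.sqrt r := by
  rw [omegaMod, if_pos h, rpow_three_half h0]

lemma omega_large {δ γ r : ℝ} (hp : PH δ γ) (h : δ ≤ r) :
    omegaMod δ γ r = δ - δ * Real.sqrt δ + γ * (Real.log (4 + Real.log (r / δ)) - Real.log 4) := by
  rcases h.eq_or_lt with h | h
  · subst h
    rw [omega_small hp.pos.le le_rfl, div_self hp.pos.ne']
    simp
  · rw [omegaMod, if_neg (not_le.2 h), rpow_three_half hp.pos.le]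

lemma sqrt_le_of_PH {δ γ r : ℝ} (hp : PH δ γ) (h : r ≤ δ) : Real.sqrt r ≤ 1 / 30 := by
  rw [Real.sqrt_le_left (by norm_num)]
  have := hp.le
  linarith

lemma PH.gpos {δ γ : ℝ} (hp : PH δ γ) : 0 < γ := by
  have := hp.pos; rw [hp.eq]; positivity

lemma logdiv_nonneg {δ γ r : ℝ} (hp : PH δ γ) (h : δ ≤ r) : 0 ≤ Real.log (r / δ) :=
  Real.log_nonneg (by rw [le_div_iff₀ hp.pos]; linarith)

lemma omegaP_small {δ γ r : ℝ} (hp : PH δ γ) (h : r ≤ δ) : 1 / 2 ≤ omegaP δ γ r := by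
  rw [omegaP, if_pos h]
  have := sqrt_le_of_PH hp h
  linarith

lemma omegaP_large {δ γ r : ℝ} (hp : PH δ γ) (h : δ < r) : omegaP δ γ r ≤ γ / (4 * r) := by
  rw [omegaP, if_neg (not_le.2 h)]
  have := logdiv_nonneg hp h.le
  have h1 := hp.pos
  have h2 := hp.gpos
  have h3 : 0 < r := h1.trans h
  apply div_le_div_of_nonneg_left h2.le (by positivity)
  nlinarith

lemma omegaP_large' {δ γ r : ℝ} (hp : PH δ γ) (h : δ < r) : omegaP δ γ r ≤ 1 / 64 := by
  refine (omegaP_large hp h).trans ?_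
  have h1 := hp.pos
  rw [div_le_iff₀ (by linarith), hp.eq]
  linarith

lemma omegaP_pos {δ γ r : ℝ} (hp : PH δ γ) : 0 < omegaP δ γ r := by
  rcases le_or_gt r δ with h | h
  · linarith [omegaP_small hp h]
  · rw [omegaP, if_neg (not_le.2 h)]
    have := logdiv_nonneg hp h.le
    have h1 := hp.pos
    have h2 := hp.gpos
    have : 0 < r := h1.trans h
    positivity

lemma omegaP_le_one {δ γ r : ℝ} (hp : PH δ γ) : omegaP δ γ r ≤ 1 := by
  rcases le_or_gt r δ with h | h
  · rw [omegaP, if_pos h]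
    have := Real.sqrt_nonneg r
    linarith
  · linarith [omegaP_large' hp h]

lemma sup_small {r s : ℝ} (hr : 0 ≤ r) (hs : 0 ≤ s) :
    s - s * Real.sqrt s ≤ r - r * Real.sqrt r + (1 - 3 / 2 * Real.sqrt r) * (s - r) := by
  obtain ⟨a, ha, rfl⟩ : ∃ a, 0 ≤ a ∧ r = a ^ 2 := ⟨_, Real.sqrt_nonneg r, (Real.sq_sqrt hr).symm⟩
  obtain ⟨b, hb, rfl⟩ : ∃ b, 0 ≤ b ∧ s = b ^ 2 := ⟨_, Real.sqrt_nonneg s, (Real.sq_sqrt hs).symm⟩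
  rw [Real.sqrt_sq ha, Real.sqrt_sq hb]
  nlinarith [mul_nonneg (sq_nonneg (b - a)) (by positivity : 0 ≤ 2 * b + a)]

lemma sup_large {δ γ r s : ℝ} (hp : PH δ γ) (hr : δ ≤ r) (hs : δ ≤ s) :
    omegaMod δ γ s ≤ omegaMod δ γ r + γ / (r * (4 + Real.log (r / δ))) * (s - r) := by
  rw [omega_large hp hr, omega_large hp hs]
  have h1 := hp.pos
  have h2 := hp.gpos
  have lr := logdiv_nonneg hp hr
  have ls := logdiv_nonneg hp hs
  have r0 : 0 < r := by linarith
  have s0 : 0 < s := by linarith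
  have A : Real.log (4 + Real.log (s / δ)) - Real.log (4 + Real.log (r / δ)) ≤
      (Real.log (s / δ) - Real.log (r / δ)) / (4 + Real.log (r / δ)) := by
    rw [← Real.log_div (by positivity) (by positivity)]
    refine (Real.log_le_sub_one_of_pos (by positivity)).trans (le_of_eq ?_)
    field_simp; ring
  have B : Real.log (s / δ) - Real.log (r / δ) ≤ (s - r) / r := by
    rw [← Real.log_div (by positivity) (by positivity)]
    refine (Real.log_le_sub_one_of_pos (by positivity)).trans (le_of_eq ?_)
    field_simp
  have C : (Real.log (s / δ) - Real.log (r / δ)) / (4 + Real.log (r / δ)) ≤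
      (s - r) / r / (4 + Real.log (r / δ)) := by gcongr
  have D : γ / (r * (4 + Real.log (r / δ))) * (s - r) = γ * ((s - r) / r / (4 + Real.log (r / δ))) := by
    field_simp
  rw [D]
  nlinarith [mul_le_mul_of_nonneg_left (A.trans C) h2.le]

lemma omega_sup {δ γ r s : ℝ} (hp : PH δ γ) (hr : 0 < r) (hs : 0 ≤ s) :
    omegaMod δ γ s ≤ omegaMod δ γ r + omegaP δ γ r * (s - r) := by
  have h1 := hp.pos
  have h2 := hp.gpos
  rcases le_or_gt r δ with h | h <;> rcases le_or_gt s δ with h' | h'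
  · rw [omega_small hs h', omega_small hr.le h, omegaP, if_pos h]
    exact sup_small hr.le hs
  · have A := sup_large hp le_rfl h'.le
    have B : omegaMod δ γ δ ≤ omegaMod δ γ r + omegaP δ γ r * (δ - r) := by
      rw [omega_small h1.le le_rfl, omega_small hr.le h, omegaP, if_pos h]
      exact sup_small hr.le h1.le
    have C : γ / (δ * (4 + Real.log (δ / δ))) = 1 / 64 := by
      rw [div_self h1.ne', Real.log_one, hp.eq]; field_simp; norm_num
    rw [C] at A
    nlinarith [omegaP_small hp h]
  · have A := sup_large hp h.le le_rfl
    have B : omegaMod δ γ s ≤ omegaMod δ γ δ + omegaP δ γ δ * (s - δ) := by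
      rw [omega_small h1.le le_rfl, omega_small hs h', omegaP, if_pos le_rfl]
      exact sup_small h1.le hs
    have C : γ / (r * (4 + Real.log (r / δ))) = omegaP δ γ r := by rw [omegaP, if_neg (not_le.2 h)]
    rw [C] at A
    nlinarith [omegaP_small hp (le_refl δ), omegaP_large' hp h]
  · rw [omegaP, if_neg (not_le.2 h)]
    exact sup_large hp h.le h'.le

lemma omega_zero {δ γ : ℝ} (hp : PH δ γ) : omegaMod δ γ 0 = 0 := by
  rw [omega_small le_rfl hp.pos.le]; simp

lemma omega_lt {δ γ r s : ℝ} (hp : PH δ γ) (hr : 0 ≤ r) (h : r < s) :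
    omegaMod δ γ r < omegaMod δ γ s := by
  have := omega_sup hp (hr.trans_lt h) hr
  nlinarith [omegaP_pos (r := s) hp]

lemma omega_mono {δ γ r s : ℝ} (hp : PH δ γ) (hr : 0 ≤ r) (h : r ≤ s) :
    omegaMod δ γ r ≤ omegaMod δ γ s := by
  rcases h.eq_or_lt with h | h
  · rw [h]
  · exact (omega_lt hp hr h).le

lemma omega_pos {δ γ r : ℝ} (hp : PH δ γ) (hr : 0 < r) : 0 < omegaMod δ γ r := by
  have := omega_lt hp le_rfl hr
  rwa [omega_zero hp] at this

lemma omega_nonneg {δ γ r : ℝ} (hp : PH δ γ) (hr : 0 ≤ r) : 0 ≤ omegaMod δ γ r := by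
  have := omega_mono hp le_rfl hr
  rwa [omega_zero hp] at this

lemma omega_le_id {δ γ r : ℝ} (hp : PH δ γ) (hr : 0 ≤ r) : omegaMod δ γ r ≤ r := by
  have h1 := hp.pos
  rcases le_or_gt r δ with h | h
  · rw [omega_small hr h]
    nlinarith [Real.sqrt_nonneg r]
  · have := omega_sup hp h1 hr
    rw [omega_small h1.le le_rfl] at this
    nlinarith [omegaP_le_one (r := δ) hp, Real.sqrt_nonneg δ]

lemma omega_lip {δ γ r s : ℝ} (hp : PH δ γ) (hr : 0 ≤ r) (h : r ≤ s) :
    omegaMod δ γ s ≤ omegaMod δ γ r + (s - r) := by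
  rcases hr.eq_or_lt with h0 | h0
  · subst h0
    rw [omega_zero hp]
    linarith [omega_le_id hp h]
  · have := omega_sup hp h0 (hr.trans h)
    nlinarith [omegaP_le_one (r := r) hp]

lemma omega_cont {δ γ : ℝ} (hp : PH δ γ) : ContinuousOn (omegaMod δ γ) (Ici 0) := by
  have : LipschitzOnWith 1 (omegaMod δ γ) (Ici 0) := by
    refine LipschitzOnWith.of_dist_le_mul fun r hr s hs => ?_
    rw [Real.dist_eq, Real.dist_eq, NNReal.coe_one, one_mul]
    rcases le_total r s with h | h
    · have a := omega_lip hp hr h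
      have b := omega_mono hp hr h
      rw [abs_sub_comm, abs_of_nonneg (by linarith), abs_sub_comm, abs_of_nonneg (by linarith)]
      linarith
    · have a := omega_lip hp hs h
      have b := omega_mono hp hs h
      rw [abs_of_nonneg (by linarith), abs_of_nonneg (by linarith)]
      linarith
  exact this.continuousOn

lemma omega_scale {δ γ r θ : ℝ} (hp : PH δ γ) (hr : 0 ≤ r) (h0 : 0 ≤ θ) (h1 : θ ≤ 1) :
    θ * omegaMod δ γ r ≤ omegaMod δ γ (θ * r) := by
  rcases (mul_nonneg h0 hr).eq_or_lt with h | h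
  · rcases mul_eq_zero.1 h.symm with h' | h' <;> subst h' <;> simp [omega_zero hp]
  · have A := omega_sup hp h hr
    have B := omega_sup hp h le_rfl
    rw [omega_zero hp] at B
    have := mul_le_mul_of_nonneg_left A h0
    have := mul_le_mul_of_nonneg_left B (sub_nonneg.2 h1)
    nlinarith

lemma log_le_sqrt {u : ℝ} (hu : 0 ≤ u) : Real.log (1 + u) ≤ 2 * Real.sqrt u := by
  have h : 1 + u ≤ (1 + Real.sqrt u) ^ 2 := by nlinarith [Real.sq_sqrt hu, Real.sqrt_nonneg u]
  have := Real.sqrt_nonneg u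
  calc Real.log (1 + u) ≤ Real.log ((1 + Real.sqrt u) ^ 2) := Real.log_le_log (by linarith) h
    _ = 2 * Real.log (1 + Real.sqrt u) := by rw [Real.log_pow]; norm_num
    _ ≤ 2 * Real.sqrt u := by
      have := Real.log_le_sub_one_of_pos (show 0 < 1 + Real.sqrt u by linarith)
      linarith

lemma omega_incr {δ γ r s : ℝ} (hp : PH δ γ) (hr : δ ≤ r) (hs : 0 ≤ s) :
    omegaMod δ γ (r + s) - omegaMod δ γ r ≤ γ / 2 * Real.sqrt (s / r) := by
  have h1 := hp.pos
  have h2 := hp.gpos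
  have r0 : 0 < r := by linarith
  have lr := logdiv_nonneg hp hr
  have lrs := logdiv_nonneg hp (show δ ≤ r + s by linarith)
  rw [omega_large hp hr, omega_large hp (by linarith)]
  have B : Real.log ((r + s) / δ) = Real.log (r / δ) + Real.log (1 + s / r) := by
    rw [← Real.log_mul (by positivity) (by positivity)]
    congr 1; field_simp
  have C := log_le_sqrt (show 0 ≤ s / r by positivity)
  have C0 : 0 ≤ Real.log (1 + s / r) := Real.log_nonneg (by linarith [show 0 ≤ s / r by positivity])
  have A : Real.log (4 + Real.log ((r + s) / δ)) - Real.log (4 + Real.log (r / δ)) ≤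
      Real.log (1 + s / r) / 4 := by
    rw [← Real.log_div (by positivity) (by positivity)]
    refine (Real.log_le_sub_one_of_pos (by positivity)).trans ?_
    rw [B, div_sub_one (by positivity)]
    have : 4 + (Real.log (r / δ) + Real.log (1 + s / r)) - (4 + Real.log (r / δ)) = Real.log (1 + s / r) := by ring
    rw [this]
    gcongr
    linarith
  nlinarith

lemma omega_delta {δ γ : ℝ} (hp : PH δ γ) : δ / 2 ≤ omegaMod δ γ δ := by
  rw [omega_small hp.pos.le le_rfl]
  nlinarith [sqrt_le_of_PH hp (le_refl δ), hp.pos]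

lemma omega_ge_half {δ γ r : ℝ} (hp : PH δ γ) (hr : δ ≤ r) : δ / 2 ≤ omegaMod δ γ r :=
  (omega_delta hp).trans (omega_mono hp hp.pos.le hr)

lemma omega_sqrt {δ γ r : ℝ} (hp : PH δ γ) (hr : 0 ≤ r) :
    omegaMod δ γ r ≤ 2 * Real.sqrt (δ * r) := by
  have h1 := hp.pos
  rcases le_or_gt r δ with h | h
  · refine (omega_le_id hp hr).trans ?_
    have : r ≤ Real.sqrt (δ * r) := Real.le_sqrt_of_sq_le (by nlinarith)
    linarith [Real.sqrt_nonneg (δ * r)]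
  · have A := omega_incr hp le_rfl (show 0 ≤ r - δ by linarith)
    rw [add_sub_cancel] at A
    have B : Real.sqrt ((r - δ) / δ) ≤ Real.sqrt (δ * r) / δ := by
      rw [le_div_iff₀ h1]
      apply Real.le_sqrt_of_sq_le
      rw [mul_pow, Real.sq_sqrt (div_nonneg (by linarith) h1.le)]
      field_simp
      nlinarith
    have C : δ ≤ Real.sqrt (δ * r) := Real.le_sqrt_of_sq_le (by nlinarith)
    have D := omega_le_id hp h1.le
    have E : γ / 2 * Real.sqrt ((r - δ) / δ) ≤ γ / 2 * (Real.sqrt (δ * r) / δ) := by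
      have := hp.gpos; gcongr
    have F : γ / 2 * (Real.sqrt (δ * r) / δ) = Real.sqrt (δ * r) / 32 := by
      rw [hp.eq]; field_simp; ring
    linarith [Real.sqrt_nonneg (δ * r)]

lemma omega_rel {δ γ r s : ℝ} (hp : PH δ γ) (hr : δ ≤ r) (hs : r ≤ s) :
    omegaMod δ γ s ≤ 2 * omegaMod δ γ r * Real.sqrt (s / r) := by
  have h1 := hp.pos
  have r0 : 0 < r := by linarith
  have A := omega_incr hp hr (show 0 ≤ s - r by linarith)
  rw [add_sub_cancel] at A
  have B : Real.sqrt ((s - r) / r) ≤ Real.sqrt (s / r) := by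
    apply Real.sqrt_le_sqrt; gcongr; linarith
  have C : 1 ≤ Real.sqrt (s / r) := by
    apply Real.le_sqrt_of_sq_le; rw [one_pow, le_div_iff₀ r0]; linarith
  have D := omega_ge_half hp hr
  have : γ / 2 * Real.sqrt ((s - r) / r) ≤ omegaMod δ γ r * Real.sqrt (s / r) := by
    have := Real.sqrt_nonneg ((s - r) / r)
    apply mul_le_mul _ B this (by linarith)
    have := hp.eq; linarith
  nlinarith [omega_nonneg hp r0.le]

lemma omega_double {δ γ r : ℝ} (hp : PH δ γ) (hr : δ ≤ r) :
    omegaMod δ γ (2 * r) ≤ 3 / 2 * omegaMod δ γ r := by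
  have r0 : 0 < r := by linarith [hp.pos]
  have A := omega_incr hp hr r0.le
  rw [div_self r0.ne', Real.sqrt_one, ← two_mul] at A
  have D := omega_ge_half hp hr
  have := hp.eq
  have := hp.pos
  linarith

lemma omega_le_cubic {δ γ r : ℝ} (hp : PH δ γ) (h0 : 0 ≤ r) (h : r ≤ 2 * δ) :
    omegaMod δ γ r ≤ r - r * Real.sqrt r := by
  have h1 := hp.pos
  rcases le_or_gt r δ with h' | h'
  · rw [omega_small h0 h']
  · have A := sup_large hp le_rfl h'.le
    have C : γ / (δ * (4 + Real.log (δ / δ))) = 1 / 64 := by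
      rw [div_self h1.ne', Real.log_one, hp.eq]; field_simp; norm_num
    rw [C, omega_small h1.le le_rfl] at A
    have B := sup_small h0 h1.le
    have : Real.sqrt r ≤ 1 / 10 := by
      rw [Real.sqrt_le_left (by norm_num)]
      have := hp.le
      linarith
    nlinarith

lemma omega_second {δ γ r s : ℝ} (hp : PH δ γ) (hr : 0 < r) (h : r ≤ δ) (h1 : r / 4 ≤ s)
    (h2 : s ≤ 3 * r / 4) :
    omegaMod δ γ (r + s) + omegaMod δ γ (r - s) - 2 * omegaMod δ γ r ≤ -(1 / 200) * (r * Real.sqrt r) := by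
  have A := omega_le_cubic hp (show 0 ≤ r + s by linarith) (by linarith)
  have B := omega_le_cubic hp (show 0 ≤ r - s by linarith) (by linarith)
  rw [omega_small hr.le h]
  obtain ⟨a, ha, ha2⟩ : ∃ a, 0 ≤ a ∧ r = a ^ 2 := ⟨_, Real.sqrt_nonneg r, (Real.sq_sqrt hr.le).symm⟩
  obtain ⟨p, hp0, hp2⟩ : ∃ a, 0 ≤ a ∧ r + s = a ^ 2 :=
    ⟨_, Real.sqrt_nonneg _, (Real.sq_sqrt (by linarith)).symm⟩
  obtain ⟨q, hq0, hq2⟩ : ∃ a, 0 ≤ a ∧ r - s = a ^ 2 :=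
    ⟨_, Real.sqrt_nonneg _, (Real.sq_sqrt (by linarith)).symm⟩
  rw [hp2, Real.sqrt_sq hp0] at A
  rw [hq2, Real.sqrt_sq hq0] at B
  rw [hp2, hq2, ha2, Real.sqrt_sq ha]
  have ap : 0 < a := by
    rcases ha.eq_or_lt with h | h
    · rw [← h] at ha2; norm_num at ha2; linarith
    · exact h
  have pa : 11 / 10 * a ≤ p := by
    apply le_of_sq_le_sq _ hp0
    nlinarith
  have e : p ^ 2 + q ^ 2 = 2 * a ^ 2 := by linarith
  -- p^3 - a^3 - 3/2 a (p^2 - a^2) = (p-a)^2 (p + a/2)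
  have key1 : p ^ 3 - a ^ 3 - 3 / 2 * a * (p ^ 2 - a ^ 2) = (p - a) ^ 2 * (p + a / 2) := by ring
  have key2 : q ^ 3 - a ^ 3 - 3 / 2 * a * (q ^ 2 - a ^ 2) = (q - a) ^ 2 * (q + a / 2) := by ring
  have k3 : 0 ≤ (q - a) ^ 2 * (q + a / 2) := by positivity
  have k4 : (a / 10) ^ 2 * (a / 2) ≤ (p - a) ^ 2 * (p + a / 2) := by
    apply mul_le_mul _ (by linarith) (by linarith) (by positivity)
    apply pow_le_pow_left₀ (by linarith); linarith
  nlinarith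

lemma omega_surj {δ γ m : ℝ} (hp : PH δ γ) (hm : 0 < m) :
    ∃ R, 0 < R ∧ omegaMod δ γ R = m := by
  have h1 := hp.pos
  have h2 := hp.gpos
  set X := δ * Real.exp (4 * Real.exp (m / γ)) with hX
  have e1 : 1 ≤ Real.exp (4 * Real.exp (m / γ)) := Real.one_le_exp (by positivity)
  have hX0 : δ ≤ X := by nlinarith
  have hXm : m ≤ omegaMod δ γ X := by
    rw [omega_large hp hX0, hX, mul_div_cancel_left₀ _ h1.ne', Real.log_exp]
    have : Real.log (4 * Real.exp (m / γ)) ≤ Real.log (4 + 4 * Real.exp (m / γ)) :=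
      Real.log_le_log (by positivity) (by linarith)
    rw [Real.log_mul (by norm_num) (by positivity), Real.log_exp] at this
    have e : γ * (m / γ) = m := by field_simp
    nlinarith [sqrt_le_of_PH hp (le_refl δ)]
  have : m ∈ Icc (omegaMod δ γ 0) (omegaMod δ γ X) := by
    rw [omega_zero hp]; exact ⟨hm.le, hXm⟩
  obtain ⟨R, hR, hRm⟩ := intermediate_value_Icc (h1.le.trans hX0)
    ((omega_cont hp).mono fun x hx => hx.1) this
  refine ⟨R, ?_, hRm⟩
  rcases hR.1.eq_or_lt with h | h
  · rw [← h, omega_zero hp] at hRm; linarith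
  · exact h

lemma omega_neg {δ γ r : ℝ} (hp : PH δ γ) (hr : r ≤ 0) : omegaMod δ γ r ≤ 0 := by
  rcases hr.eq_or_lt with h | h
  · rw [h, omega_zero hp]
  · rw [omegaMod, if_pos (by linarith [hp.pos])]
    rw [Real.rpow_def_of_neg h]
    have : Real.cos (3 / 2 * Real.pi) = 0 := by
      rw [show 3 / 2 * Real.pi = Real.pi / 2 + Real.pi by ring, Real.cos_add_pi]; simp
    rw [this]; linarith

lemma omega_invFun {δ γ m : ℝ} (hp : PH δ γ) (hm : 0 < m) :
    0 < Function.invFun (omegaMod δ γ) m ∧ omegaMod δ γ (Function.invFun (omegaMod δ γ) m) = m := by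
  obtain ⟨R, -, hR⟩ := omega_surj hp hm
  have h := Function.invFun_eq ⟨R, hR⟩
  refine ⟨?_, h⟩
  by_contra hn
  have := omega_neg (γ := γ) hp (not_lt.1 hn)
  linarith

/-! ### Part 2: integrals over annuli -/

def ann (a b : ℝ) : Set E2 := {h : E2 | a < ‖h‖ ∧ ‖h‖ < b}

lemma ann_meas (a b : ℝ) : MeasurableSet (ann a b) :=
  (measurableSet_lt measurable_const measurable_norm).inter
    (measurableSet_lt measurable_norm measurable_const)

lemma ann_ne {a b : ℝ} (ha : 0 ≤ a) {h : E2} (hh : h ∈ ann a b) : h ≠ 0 := by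
  rintro rfl
  have := hh.1
  rw [norm_zero] at this
  linarith

lemma ann_int {a b : ℝ} (ha : 0 < a) {F : E2 → ℝ} (hF : ContinuousOn F {h | h ≠ 0}) :
    IntegrableOn F (ann a b) := by
  have hc : IsCompact (Metric.closedBall (0 : E2) b \ Metric.ball 0 a) :=
    (isCompact_closedBall 0 b).diff Metric.isOpen_ball
  refine ((hF.mono ?_).integrableOn_compact hc).mono_set ?_
  · rintro h ⟨-, h2⟩ h0
    apply h2
    rw [h0]
    exact Metric.mem_ball_self ha
  · rintro h ⟨h1, h2⟩
    simp only [Set.mem_sdiff, Metric.mem_closedBall, dist_zero_right, Metric.mem_ball, not_lt]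
    exact ⟨h2.le, h1.le⟩

lemma ann_vol {a b : ℝ} : volume (ann a b) < ⊤ := by
  refine (measure_mono (t := Metric.ball 0 b) ?_).trans_lt measure_ball_lt_top
  rintro h ⟨-, h2⟩
  simpa using h2

lemma ann_split {a c b : ℝ} (hc : 0 < c) (h1 : a ≤ c) (h2 : c ≤ b) {F : E2 → ℝ}
    (hF : IntegrableOn F (ann a b)) :
    ∫ h in ann a b, F h = (∫ h in ann a c, F h) + ∫ h in ann c b, F h := by
  rw [← setIntegral_union _ (ann_meas c b) (hF.mono_set _) (hF.mono_set _)]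
  · apply setIntegral_congr_set
    have hz : volume (Metric.sphere (0 : E2) c) = 0 := Measure.addHaar_sphere_of_ne_zero _ _ hc.ne'
    have : ∀ᵐ h : E2, h ∉ Metric.sphere (0 : E2) c := measure_eq_zero_iff_ae_notMem.1 hz
    filter_upwards [this] with h hh
    have hh' : ‖h‖ ≠ c := by simpa using hh
    apply propext
    show (h ∈ ann a b) ↔ (h ∈ ann a c ∪ ann c b)
    constructor
    · rintro ⟨u, v⟩
      rcases lt_or_gt_of_ne hh' with w | w
      · exact Or.inl ⟨u, w⟩
      · exact Or.inr ⟨w, v⟩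
    · rintro (⟨u, v⟩ | ⟨u, v⟩)
      · exact ⟨u, by linarith⟩
      · exact ⟨by linarith, v⟩
  · rw [Set.disjoint_left]
    rintro h ⟨-, u⟩ ⟨v, -⟩
    linarith
  · rintro h ⟨u, v⟩; exact ⟨u, by linarith⟩
  · rintro h ⟨u, v⟩; exact ⟨by linarith, v⟩

lemma ann_radial {a b : ℝ} (ha : 0 ≤ a) (hab : a ≤ b) (φ : ℝ → ℝ) :
    ∫ h in ann a b, φ ‖h‖ = 2 * Real.pi * ∫ r in a..b, r * φ r := by
  have e : ∀ h : E2, (ann a b).indicator (fun h => φ ‖h‖) h = (Ioo a b).indicator φ ‖h‖ := by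
    intro h
    by_cases hh : h ∈ ann a b
    · have : ‖h‖ ∈ Ioo a b := hh
      rw [indicator_of_mem hh, indicator_of_mem this]
    · have : ‖h‖ ∉ Ioo a b := hh
      rw [indicator_of_notMem hh, indicator_of_notMem this]
  rw [← integral_indicator (ann_meas a b)]
  simp_rw [e]
  rw [integral_fun_norm_addHaar volume ((Ioo a b).indicator φ)]
  have hd : Module.finrank ℝ E2 = 2 := by simp
  have hv : volume.real (Metric.ball (0 : E2) 1) = Real.pi := by
    rw [measureReal_def, EuclideanSpace.volume_ball_fin_two]
    simp [Real.pi_nonneg]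
  rw [hd, hv, intervalIntegral.integral_of_le hab, integral_Ioc_eq_integral_Ioo]
  have e2 : ∀ y : ℝ, y ^ (2 - 1) • (Ioo a b).indicator φ y = (Ioo a b).indicator (fun y => y * φ y) y := by
    intro y
    by_cases hy : y ∈ Ioo a b <;> simp [hy]
  simp_rw [e2]
  rw [setIntegral_indicator measurableSet_Ioo]
  have : Ioi 0 ∩ Ioo a b = Ioo a b := by
    apply inter_eq_right.2
    intro y hy
    exact ha.trans_lt hy.1
  rw [this]
  simp only [nsmul_eq_mul, smul_eq_mul]
  push_cast
  ring

lemma ann_inv1 {a b : ℝ} (ha : 0 < a) (hab : a ≤ b) :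
    ∫ h in ann a b, ‖h‖⁻¹ = 2 * Real.pi * (b - a) := by
  rw [ann_radial ha.le hab (fun r => r⁻¹)]
  congr 1
  rw [intervalIntegral.integral_congr (g := fun _ => (1 : ℝ))]
  · simp
  · intro r hr
    rw [uIcc_of_le hab] at hr
    have : r ≠ 0 := by linarith [hr.1]
    simp [this]

lemma ann_inv2 {a b : ℝ} (ha : 0 < a) (hab : a ≤ b) :
    ∫ h in ann a b, (‖h‖ ^ 2)⁻¹ = 2 * Real.pi * Real.log (b / a) := by
  rw [ann_radial ha.le hab (fun r => (r ^ 2)⁻¹)]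
  congr 1
  rw [intervalIntegral.integral_congr (g := fun r => r⁻¹), integral_inv_of_pos ha (ha.trans_le hab)]
  intro r hr
  rw [uIcc_of_le hab] at hr
  have : r ≠ 0 := by linarith [hr.1]
  field_simp

lemma ann_inv3 {a b : ℝ} (ha : 0 < a) (hab : a ≤ b) :
    ∫ h in ann a b, (‖h‖ ^ 3)⁻¹ ≤ 2 * Real.pi / a := by
  rw [ann_radial ha.le hab (fun r => (r ^ 3)⁻¹), div_eq_mul_inv]
  refine mul_le_mul_of_nonneg_left ?_ (by positivity)
  rw [intervalIntegral.integral_eq_sub_of_hasDerivAt (f := fun r => - r⁻¹)]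
  · have : 0 < b⁻¹ := inv_pos.2 (ha.trans_le hab)
    linarith
  · intro r hr
    rw [uIcc_of_le hab] at hr
    have : r ≠ 0 := by linarith [hr.1]
    have key := (hasDerivAt_inv this).fun_neg
    have e : r * (r ^ 3)⁻¹ = - -(r ^ 2)⁻¹ := by field_simp
    rw [e]
    exact key
  · apply ContinuousOn.intervalIntegrable
    intro r hr
    rw [uIcc_of_le hab] at hr
    have : r ^ 3 ≠ 0 := pow_ne_zero _ (by linarith [hr.1])
    fun_prop (disch := assumption)

lemma ann_inv52 {a b : ℝ} (ha : 0 < a) (hab : a ≤ b) :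
    ∫ h in ann a b, Real.sqrt ‖h‖ * (‖h‖ ^ 3)⁻¹ ≤ 4 * Real.pi / Real.sqrt a := by
  rw [ann_radial ha.le hab (fun r => Real.sqrt r * (r ^ 3)⁻¹)]
  have : (∫ r in a..b, r * (Real.sqrt r * (r ^ 3)⁻¹)) ≤ 2 / Real.sqrt a := by
    rw [intervalIntegral.integral_eq_sub_of_hasDerivAt (f := fun r => - (2 * (Real.sqrt r)⁻¹))]
    · have : 0 < (Real.sqrt b)⁻¹ := inv_pos.2 (Real.sqrt_pos.2 (ha.trans_le hab))
      rw [div_eq_mul_inv]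
      linarith
    · intro r hr
      rw [uIcc_of_le hab] at hr
      have r0 : 0 < r := by linarith [hr.1]
      have s0 : 0 < Real.sqrt r := Real.sqrt_pos.2 r0
      have key := (((Real.hasDerivAt_sqrt r0.ne').fun_inv s0.ne').const_mul 2).fun_neg
      have e : r * (Real.sqrt r * (r ^ 3)⁻¹) = -(2 * (-(1 / (2 * Real.sqrt r)) / Real.sqrt r ^ 2)) := by
        have e : r = Real.sqrt r ^ 2 := (Real.sq_sqrt r0.le).symm
        generalize Real.sqrt r = s at *
        subst e
        field_simp
      rw [e]
      exact key
    · apply ContinuousOn.intervalIntegrable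
      intro r hr
      rw [uIcc_of_le hab] at hr
      have : r ^ 3 ≠ 0 := pow_ne_zero _ (by linarith [hr.1])
      fun_prop (disch := assumption)
  calc _ ≤ 2 * Real.pi * (2 / Real.sqrt a) := by gcongr
    _ = _ := by ring

lemma ann_odd {a b : ℝ} (F : E2 → ℝ) (hF : ∀ h, F (-h) = - F h) :
    ∫ h in ann a b, F h = 0 := by
  have h1 : ∫ h in ann a b, F h = ∫ h in ann a b, F (-h) := by
    rw [← integral_indicator (ann_meas a b), ← integral_indicator (ann_meas a b),
      ← integral_neg_eq_self]
    congr 1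
    ext h
    by_cases hh : h ∈ ann a b
    · have : -h ∈ ann a b := by simpa [ann] using hh
      simp [hh, this]
    · have : -h ∉ ann a b := by simpa [ann] using hh
      simp [hh, this]
  simp_rw [hF, integral_neg] at h1
  linarith

/-! ### Part 3: differentiating the integrand -/

/-- First difference. -/
def dA (g : E2 → ℝ) (x h : E2) : ℝ := g (x + h) - g x
/-- First difference of the directional derivative. -/
def dAe (g : E2 → ℝ) (e x h : E2) : ℝ := fderiv ℝ g (x + h) e - fderiv ℝ g x e
/-- Second derivative term. -/
def dBe (g : E2 → ℝ) (e x h : E2) : ℝ := fderiv ℝ (fderiv ℝ g) x e h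
def sD (g : E2 → ℝ) (x h : E2) : ℝ := Real.sqrt (dA g x h ^ 2 + ‖h‖ ^ 2)

def Fint (g : E2 → ℝ) (x h : E2) : ℝ := (dA g x h - fderiv ℝ g x h) / sD g x h ^ 3

def Jint (g : E2 → ℝ) (e x h : E2) : ℝ :=
  (dAe g e x h - dBe g e x h) / sD g x h ^ 3 -
    3 * (dA g x h - fderiv ℝ g x h) * dA g x h * dAe g e x h / sD g x h ^ 5

lemma inner_grad (g : E2 → ℝ) (x h : E2) : ⟪gradient g x, h⟫ = fderiv ℝ g x h := by
  rw [gradient, InnerProductSpace.toDual_symm_apply]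

lemma norm_grad_sub (g : E2 → ℝ) (x y : E2) :
    ‖gradient g x - gradient g y‖ = ‖fderiv ℝ g x - fderiv ℝ g y‖ := by
  rw [gradient, gradient, ← map_sub, LinearIsometryEquiv.norm_map]

lemma norm_grad (g : E2 → ℝ) (x : E2) : ‖gradient g x‖ = ‖fderiv ℝ g x‖ := by
  rw [gradient, LinearIsometryEquiv.norm_map]

lemma muskat_eq_Fint (g : E2 → ℝ) (x h : E2) : muskatIntegrand 3 g x h = Fint g x h := by
  rw [muskatIntegrand, Fint, inner_grad, sD, dA]
  congr 1
  have h0 : 0 ≤ (g (x + h) - g x) ^ 2 + ‖h‖ ^ 2 := by positivity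
  generalize (g (x + h) - g x) ^ 2 + ‖h‖ ^ 2 = d at *
  rw [Real.sqrt_eq_rpow, ← Real.rpow_natCast _ 3, ← Real.rpow_mul h0]
  norm_num

lemma sD_ge (g : E2 → ℝ) (x h : E2) : ‖h‖ ≤ sD g x h :=
  Real.le_sqrt_of_sq_le (by nlinarith [sq_nonneg (dA g x h)])

lemma sD_pos (g : E2 → ℝ) (x : E2) {h : E2} (hh : h ≠ 0) : 0 < sD g x h :=
  (norm_pos_iff.2 hh).trans_le (sD_ge g x h)

lemma sD_sq (g : E2 → ℝ) (x h : E2) : sD g x h ^ 2 = dA g x h ^ 2 + ‖h‖ ^ 2 :=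
  Real.sq_sqrt (by positivity)

lemma sD_le (g : E2 → ℝ) (x h : E2) : sD g x h ≤ ‖h‖ + |dA g x h| := by
  refine Real.sqrt_le_iff.2 ⟨by positivity, ?_⟩
  nlinarith [sq_abs (dA g x h), abs_nonneg (dA g x h), norm_nonneg h,
    mul_nonneg (abs_nonneg (dA g x h)) (norm_nonneg h)]

lemma cd_fderiv {g : E2 → ℝ} (hg : ContDiff ℝ 3 g) : ContDiff ℝ 2 (fderiv ℝ g) :=
  hg.fderiv_right (by norm_num)

lemma cd_fderiv2 {g : E2 → ℝ} (hg : ContDiff ℝ 3 g) : ContDiff ℝ 1 (fderiv ℝ (fderiv ℝ g)) :=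
  (cd_fderiv hg).fderiv_right (by norm_num)

lemma symm2 {g : E2 → ℝ} (hg : ContDiff ℝ 3 g) (x v w : E2) :
    fderiv ℝ (fderiv ℝ g) x v w = fderiv ℝ (fderiv ℝ g) x w v := by
  have h2 : ContDiffAt ℝ 3 g x := hg.contDiffAt
  exact h2.isSymmSndFDerivAt (by simp only [minSmoothness_of_isRCLikeNormedField]; norm_num) v w

lemma hasDeriv_line {F : Type*} [NormedAddCommGroup F] [NormedSpace ℝ F] {u : E2 → F} {x e : E2}
    {σ : ℝ} (hu : DifferentiableAt ℝ u (x + σ • e)) :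
    HasDerivAt (fun σ : ℝ => u (x + σ • e)) (fderiv ℝ u (x + σ • e) e) σ := by
  have h1 : HasDerivAt (fun σ : ℝ => x + σ • e) e σ := by
    have := ((hasDerivAt_id σ).smul_const e).const_add x
    simpa using this
  exact hu.hasFDerivAt.comp_hasDerivAt σ h1

lemma Fint_deriv {g : E2 → ℝ} (hg : ContDiff ℝ 3 g) (e x : E2) {h : E2} (hh : h ≠ 0) (σ : ℝ) :
    HasDerivAt (fun σ : ℝ => Fint g (x + σ • e) h) (Jint g e (x + σ • e) h) σ := by
  have dg : Differentiable ℝ g := hg.differentiable (by norm_num)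
  have dg2 : Differentiable ℝ (fderiv ℝ g) := (cd_fderiv hg).differentiable (by norm_num)
  have e1 : ∀ σ : ℝ, x + σ • e + h = (x + h) + σ • e := fun σ => by abel
  have hA : HasDerivAt (fun σ : ℝ => dA g (x + σ • e) h) (dAe g e (x + σ • e) h) σ := by
    simp only [dA, dAe, e1]
    exact (hasDeriv_line (dg _)).fun_sub (hasDeriv_line (dg _))
  have hB : HasDerivAt (fun σ : ℝ => fderiv ℝ g (x + σ • e) h) (dBe g e (x + σ • e) h) σ := by
    have := (hasDeriv_line (x := x) (e := e) (σ := σ) (dg2 _)).clm_apply (hasDerivAt_const σ h)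
    simpa [dBe] using this
  have s0 := sD_pos g (x + σ • e) hh
  have hS : HasDerivAt (fun σ : ℝ => sD g (x + σ • e) h)
      (dA g (x + σ • e) h * dAe g e (x + σ • e) h / sD g (x + σ • e) h) σ := by
    have hs2 := sD_sq g (x + σ • e) h
    have := ((hA.pow 2).add_const (‖h‖ ^ 2)).sqrt (by
      show dA g (x + σ • e) h ^ 2 + ‖h‖ ^ 2 ≠ 0
      rw [← hs2]; positivity)
    refine this.congr_deriv ?_
    show _ = _ / Real.sqrt (dA g (x + σ • e) h ^ 2 + ‖h‖ ^ 2)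
    simp only [Pi.pow_apply]
    push_cast
    field_simp
    try ring
  have := (hA.fun_sub hB).fun_div (hS.fun_pow 3) (by positivity)
  refine this.congr_deriv ?_
  rw [Jint]
  field_simp
  push_cast
  ring

structure Bd (g : E2 → ℝ) (B : ℝ) : Prop where
  cd : ContDiff ℝ 3 g
  one : 1 ≤ B
  b0 : ∀ x, |g x| ≤ B
  b1 : ∀ x, ‖fderiv ℝ g x‖ ≤ B
  b2 : ∀ x, ‖fderiv ℝ (fderiv ℝ g) x‖ ≤ B
  b3 : ∀ x y, ‖fderiv ℝ (fderiv ℝ g) y - fderiv ℝ (fderiv ℝ g) x‖ ≤ B * ‖y - x‖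

lemma lip_of_fderiv {F : Type*} [NormedAddCommGroup F] [NormedSpace ℝ F] {u : E2 → F} {B : ℝ}
    (hu : Differentiable ℝ u) (hB : ∀ x, ‖fderiv ℝ u x‖ ≤ B) (x y : E2) :
    ‖u y - u x‖ ≤ B * ‖y - x‖ :=
  convex_univ.norm_image_sub_le_of_norm_fderiv_le (fun z _ => hu z) (fun z _ => hB z)
    (mem_univ x) (mem_univ y)

lemma taylor1 {F : Type*} [NormedAddCommGroup F] [NormedSpace ℝ F] {u : E2 → F} {C : ℝ}
    (hu : Differentiable ℝ u) (x h : E2)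
    (hB : ∀ k, ‖k‖ ≤ ‖h‖ → ‖fderiv ℝ u (x + k) - fderiv ℝ u x‖ ≤ C) :
    ‖u (x + h) - u x - fderiv ℝ u x h‖ ≤ C * ‖h‖ := by
  have := (convex_closedBall x ‖h‖).norm_image_sub_le_of_norm_fderiv_le' (f := u)
    (φ := fderiv ℝ u x) (C := C) (x := x) (y := x + h) (fun z _ => hu z) (fun z hz => by
      have := hB (z - x) (by rwa [mem_closedBall_iff_norm] at hz)
      rwa [add_sub_cancel] at this) (by simp) (by simp)
  simpa using this

lemma taylor2 {F : Type*} [NormedAddCommGroup F] [NormedSpace ℝ F] {u : E2 → F} {B : ℝ}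
    (hu : Differentiable ℝ u) (hu2 : Differentiable ℝ (fderiv ℝ u))
    (hB : ∀ x, ‖fderiv ℝ (fderiv ℝ u) x‖ ≤ B) (hB0 : 0 ≤ B) (x h : E2) :
    ‖u (x + h) - u x - fderiv ℝ u x h‖ ≤ B * ‖h‖ ^ 2 := by
  have := taylor1 (C := B * ‖h‖) hu x h (fun k hk => by
    have := lip_of_fderiv hu2 hB x (x + k)
    rw [add_sub_cancel_left] at this
    exact this.trans (by gcongr))
  linarith

section bounds
variable {g : E2 → ℝ} {B : ℝ}

lemma Bd.dg (hb : Bd g B) : Differentiable ℝ g := hb.cd.differentiable (by norm_num)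
lemma Bd.dg1 (hb : Bd g B) : Differentiable ℝ (fderiv ℝ g) := (cd_fderiv hb.cd).differentiable (by norm_num)
lemma Bd.dg2 (hb : Bd g B) : Differentiable ℝ (fderiv ℝ (fderiv ℝ g)) :=
  (cd_fderiv2 hb.cd).differentiable (by norm_num)

lemma Bd.dA_le (hb : Bd g B) (x h : E2) : |dA g x h| ≤ B * ‖h‖ := by
  have := lip_of_fderiv hb.dg hb.b1 x (x + h)
  rwa [add_sub_cancel_left] at this

lemma Bd.dA_le' (hb : Bd g B) (x h : E2) : |dA g x h| ≤ 2 * B := by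
  rw [dA]
  have := abs_sub (g (x + h)) (g x)
  linarith [hb.b0 x, hb.b0 (x + h)]

lemma Bd.dAB_le (hb : Bd g B) (x h : E2) : |dA g x h - fderiv ℝ g x h| ≤ B * ‖h‖ ^ 2 :=
  taylor2 hb.dg hb.dg1 hb.b2 (by linarith [hb.one]) x h

lemma apply_le (_hb : Bd g B) {e : E2} (he : ‖e‖ ≤ 1) {φ : E2 →L[ℝ] ℝ} {C : ℝ} (hφ : ‖φ‖ ≤ C) : |φ e| ≤ C :=
  calc |φ e| ≤ ‖φ‖ * ‖e‖ := φ.le_opNorm e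
    _ ≤ C * 1 := mul_le_mul hφ he (norm_nonneg _) ((norm_nonneg _).trans hφ)
    _ = C := mul_one C

lemma Bd.dAe_le (hb : Bd g B) {e : E2} (he : ‖e‖ ≤ 1) (x h : E2)
    : |dAe g e x h| ≤ B * ‖h‖ := by
  have := lip_of_fderiv hb.dg1 hb.b2 x (x + h)
  rw [add_sub_cancel_left] at this
  exact apply_le hb he this

lemma Bd.dAe_le' (hb : Bd g B) {e : E2} (he : ‖e‖ ≤ 1) (x h : E2)
    : |dAe g e x h| ≤ 2 * B := by
  rw [dAe]
  have := abs_sub (fderiv ℝ g (x + h) e) (fderiv ℝ g x e)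
  linarith [apply_le hb he (hb.b1 x), apply_le hb he (hb.b1 (x + h))]

lemma Bd.dBe_le (hb : Bd g B) {e : E2} (he : ‖e‖ ≤ 1) (x h : E2)
    : |dBe g e x h| ≤ B * ‖h‖ := by
  rw [dBe, symm2 hb.cd]
  apply apply_le hb he
  exact ((fderiv ℝ (fderiv ℝ g) x).le_opNorm h).trans (by gcongr; exact hb.b2 x)

lemma Bd.dABe_le (hb : Bd g B) {e : E2} (he : ‖e‖ ≤ 1) (x h : E2)
    : |dAe g e x h - dBe g e x h| ≤ B * ‖h‖ ^ 2 := by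
  have B0 : 0 ≤ B := by linarith [hb.one]
  have := taylor1 (C := B * ‖h‖) hb.dg1 x h (fun k hk => by
    have := hb.b3 x (x + k)
    rw [add_sub_cancel_left] at this
    exact this.trans (by gcongr))
  rw [dBe, symm2 hb.cd, dAe]
  refine (apply_le hb he this).trans (le_of_eq (by ring))

lemma Bd.J_near (hb : Bd g B) {e : E2} (he : ‖e‖ ≤ 1) (x h : E2)
    (hh : h ≠ 0) : |Jint g e x h| ≤ (B + 3 * B ^ 3) * ‖h‖⁻¹ := by
  have n0 : 0 < ‖h‖ := norm_pos_iff.2 hh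
  have sg := sD_ge g x h
  have s0 := sD_pos g x hh
  have B0 : 0 ≤ B := by linarith [hb.one]
  have t1 : |(dAe g e x h - dBe g e x h) / sD g x h ^ 3| ≤ B * ‖h‖ ^ 2 / ‖h‖ ^ 3 := by
    rw [abs_div, abs_of_pos (by positivity : 0 < sD g x h ^ 3)]
    gcongr
    exact hb.dABe_le he x h
  have t2 : |3 * (dA g x h - fderiv ℝ g x h) * dA g x h * dAe g e x h / sD g x h ^ 5| ≤
      3 * (B * ‖h‖ ^ 2) * (B * ‖h‖) * (B * ‖h‖) / ‖h‖ ^ 5 := by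
    rw [abs_div, abs_of_pos (by positivity : 0 < sD g x h ^ 5), abs_mul, abs_mul, abs_mul,
      abs_of_pos (by norm_num : (0 : ℝ) < 3)]
    gcongr
    · exact hb.dAB_le x h
    · exact hb.dA_le x h
    · exact hb.dAe_le he x h
  calc |Jint g e x h| ≤ _ := abs_sub _ _
    _ ≤ _ := add_le_add t1 t2
    _ = _ := by field_simp

lemma Bd.J_far (hb : Bd g B) {e : E2} (he : ‖e‖ ≤ 1) (x h : E2)
    (hh : h ≠ 0) :
    |Jint g e x h + dBe g e x h * (‖h‖ ^ 3)⁻¹| ≤ (2 * B + 12 * B ^ 3 + 6 * B ^ 2) * (‖h‖ ^ 3)⁻¹ := by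
  have n0 : 0 < ‖h‖ := norm_pos_iff.2 hh
  have sg := sD_ge g x h
  have s0 := sD_pos g x hh
  have sl := sD_le g x h
  have B0 : 0 ≤ B := by linarith [hb.one]
  have t1 : |dAe g e x h / sD g x h ^ 3| ≤ 2 * B / ‖h‖ ^ 3 := by
    rw [abs_div, abs_of_pos (by positivity : 0 < sD g x h ^ 3)]
    gcongr
    exact hb.dAe_le' he x h
  have t2 : |3 * (dA g x h - fderiv ℝ g x h) * dA g x h * dAe g e x h / sD g x h ^ 5| ≤
      3 * (2 * B * ‖h‖) * (B * ‖h‖) * (2 * B) / ‖h‖ ^ 5 := by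
    rw [abs_div, abs_of_pos (by positivity : 0 < sD g x h ^ 5), abs_mul, abs_mul, abs_mul,
      abs_of_pos (by norm_num : (0 : ℝ) < 3)]
    gcongr
    · refine (abs_sub _ _).trans ?_
      have u1 := hb.dA_le x h
      have u2 : |fderiv ℝ g x h| ≤ B * ‖h‖ :=
        ((fderiv ℝ g x).le_opNorm h).trans (by gcongr; exact hb.b1 x)
      linarith
    · exact hb.dA_le x h
    · exact hb.dAe_le' he x h
  have t3 : |dBe g e x h * ((‖h‖ ^ 3)⁻¹ - (sD g x h ^ 3)⁻¹)| ≤ (B * ‖h‖) * (6 * B / ‖h‖ ^ 4) := by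
    rw [abs_mul]
    have q : (sD g x h ^ 3)⁻¹ ≤ (‖h‖ ^ 3)⁻¹ := by gcongr
    rw [abs_of_nonneg (sub_nonneg.2 q)]
    apply mul_le_mul (hb.dBe_le he x h) _ (sub_nonneg.2 q) (by positivity)
    have u1 := hb.dA_le' x h
    generalize sD g x h = s at *
    have : (‖h‖ ^ 3)⁻¹ - (s ^ 3)⁻¹ = (s ^ 3 - ‖h‖ ^ 3) / (s ^ 3 * ‖h‖ ^ 3) := by
      field_simp
    rw [this, div_le_div_iff₀ (by positivity) (by positivity)]
    have v1 : s ^ 3 - ‖h‖ ^ 3 ≤ 3 * (s - ‖h‖) * s ^ 2 := by nlinarith [mul_nonneg (sq_nonneg (s - ‖h‖)) (by positivity : 0 ≤ 2 * s + ‖h‖)]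
    have v2 : s - ‖h‖ ≤ 2 * B := by linarith
    have v3 : (s - ‖h‖) * s ^ 2 ≤ 2 * B * s ^ 2 := by gcongr
    calc (s ^ 3 - ‖h‖ ^ 3) * ‖h‖ ^ 4 ≤ (6 * B * s ^ 2) * ‖h‖ ^ 4 := by gcongr; linarith
      _ ≤ (6 * B * s ^ 2) * (s * ‖h‖ ^ 3) := by
        have : ‖h‖ ^ 4 ≤ s * ‖h‖ ^ 3 := by
          have : ‖h‖ ^ 4 = ‖h‖ * ‖h‖ ^ 3 := by ring
          rw [this]; gcongr
        gcongr
      _ = _ := by ring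
  have eq : Jint g e x h + dBe g e x h * (‖h‖ ^ 3)⁻¹ =
      dAe g e x h / sD g x h ^ 3 -
      3 * (dA g x h - fderiv ℝ g x h) * dA g x h * dAe g e x h / sD g x h ^ 5 +
      dBe g e x h * ((‖h‖ ^ 3)⁻¹ - (sD g x h ^ 3)⁻¹) := by
    rw [Jint]; ring
  rw [eq]
  calc _ ≤ _ := abs_add_le _ _
    _ ≤ _ := add_le_add ((abs_sub _ _).trans (add_le_add t1 t2)) t3
    _ = _ := by field_simp; ring

end bounds

/-! ### Part 4: truncated integrals, tails -/

def IR (g : E2 → ℝ) (x : E2) (R : ℝ) : ℝ := ∫ h in ann R⁻¹ R, Fint g x h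
def JR (g : E2 → ℝ) (e x : E2) (R : ℝ) : ℝ := ∫ h in ann R⁻¹ R, Jint g e x h

lemma dA_cont {g : E2 → ℝ} (hg : ContDiff ℝ 3 g) (x : E2) : Continuous (fun h => dA g x h) := by
  have := hg.continuous
  unfold dA; fun_prop

lemma dAe_cont {g : E2 → ℝ} (hg : ContDiff ℝ 3 g) (e x : E2) :
    Continuous (fun h => dAe g e x h) := by
  have := (cd_fderiv hg).continuous
  unfold dAe; fun_prop

lemma dBe_cont (g : E2 → ℝ) (e x : E2) : Continuous (fun h => dBe g e x h) := by
  unfold dBe; fun_prop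

lemma sD_cont {g : E2 → ℝ} (hg : ContDiff ℝ 3 g) (x : E2) : Continuous (fun h => sD g x h) := by
  have := dA_cont hg x
  unfold sD; fun_prop

lemma Fint_cont {g : E2 → ℝ} (hg : ContDiff ℝ 3 g) (x : E2) :
    ContinuousOn (fun h => Fint g x h) {h | h ≠ 0} := by
  have h1 := dA_cont hg x
  have h2 := sD_cont hg x
  unfold Fint
  refine ContinuousOn.div (by fun_prop) (by fun_prop) (fun h hh => ?_)
  exact pow_ne_zero _ (sD_pos g x hh).ne'

lemma Jint_cont {g : E2 → ℝ} (hg : ContDiff ℝ 3 g) (e x : E2) :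
    ContinuousOn (fun h => Jint g e x h) {h | h ≠ 0} := by
  have h1 := dA_cont hg x
  have h2 := sD_cont hg x
  have h3 := dAe_cont hg e x
  have h4 := dBe_cont g e x
  unfold Jint
  refine ContinuousOn.sub ?_ ?_
  · refine ContinuousOn.div (by fun_prop) (by fun_prop) (fun h hh => ?_)
    exact pow_ne_zero _ (sD_pos g x hh).ne'
  · refine ContinuousOn.div (by fun_prop) (by fun_prop) (fun h hh => ?_)
    exact pow_ne_zero _ (sD_pos g x hh).ne'

lemma Jint_int {g : E2 → ℝ} (hg : ContDiff ℝ 3 g) (e x : E2) {a b : ℝ} (ha : 0 < a) :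
    IntegrableOn (fun h => Jint g e x h) (ann a b) := ann_int ha (Jint_cont hg e x)

lemma Bd.J_ann {g : E2 → ℝ} {B : ℝ} (hb : Bd g B) {e : E2} (he : ‖e‖ ≤ 1) (x : E2) {R : ℝ}
    (hR : 0 < R) {h : E2} (hh : h ∈ ann R⁻¹ R) : |Jint g e x h| ≤ (B + 3 * B ^ 3) * R := by
  refine (hb.J_near he x h (ann_ne (by positivity) hh)).trans ?_
  have B0 : 0 ≤ B := by linarith [hb.one]
  gcongr
  exact inv_le_of_inv_le₀ hR hh.1.le

lemma IR_deriv {g : E2 → ℝ} {B : ℝ} (hb : Bd g B) {e : E2} (he : ‖e‖ ≤ 1) (x : E2) {R : ℝ}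
    (hR : 0 < R) (σ : ℝ) :
    HasDerivAt (fun σ : ℝ => IR g (x + σ • e) R) (JR g e (x + σ • e) R) σ := by
  have ri : 0 < R⁻¹ := by positivity
  refine (hasDerivAt_integral_of_dominated_loc_of_deriv_le (μ := volume.restrict (ann R⁻¹ R))
    (F := fun σ h => Fint g (x + σ • e) h) (F' := fun σ h => Jint g e (x + σ • e) h)
    (bound := fun _ => (B + 3 * B ^ 3) * R) (s := univ) univ_mem ?_ ?_ ?_ ?_ ?_ ?_).2
  · exact Eventually.of_forall fun σ => (ann_int ri (Fint_cont hb.cd _)).aestronglyMeasurable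
  · exact ann_int ri (Fint_cont hb.cd _)
  · exact (Jint_int hb.cd e _ ri).aestronglyMeasurable
  · refine (ae_restrict_iff' (ann_meas _ _)).2 (Eventually.of_forall fun h hh σ _ => ?_)
    exact hb.J_ann he _ hR hh
  · exact integrableOn_const (ann_vol.ne)
  · refine (ae_restrict_iff' (ann_meas _ _)).2 (Eventually.of_forall fun h hh σ _ => ?_)
    exact Fint_deriv hb.cd e x (ann_ne ri.le hh) σ

lemma cont_inv (n : ℕ) : ContinuousOn (fun h : E2 => (‖h‖ ^ n)⁻¹) {h | h ≠ 0} := by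
  refine ContinuousOn.inv₀ (by fun_prop) (fun h hh => ?_)
  exact pow_ne_zero _ (norm_ne_zero_iff.2 hh)

lemma JR_tail {g : E2 → ℝ} {B : ℝ} (hb : Bd g B) {e : E2} (he : ‖e‖ ≤ 1) (x : E2) {R R' : ℝ}
    (hR : 1 ≤ R) (hR' : R ≤ R') :
    |JR g e x R' - JR g e x R| ≤ 2 * Real.pi * (3 * B + 6 * B ^ 2 + 15 * B ^ 3) / R := by
  have R0 : 0 < R := by linarith
  have R0' : 0 < R' := by linarith
  have B0 : 0 ≤ B := by linarith [hb.one]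
  have ri : 0 < R⁻¹ := by positivity
  have ri' : 0 < R'⁻¹ := by positivity
  have hi : R'⁻¹ ≤ R⁻¹ := by gcongr
  have hi1 : R⁻¹ ≤ R := (inv_le_one_of_one_le₀ hR).trans hR
  rw [JR, JR, ann_split (a := R'⁻¹) (c := R⁻¹) (b := R') ri hi (hi1.trans hR') (Jint_int hb.cd e x ri'),
    ann_split (a := R⁻¹) (c := R) (b := R') R0 hi1 hR' (Jint_int hb.cd e x ri)]
  have t1 : |∫ h in ann R'⁻¹ R⁻¹, Jint g e x h| ≤ (B + 3 * B ^ 3) * (2 * Real.pi * R⁻¹) := by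
    have : ∫ h in ann R'⁻¹ R⁻¹, (B + 3 * B ^ 3) * ‖h‖⁻¹ ≤ (B + 3 * B ^ 3) * (2 * Real.pi * R⁻¹) := by
      rw [integral_const_mul, ann_inv1 ri' hi]
      gcongr; linarith
    refine le_trans ?_ this
    rw [← Real.norm_eq_abs]
    apply norm_integral_le_of_norm_le
    · have := cont_inv 1
      simp only [pow_one] at this
      exact (ann_int ri' this).const_mul _
    · refine (ae_restrict_iff' (ann_meas _ _)).2 (Eventually.of_forall fun h hh => ?_)
      exact hb.J_near he _ _ (ann_ne ri'.le hh)
  have t2 : |∫ h in ann R R', Jint g e x h| ≤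
      (2 * B + 12 * B ^ 3 + 6 * B ^ 2) * (2 * Real.pi / R) := by
    have c3 : IntegrableOn (fun h : E2 => dBe g e x h * (‖h‖ ^ 3)⁻¹) (ann R R') :=
      ann_int R0 ((dBe_cont g e x).continuousOn.mul (cont_inv 3))
    have e1 : ∫ h in ann R R', Jint g e x h =
        ∫ h in ann R R', (Jint g e x h + dBe g e x h * (‖h‖ ^ 3)⁻¹) := by
      rw [integral_add (Jint_int hb.cd e x R0) c3, ann_odd (fun h => dBe g e x h * (‖h‖ ^ 3)⁻¹)]
      · simp
      · intro h; simp [dBe]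
    rw [e1]
    have : ∫ h in ann R R', (2 * B + 12 * B ^ 3 + 6 * B ^ 2) * (‖h‖ ^ 3)⁻¹ ≤
        (2 * B + 12 * B ^ 3 + 6 * B ^ 2) * (2 * Real.pi / R) := by
      rw [integral_const_mul]
      gcongr
      exact ann_inv3 R0 hR'
    refine le_trans ?_ this
    rw [← Real.norm_eq_abs]
    apply norm_integral_le_of_norm_le
    · exact (ann_int R0 (cont_inv 3)).const_mul _
    · refine (ae_restrict_iff' (ann_meas _ _)).2 (Eventually.of_forall fun h hh => ?_)
      exact hb.J_far he _ _ (ann_ne R0.le hh)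
  rw [abs_le] at *
  have : 2 * Real.pi * (3 * B + 6 * B ^ 2 + 15 * B ^ 3) / R = (B + 3 * B ^ 3) * (2 * Real.pi * R⁻¹) +
    (2 * B + 12 * B ^ 3 + 6 * B ^ 2) * (2 * Real.pi / R) := by
    field_simp; ring
  rw [this]
  constructor <;> linarith [t1.1, t1.2, t2.1, t2.2]

/-! ### Part 5: the evolution of the directional derivative -/

lemma bdd_of_decay {u : E2 → ℝ} (hc : Continuous u) (h0 : Tendsto u (cocompact E2) (𝓝 0)) :
    ∃ C, ∀ x, u x ≤ C := by
  have h1 : ∀ᶠ x in cocompact E2, u x < 1 := h0.eventually_lt_const one_pos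
  obtain ⟨K, hK, hKs⟩ := mem_cocompact.1 h1
  obtain ⟨C, hC⟩ := hK.exists_bound_of_continuousOn hc.continuousOn
  refine ⟨max C 1, fun x => ?_⟩
  by_cases hx : x ∈ K
  · exact ((le_abs_self _).trans (hC x hx)).trans (le_max_left _ _)
  · exact (le_of_lt (hKs hx)).trans (le_max_right _ _)

lemma lip_of_iter {F : Type*} [NormedAddCommGroup F] [NormedSpace ℝ F] {u : E2 → F} {B : ℝ}
    (hu : Differentiable ℝ u) (hB : ∀ x, ‖iteratedFDeriv ℝ 1 u x‖ ≤ B) (x y : E2) :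
    ‖u y - u x‖ ≤ B * ‖y - x‖ := by
  refine lip_of_fderiv hu (fun x => ?_) x y
  have := hB x
  rwa [← norm_fderiv_iteratedFDeriv, show fderiv ℝ (iteratedFDeriv ℝ 0 u) x = _ from rfl,
    norm_fderiv_iteratedFDeriv, norm_iteratedFDeriv_one] at this

lemma iter_to_Bd {g : E2 → ℝ} {B : ℝ} (hg : ContDiff ℝ 3 g) (h1 : 1 ≤ B)
    (h : ∀ i : ℕ, i ≤ 3 → ∀ x, ‖iteratedFDeriv ℝ i g x‖ ≤ B) : Bd g B where
  cd := hg
  one := h1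
  b0 x := by simpa using h 0 (by norm_num) x
  b1 x := by simpa using h 1 (by norm_num) x
  b2 x := by
    have := h 2 (by norm_num) x
    rwa [← norm_iteratedFDeriv_fderiv, norm_iteratedFDeriv_one] at this
  b3 := by
    apply lip_of_iter ((cd_fderiv2 hg).differentiable (by norm_num))
    intro x
    rw [norm_iteratedFDeriv_fderiv, norm_iteratedFDeriv_fderiv]
    exact h 3 le_rfl x

lemma sol_bd_at {T : ℝ} {f : ℝ → E2 → ℝ} (hs : SmoothDecaySol T f) {t : ℝ} (ht : t ∈ Icc 0 T) :
    ∃ B, 1 ≤ B ∧ ∀ i : ℕ, i ≤ 3 → ∀ x, ‖iteratedFDeriv ℝ i (f t) x‖ ≤ B := by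
  have h : ∀ i : ℕ, ∃ C, i ≤ 3 → ∀ x, ‖iteratedFDeriv ℝ i (f t) x‖ ≤ C := by
    intro i
    by_cases hi : i ≤ 3
    · have hc : Continuous (fun x => ‖iteratedFDeriv ℝ i (f t) x‖) :=
        ((hs.1 t ht).continuous_iteratedFDeriv (m := i) (by exact_mod_cast hi)).norm
      obtain ⟨C, hC⟩ := bdd_of_decay hc (hs.2.1 t ht i hi)
      exact ⟨C, fun _ => hC⟩
    · exact ⟨0, fun h => absurd h hi⟩
  choose C hC using h
  refine ⟨1 + |C 0| + |C 1| + |C 2| + |C 3|, ?_, ?_⟩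
  · have := abs_nonneg (C 0); have := abs_nonneg (C 1); have := abs_nonneg (C 2)
    have := abs_nonneg (C 3); linarith
  · intro i hi x
    refine (hC i hi x).trans ?_
    have := abs_nonneg (C 0); have := abs_nonneg (C 1); have := abs_nonneg (C 2)
    have := abs_nonneg (C 3)
    have := le_abs_self (C 0); have := le_abs_self (C 1); have := le_abs_self (C 2)
    have := le_abs_self (C 3)
    interval_cases i <;> linarith

lemma sol_bd {T : ℝ} {f : ℝ → E2 → ℝ} (hs : SmoothDecaySol T f) {t₁ : ℝ} (ht : t₁ ∈ Icc 0 T) :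
    ∃ B, ∃ ε > 0, ∀ t ∈ Icc 0 T, |t - t₁| < ε → Bd (f t) B := by
  obtain ⟨B, hB1, hB⟩ := sol_bd_at hs ht
  obtain ⟨ε, e0, hε⟩ := hs.2.2.1 t₁ ht 1 one_pos
  refine ⟨B + 1, ε, e0, fun t htt hte => iter_to_Bd (hs.1 t htt) (by linarith) ?_⟩
  intro i hi x
  have h1 := hε t htt hte i hi x
  have h2 := hB i hi x
  have := norm_le_norm_add_norm_sub' (iteratedFDeriv ℝ i (f t) x) (iteratedFDeriv ℝ i (f t₁) x)
  linarith

def CloseAt {F : Type*} [NormedAddCommGroup F] (T t₁ : ℝ) (Φ : ℝ → E2 → F) : Prop :=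
  ∀ ε > (0 : ℝ), ∃ δ > (0 : ℝ), ∀ t ∈ Icc 0 T, |t - t₁| < δ → ∀ x, ‖Φ t x - Φ t₁ x‖ ≤ ε

lemma sol_close {T : ℝ} {f : ℝ → E2 → ℝ} (hs : SmoothDecaySol T f) {t₁ : ℝ} (ht : t₁ ∈ Icc 0 T) :
    CloseAt T t₁ f ∧ CloseAt T t₁ (fun t => fderiv ℝ (f t)) ∧
      CloseAt T t₁ (fun t => fderiv ℝ (fderiv ℝ (f t))) := by
  have key : ∀ i : ℕ, i ≤ 3 → ∀ t ∈ Icc 0 T, ∀ x,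
      iteratedFDeriv ℝ i (f t) x - iteratedFDeriv ℝ i (f t₁) x =
        iteratedFDeriv ℝ i (f t - f t₁) x := by
    intro i hi t htt x
    have hi' : (i : WithTop ℕ∞) ≤ 3 := by exact_mod_cast hi
    rw [iteratedFDeriv_sub ((hs.1 t htt).of_le hi') ((hs.1 t₁ ht).of_le hi'), Pi.sub_apply]
  have k1 : ∀ t ∈ Icc 0 T, fderiv ℝ (f t - f t₁) = fderiv ℝ (f t) - fderiv ℝ (f t₁) := by
    intro t htt
    ext1 x
    exact fderiv_sub ((hs.1 t htt).differentiable (by norm_num) x)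
      ((hs.1 t₁ ht).differentiable (by norm_num) x)
  refine ⟨fun ε e0 => ?_, fun ε e0 => ?_, fun ε e0 => ?_⟩ <;>
    obtain ⟨δ, d0, hd⟩ := hs.2.2.1 t₁ ht ε e0 <;>
    refine ⟨δ, d0, fun t htt hte x => ?_⟩
  · have := hd t htt hte 0 (by norm_num) x
    rw [key 0 (by norm_num) t htt] at this
    simpa using this
  · have := hd t htt hte 1 (by norm_num) x
    rw [key 1 (by norm_num) t htt, norm_iteratedFDeriv_one, k1 t htt] at this
    exact this
  · have := hd t htt hte 2 (by norm_num) x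
    rw [key 2 (by norm_num) t htt, ← norm_iteratedFDeriv_fderiv, norm_iteratedFDeriv_one,
      k1 t htt] at this
    rw [show fderiv ℝ (fderiv ℝ (f t) - fderiv ℝ (f t₁)) x =
      fderiv ℝ (fderiv ℝ (f t)) x - fderiv ℝ (fderiv ℝ (f t₁)) x from
      fderiv_sub ((cd_fderiv (hs.1 t htt)).differentiable (by norm_num) x)
        ((cd_fderiv (hs.1 t₁ ht)).differentiable (by norm_num) x)] at this
    exact this

lemma close_tendsto {F : Type*} [NormedAddCommGroup F] {T t₁ : ℝ} {Φ : ℝ → E2 → F}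
    (h : CloseAt T t₁ Φ) (ht : t₁ ∈ Ioo 0 T) (hc : Continuous (Φ t₁)) (z e : E2) :
    Tendsto (fun p : ℝ × ℝ => Φ p.1 (z + p.2 • e)) (𝓝 (t₁, 0)) (𝓝 (Φ t₁ z)) := by
  rw [Metric.tendsto_nhds]
  intro ε e0
  obtain ⟨δ, d0, hd⟩ := h (ε / 2) (by positivity)
  have c1 : Tendsto (fun p : ℝ × ℝ => Φ t₁ (z + p.2 • e)) (𝓝 (t₁, 0)) (𝓝 (Φ t₁ z)) := by
    have : Continuous (fun p : ℝ × ℝ => Φ t₁ (z + p.2 • e)) := by fun_prop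
    simpa using this.tendsto (t₁, 0)
  have f1 : Tendsto (fun p : ℝ × ℝ => p.1) (𝓝 (t₁, 0)) (𝓝 t₁) := continuous_fst.tendsto (t₁, 0)
  filter_upwards [Metric.tendsto_nhds.1 c1 (ε / 2) (by positivity),
    f1.eventually (Ioo_mem_nhds ht.1 ht.2), f1.eventually (Metric.ball_mem_nhds t₁ d0)] with p p1 p2 p3
  have := hd p.1 ⟨p2.1.le, p2.2.le⟩ (by simpa [Real.dist_eq] using p3) (z + p.2 • e)
  rw [← dist_eq_norm] at this
  linarith [dist_triangle (Φ p.1 (z + p.2 • e)) (Φ t₁ (z + p.2 • e)) (Φ t₁ z)]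

lemma tendsto_clm {α F : Type*} [NormedAddCommGroup F] [NormedSpace ℝ F] {φ : α → E2 →L[ℝ] F}
    {ψ : E2 →L[ℝ] F} {l : Filter α} (h : Tendsto φ l (𝓝 ψ)) (v : E2) :
    Tendsto (fun p => φ p v) l (𝓝 (ψ v)) :=
  ((ContinuousLinearMap.apply ℝ F v).continuous.tendsto ψ).comp h

lemma JR_tendsto {T : ℝ} {f : ℝ → E2 → ℝ} (hs : SmoothDecaySol T f) {t₁ : ℝ} (ht : t₁ ∈ Ioo 0 T)
    {e : E2} (he : ‖e‖ ≤ 1) (x : E2) {R : ℝ} (hR : 0 < R) :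
    Tendsto (fun p : ℝ × ℝ => JR (f p.1) e (x + p.2 • e) R) (𝓝 (t₁, 0)) (𝓝 (JR (f t₁) e x R)) := by
  have ht' : t₁ ∈ Icc 0 T := ⟨ht.1.le, ht.2.le⟩
  obtain ⟨B, ε, e0, hB⟩ := sol_bd hs ht'
  obtain ⟨c0, c1, c2⟩ := sol_close hs ht'
  have ri : 0 < R⁻¹ := by positivity
  have f1 : Tendsto (fun p : ℝ × ℝ => p.1) (𝓝 (t₁, 0)) (𝓝 t₁) := continuous_fst.tendsto (t₁, 0)
  have ev : ∀ᶠ p : ℝ × ℝ in 𝓝 (t₁, 0), Bd (f p.1) B := by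
    filter_upwards [f1.eventually (Ioo_mem_nhds ht.1 ht.2),
      f1.eventually (Metric.ball_mem_nhds t₁ e0)] with p p2 p3
    exact hB p.1 ⟨p2.1.le, p2.2.le⟩ (by simpa [Real.dist_eq] using p3)
  have hcd := hs.1 t₁ ht'
  refine tendsto_integral_filter_of_dominated_convergence (fun _ => (B + 3 * B ^ 3) * R) ?_ ?_ ?_ ?_
  · filter_upwards [ev] with p hp
    exact (Jint_int hp.cd e _ ri).aestronglyMeasurable
  · filter_upwards [ev] with p hp
    refine (ae_restrict_iff' (ann_meas _ _)).2 (Eventually.of_forall fun h hh => ?_)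
    exact hp.J_ann he _ hR hh
  · exact integrableOn_const (ann_vol.ne)
  · refine (ae_restrict_iff' (ann_meas _ _)).2 (Eventually.of_forall fun h hh => ?_)
    have hh0 : h ≠ 0 := ann_ne ri.le hh
    have a0 := close_tendsto c0 ht hcd.continuous
    have a1 := close_tendsto c1 ht (cd_fderiv hcd).continuous
    have a2 := close_tendsto c2 ht (cd_fderiv2 hcd).continuous
    have e1 : ∀ σ : ℝ, x + σ • e + h = (x + h) + σ • e := fun σ => by abel
    have hA : Tendsto (fun p : ℝ × ℝ => dA (f p.1) (x + p.2 • e) h) (𝓝 (t₁, 0))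
        (𝓝 (dA (f t₁) x h)) := by
      simp only [dA, e1]
      exact (a0 (x + h) e).sub (a0 x e)
    have hAe : Tendsto (fun p : ℝ × ℝ => dAe (f p.1) e (x + p.2 • e) h) (𝓝 (t₁, 0))
        (𝓝 (dAe (f t₁) e x h)) := by
      simp only [dAe, e1]
      exact (tendsto_clm (a1 (x + h) e) e).sub (tendsto_clm (a1 x e) e)
    have hD : Tendsto (fun p : ℝ × ℝ => fderiv ℝ (f p.1) (x + p.2 • e) h) (𝓝 (t₁, 0))
        (𝓝 (fderiv ℝ (f t₁) x h)) := tendsto_clm (a1 x e) h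
    have hBe : Tendsto (fun p : ℝ × ℝ => dBe (f p.1) e (x + p.2 • e) h) (𝓝 (t₁, 0))
        (𝓝 (dBe (f t₁) e x h)) :=
      tendsto_clm (tendsto_clm (a2 x e) e) h
    have hS : Tendsto (fun p : ℝ × ℝ => sD (f p.1) (x + p.2 • e) h) (𝓝 (t₁, 0))
        (𝓝 (sD (f t₁) x h)) := ((hA.pow 2).add_const _).sqrt
    have s0 := sD_pos (f t₁) x hh0
    exact ((hAe.sub hBe).div (hS.pow 3) (by positivity)).sub
      (((((hA.sub hD).const_mul 3).mul hA).mul hAe).div (hS.pow 5) (by positivity))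

lemma mvt_le {v v' : ℝ → ℝ} {a b c C : ℝ} (hab : a ≤ b)
    (h : ∀ s ∈ Icc a b, HasDerivWithinAt v (v' s) (Icc a b) s) (hc : ∀ s ∈ Icc a b, |v' s - c| ≤ C) :
    |v b - v a - (b - a) * c| ≤ C * (b - a) := by
  have h2 : ∀ s ∈ Icc a b, HasDerivWithinAt (fun s => v s - s * c) (v' s - c) (Icc a b) s := by
    intro s hs
    have := (h s hs).fun_sub (((hasDerivAt_id s).mul_const c).hasDerivWithinAt (s := Icc a b))
    simpa using this
  have := (convex_Icc a b).norm_image_sub_le_of_norm_hasDerivWithin_le h2 hc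
    (left_mem_Icc.2 hab) (right_mem_Icc.2 hab)
  rw [Real.norm_eq_abs, Real.norm_eq_abs, abs_of_nonneg (sub_nonneg.2 hab)] at this
  convert this using 2
  ring

lemma mvt_le_Ico {v v' : ℝ → ℝ} {a b c C : ℝ} (hab : a ≤ b) 
    (h : ∀ s ∈ Icc a b, HasDerivAt v (v' s) s) (hc : ∀ s ∈ Icc a b, |v' s - c| ≤ C) :
    |v b - v a - (b - a) * c| ≤ C * (b - a) :=
  mvt_le hab (fun s hs => (h s hs).hasDerivWithinAt) hc

lemma evol1 {T : ℝ} {f : ℝ → E2 → ℝ} (hs : SmoothDecaySol T f) {t₁ : ℝ} (ht : t₁ ∈ Ioo 0 T)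
    {e : E2} (he : ‖e‖ ≤ 1) (x : E2) {η : ℝ} (hη : 0 < η) :
    ∃ R1, ∀ R ≥ R1, ∃ ε > 0, ∀ s ∈ Ioo (t₁ - ε) t₁,
      |fderiv ℝ (f t₁) x e - fderiv ℝ (f s) x e - (t₁ - s) * JR (f t₁) e x R| ≤ η * (t₁ - s) := by
  have ht' : t₁ ∈ Icc 0 T := ⟨ht.1.le, ht.2.le⟩
  obtain ⟨B, εb, eb0, hB⟩ := sol_bd hs ht'
  have B1 : 1 ≤ B := (hB t₁ ht' (by simpa using eb0)).one
  set C := 2 * Real.pi * (3 * B + 6 * B ^ 2 + 15 * B ^ 3) with hC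
  have C0 : 0 < C := by have := Real.pi_pos; positivity
  refine ⟨max 1 (2 * C / η), fun R hR => ?_⟩
  have R1 : 1 ≤ R := (le_max_left _ _).trans hR
  have R2 : 2 * C / η ≤ R := (le_max_right _ _).trans hR
  have R0 : 0 < R := by linarith
  have CR : C / R ≤ η / 2 := by
    rw [div_le_iff₀ hη] at R2
    rw [div_le_iff₀ R0]; linarith
  obtain ⟨ρ, r0, hρ⟩ := Metric.tendsto_nhds_nhds.1 (JR_tendsto hs ht he x R0) (η / 2) (by positivity)
  set J := JR (f t₁) e x R with hJ
  -- radius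
  obtain ⟨ε, e0, hε⟩ : ∃ ε > 0, ∀ s, |s - t₁| < ε → s ∈ Ioo 0 T ∧ |s - t₁| < ρ ∧ |s - t₁| < εb := by
    refine ⟨min (min t₁ (T - t₁)) (min ρ εb), ?_, fun s hs' => ?_⟩
    · have := ht.1; have := ht.2
      simp only [gt_iff_lt, lt_min_iff]
      exact ⟨⟨by linarith, by linarith⟩, r0, eb0⟩
    · simp only [lt_min_iff] at hs'
      have := abs_lt.1 hs'.1.1; have := abs_lt.1 hs'.1.2
      exact ⟨⟨by linarith, by linarith⟩, hs'.2⟩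
  refine ⟨ε, e0, fun s hss => ?_⟩
  have near : ∀ s', |s' - t₁| < ε → ∀ σ : ℝ, |σ| < ρ → ∀ R' ≥ R,
      |JR (f s') e (x + σ • e) R' - J| ≤ η := by
    intro s' hs' σ hσ R' hR'
    obtain ⟨q1, q2, q3⟩ := hε s' hs'
    have hb := hB s' ⟨q1.1.le, q1.2.le⟩ q3
    have t1 := JR_tail hb he (x + σ • e) R1 hR'
    have t2 := hρ (x := (s', σ)) (by
      rw [Prod.dist_eq, max_lt_iff]
      simp only [Real.dist_eq, sub_zero]
      exact ⟨q2, hσ⟩)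
    rw [Real.dist_eq] at t2
    rw [← hC] at t1
    rw [abs_le] at *
    rw [abs_lt] at t2
    constructor <;> linarith [t1.1, t1.2, t2.1, t2.2]
  have vder : ∀ τ ∈ Ioo 0 ρ, ∀ s', |s' - t₁| < ε →
      |deriv (fun s => f s (x + τ • e)) s' - deriv (fun s => f s x) s' - τ * J| ≤ η * τ := by
    intro τ hτ s' hs'
    obtain ⟨q1, q2, q3⟩ := hε s' hs'
    have hb := hB s' ⟨q1.1.le, q1.2.le⟩ q3
    have p1 := hs.2.2.2.2 s' q1 (x + τ • e)
    have p2 := hs.2.2.2.2 s' q1 x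
    have pv : ∀ z, (fun R => ∫ h in {h : E2 | R⁻¹ < ‖h‖ ∧ ‖h‖ < R}, muskatIntegrand 3 (f s') z h) =
        fun R => IR (f s') z R := by
      intro z; ext R
      simp only [muskat_eq_Fint]
      rfl
    rw [HasPV, pv] at p1 p2
    have lim := ((p1.sub p2).sub_const (τ * J)).abs
    refine le_of_tendsto lim ?_
    filter_upwards [eventually_ge_atTop R] with R' hR'
    have := mvt_le (v := fun σ => IR (f s') (x + σ • e) R') (a := 0) (b := τ) (c := J) (C := η) hτ.1.le
      (fun σ hσ => (IR_deriv hb he x (by linarith) σ).hasDerivWithinAt)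
      (fun σ hσ => near s' hs' σ (by rw [abs_of_nonneg hσ.1]; linarith [hσ.2, hτ.2]) R' hR')
    simpa using this
  have vint : ∀ τ ∈ Ioo 0 ρ,
      |(f t₁ (x + τ • e) - f t₁ x) - (f s (x + τ • e) - f s x) - (t₁ - s) * (τ * J)| ≤
        η * τ * (t₁ - s) := by
    intro τ hτ
    refine mvt_le (v := fun s => f s (x + τ • e) - f s x) (c := τ * J) (C := η * τ) hss.2.le
      (v' := fun s' => deriv (fun s => f s (x + τ • e)) s' - deriv (fun s => f s x) s') ?_ ?_
    · intro s' hs'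
      have q := (hε s' (by rw [abs_lt]; constructor <;> linarith [hss.1, hs'.1, hs'.2])).1
      exact ((hs.2.2.2.1 s' q _).hasDerivAt.fun_sub (hs.2.2.2.1 s' q _).hasDerivAt).hasDerivWithinAt
    · intro s' hs'
      exact vder τ hτ s' (by rw [abs_lt]; constructor <;> linarith [hss.1, hs'.1, hs'.2])
  have hss' : s ∈ Icc 0 T := by
    have := (hε s (by rw [abs_lt]; constructor <;> linarith [hss.1, hss.2])).1
    exact ⟨this.1.le, this.2.le⟩
  have slope : ∀ t ∈ Icc 0 T, Tendsto (fun τ : ℝ => τ⁻¹ * (f t (x + τ • e) - f t x)) (𝓝[>] 0)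
      (𝓝 (fderiv ℝ (f t) x e)) := by
    intro t htt
    have := hasDeriv_line (u := f t) (x := x) (e := e) (σ := 0)
      ((hs.1 t htt).differentiable (by norm_num) _)
    have := this.tendsto_slope_zero_right
    simpa using this
  have lim := (((slope t₁ ht').sub (slope s hss')).sub_const ((t₁ - s) * J)).abs
  refine le_of_tendsto lim ?_
  filter_upwards [Ioo_mem_nhdsGT r0] with τ hτ
  have := vint τ hτ
  have t0 := hτ.1
  have e1 : τ⁻¹ * (f t₁ (x + τ • e) - f t₁ x) - τ⁻¹ * (f s (x + τ • e) - f s x) - (t₁ - s) * J =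
    τ⁻¹ * ((f t₁ (x + τ • e) - f t₁ x) - (f s (x + τ • e) - f s x) - (t₁ - s) * (τ * J)) := by
    field_simp
  rw [e1, abs_mul, abs_of_pos (inv_pos.2 t0)]
  calc _ ≤ τ⁻¹ * (η * τ * (t₁ - s)) := by gcongr
    _ = _ := by field_simp

/-! ### Part 6: pointwise static estimates -/

def cK (α : ℝ) : ℝ := (Real.sqrt (1 + α ^ 2))⁻¹
def qK (α β : ℝ) : ℝ := 1 - 2 * α ^ 2 + 3 * α * β
def KK (α β : ℝ) : ℝ := qK α β * cK α ^ 5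

lemma cK_root_ge (α : ℝ) : 1 ≤ Real.sqrt (1 + α ^ 2) :=
  Real.le_sqrt_of_sq_le (by nlinarith [sq_nonneg α])

lemma cK_pos (α : ℝ) : 0 < cK α := by
  have := cK_root_ge α
  unfold cK; positivity

lemma cK_le (α : ℝ) : cK α ≤ 1 := inv_le_one_of_one_le₀ (cK_root_ge α)

lemma cK_sq (α : ℝ) : cK α ^ 2 * (1 + α ^ 2) = 1 := by
  unfold cK
  rw [inv_pow, Real.sq_sqrt (by positivity)]
  have : 0 < 1 + α ^ 2 := by positivity
  field_simp

lemma root_lip (α β : ℝ) : |Real.sqrt (1 + α ^ 2) - Real.sqrt (1 + β ^ 2)| ≤ |α - β| := by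
  have key : ∀ α β : ℝ, Real.sqrt (1 + α ^ 2) ≤ Real.sqrt (1 + β ^ 2) + |α - β| := by
    intro α β
    refine Real.sqrt_le_iff.2 ⟨by positivity, ?_⟩
    have h1 := Real.sq_sqrt (by positivity : 0 ≤ 1 + β ^ 2)
    have h2 : |β| ≤ Real.sqrt (1 + β ^ 2) := Real.le_sqrt_of_sq_le (by rw [sq_abs]; linarith)
    have h3 : β * (α - β) ≤ |β| * |α - β| := by rw [← abs_mul]; exact le_abs_self _
    have h4 : |β| * |α - β| ≤ Real.sqrt (1 + β ^ 2) * |α - β| := by gcongr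
    nlinarith [sq_abs (α - β)]
  rw [abs_le]
  have h1 := key α β
  have h2 := key β α
  rw [abs_sub_comm β α] at h2
  constructor <;> linarith

lemma cK_lip (α β : ℝ) : |cK α - cK β| ≤ |α - β| := by
  have h1 := cK_root_ge α
  have h2 := cK_root_ge β
  have h3 := root_lip β α
  unfold cK
  rw [abs_sub_comm α β]
  generalize Real.sqrt (1 + α ^ 2) = r at *
  generalize Real.sqrt (1 + β ^ 2) = s at *
  have : r⁻¹ - s⁻¹ = (s - r) / (r * s) := by field_simp
  rw [this, abs_div, abs_of_pos (by positivity : 0 < r * s)]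
  refine (div_le_self (abs_nonneg _) ?_).trans h3
  nlinarith

lemma pow_lip {c d : ℝ} (c0 : 0 ≤ c) (c1 : c ≤ 1) (d0 : 0 ≤ d) (d1 : d ≤ 1) (n : ℕ) :
    |c ^ n - d ^ n| ≤ n * |c - d| := by
  induction n with
  | zero => simp
  | succ n ih =>
    have : c ^ (n + 1) - d ^ (n + 1) = c * (c ^ n - d ^ n) + (c - d) * d ^ n := by ring
    rw [this]
    refine (abs_add_le _ _).trans ?_
    rw [abs_mul, abs_mul, abs_of_nonneg c0, abs_of_nonneg (pow_nonneg d0 n)]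
    have e1 : c * |c ^ n - d ^ n| ≤ 1 * (n * |c - d|) :=
      mul_le_mul c1 ih (abs_nonneg _) zero_le_one
    have e2 : |c - d| * d ^ n ≤ |c - d| * 1 := by gcongr; exact pow_le_one₀ d0 d1
    push_cast
    linarith

lemma c3_lip (α β : ℝ) : |cK α ^ 3 - cK β ^ 3| ≤ 3 * |α - β| := by
  have := pow_lip (cK_pos α).le (cK_le α) (cK_pos β).le (cK_le β) 3
  have := cK_lip α β
  push_cast at *
  linarith

lemma c5_lip (α β : ℝ) : |cK α ^ 5 - cK β ^ 5| ≤ 5 * |α - β| := by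
  have := pow_lip (cK_pos α).le (cK_le α) (cK_pos β).le (cK_le β) 5
  have := cK_lip α β
  push_cast at *
  linarith

lemma M_half {M : ℝ} (h0 : 0 ≤ M) (h : 5 * M ^ 2 < 1) : M ≤ 9 / 20 := by nlinarith

lemma mul_abs_le {a b M : ℝ} (ha : |a| ≤ M) (hb : |b| ≤ M) : |a * b| ≤ M ^ 2 := by
  rw [abs_mul, sq]
  exact mul_le_mul ha hb (abs_nonneg _) ((abs_nonneg _).trans ha)

lemma KK_ge {M α β : ℝ} (h : 5 * M ^ 2 < 1) (ha : |α| ≤ M) (hb : |β| ≤ M) :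
    (1 - 5 * M ^ 2) / 2 ≤ KK α β := by
  have h1 := (abs_le.1 (mul_abs_le ha hb)).1
  have h2 : α ^ 2 ≤ M ^ 2 := by rw [← sq_abs]; gcongr
  have hq : 1 - 5 * M ^ 2 ≤ qK α β := by unfold qK; linarith
  have c0 := cK_pos α
  have c1 := cK_le α
  have c2 := cK_sq α
  have s1 : 5 / 6 ≤ cK α ^ 2 := by nlinarith [sq_nonneg (cK α)]
  have s2 : 5 / 6 ≤ cK α := by nlinarith
  have s3 : 1 / 2 ≤ cK α ^ 5 := by
    have : cK α ^ 5 = cK α ^ 2 * (cK α ^ 2 * cK α) := by ring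
    rw [this]
    nlinarith [mul_le_mul s1 s2 (by norm_num) (by positivity : 0 ≤ cK α ^ 2)]
  unfold KK
  calc (1 - 5 * M ^ 2) / 2 = (1 - 5 * M ^ 2) * (1 / 2) := by ring
    _ ≤ _ := mul_le_mul hq s3 (by norm_num) (by linarith)

lemma KK_lip {M α β α' β' : ℝ} (h0 : 0 ≤ M) (h : 5 * M ^ 2 < 1) (ha : |α| ≤ M) (hb : |β| ≤ M)
    (ha' : |α'| ≤ M) (hb' : |β'| ≤ M) :
    |KK α β - KK α' β'| ≤ 14 * (|α - α'| + |β - β'|) := by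
  have hM := M_half h0 h
  have e1 : KK α β - KK α' β' = (qK α β - qK α' β') * cK α ^ 5 +
    qK α' β' * (cK α ^ 5 - cK α' ^ 5) := by unfold KK; ring
  have q1 : |qK α' β'| ≤ 2 := by
    have h1 := abs_le.1 (mul_abs_le ha' hb')
    have h2 := abs_le.1 (mul_abs_le ha' ha')
    unfold qK
    rw [abs_le]
    constructor <;> nlinarith [h1.1, h1.2, h2.1, h2.2, sq_nonneg α']
  have q2 : |qK α β - qK α' β'| ≤ 4 * |α - α'| + 2 * |β - β'| := by
    have : qK α β - qK α' β' = (α - α') * (-2 * (α + α') + 3 * β') + (β - β') * (3 * α) := by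
      unfold qK; ring
    rw [this]
    refine (abs_add_le _ _).trans ?_
    rw [abs_mul, abs_mul, mul_comm 4, mul_comm 2]
    have := abs_le.1 ha; have := abs_le.1 ha'; have := abs_le.1 hb'
    have b1 : |-2 * (α + α') + 3 * β'| ≤ 4 := by rw [abs_le]; constructor <;> linarith
    have b2 : |3 * α| ≤ 2 := by rw [abs_le]; constructor <;> linarith
    gcongr
  rw [e1]
  refine (abs_add_le _ _).trans ?_
  rw [abs_mul, abs_mul, abs_of_nonneg (pow_nonneg (cK_pos α).le 5)]
  have u1 : |qK α β - qK α' β'| * cK α ^ 5 ≤ (4 * |α - α'| + 2 * |β - β'|) * 1 := by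
    gcongr
    · exact pow_nonneg (cK_pos α).le 5
    · exact pow_le_one₀ (cK_pos α).le (cK_le α)
  have u2 : |qK α' β'| * |cK α ^ 5 - cK α' ^ 5| ≤ 2 * (5 * |α - α'|) := by
    gcongr
    exact c5_lip α α'
  linarith [abs_nonneg (β - β')]

lemma KK_sub {M α β ν : ℝ} (h0 : 0 ≤ M) (h : 5 * M ^ 2 < 1) (ha : |α| ≤ M) (hν : |α - β| ≤ ν) :
    |KK α β - cK α ^ 3| ≤ 3 / 2 * ν := by
  have hM := M_half h0 h
  have e1 : KK α β - cK α ^ 3 = cK α ^ 5 * (-3 * α) * (α - β) := by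
    have : cK α ^ 3 = cK α ^ 5 * (1 + α ^ 2) := by
      linear_combination (-(cK α ^ 3)) * cK_sq α
    rw [this]; unfold KK qK; ring
  rw [e1, abs_mul, abs_mul, abs_of_nonneg (pow_nonneg (cK_pos α).le 5)]
  have c1 : cK α ^ 5 ≤ 1 := pow_le_one₀ (cK_pos α).le (cK_le α)
  have c0 : 0 ≤ cK α ^ 5 := pow_nonneg (cK_pos α).le 5
  have := abs_le.1 ha
  have b2 : |-3 * α| ≤ 3 / 2 := by rw [abs_le]; constructor <;> linarith
  calc cK α ^ 5 * |-3 * α| * |α - β| ≤ 1 * (3 / 2) * ν := by gcongr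
    _ = _ := by ring

lemma Jint_eq (g : E2 → ℝ) (e x : E2) {h : E2} (hh : h ≠ 0) :
    Jint g e x h = (dAe g e x h * KK (dA g x h / ‖h‖) (fderiv ℝ g x h / ‖h‖) -
      dBe g e x h * cK (dA g x h / ‖h‖) ^ 3) * (‖h‖ ^ 3)⁻¹ := by
  have n0 : 0 < ‖h‖ := norm_pos_iff.2 hh
  obtain ⟨α, hα⟩ : ∃ α, dA g x h = α * ‖h‖ := ⟨dA g x h / ‖h‖, by field_simp⟩
  obtain ⟨β, hβ⟩ : ∃ β, fderiv ℝ g x h = β * ‖h‖ := ⟨fderiv ℝ g x h / ‖h‖, by field_simp⟩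
  have e1 : dA g x h / ‖h‖ = α := by rw [hα]; field_simp
  have e2 : fderiv ℝ g x h / ‖h‖ = β := by rw [hβ]; field_simp
  have e3 : sD g x h = Real.sqrt (1 + α ^ 2) * ‖h‖ := by
    rw [sD, hα, show (α * ‖h‖) ^ 2 + ‖h‖ ^ 2 = (1 + α ^ 2) * ‖h‖ ^ 2 by ring,
      Real.sqrt_mul (by positivity), Real.sqrt_sq n0.le]
  rw [e1, e2, Jint, e3, hα, hβ, KK, qK, cK]
  have r1 := cK_root_ge α
  have r2 := Real.sq_sqrt (by positivity : 0 ≤ 1 + α ^ 2)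
  generalize Real.sqrt (1 + α ^ 2) = r at *
  generalize dAe g e x h = A
  generalize dBe g e x h = D
  have r0 : 0 < r := by linarith
  field_simp
  linear_combination (A) * r2

structure Touch (δ γ M L : ℝ) (g : E2 → ℝ) (e v x y : E2) (ξ : ℝ) : Prop where
  ph : PH δ γ
  cd : ContDiff ℝ 3 g
  L0 : 0 < L
  M0 : 0 ≤ M
  M5 : 5 * M ^ 2 < 1
  slope : ∀ z, ‖fderiv ℝ g z‖ ≤ M
  he : ‖e‖ ≤ 1
  hv : ‖v‖ = 1
  x0 : 0 < ξ
  xy : x = y + ξ • v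
  mod : ∀ z z', ‖fderiv ℝ g z - fderiv ℝ g z'‖ ≤ omegaMod δ γ (L * ‖z - z'‖)
  eq : fderiv ℝ g x e - fderiv ℝ g y e = omegaMod δ γ (L * ξ)

lemma apply_le' {e : E2} (he : ‖e‖ ≤ 1) {φ : E2 →L[ℝ] ℝ} {C : ℝ} (hφ : ‖φ‖ ≤ C) : |φ e| ≤ C :=
  calc |φ e| ≤ ‖φ‖ * ‖e‖ := φ.le_opNorm e
    _ ≤ C * 1 := mul_le_mul hφ he (norm_nonneg _) ((norm_nonneg _).trans hφ)
    _ = C := mul_one C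

lemma deriv_touch {φ : ℝ → ℝ} {d A C : ℝ} (h0 : φ 0 = 0) (hd : HasDerivAt φ d 0)
    (hle : ∀ t, φ t ≤ A * t + C * t ^ 2) : d = A := by
  have h1 : HasDerivAt (fun t => φ t - (A * t + C * t ^ 2)) (d - A) 0 := by
    have := hd.fun_sub ((((hasDerivAt_id (0 : ℝ)).const_mul A)).fun_add
      (((hasDerivAt_id (0 : ℝ)).fun_pow 2).const_mul C))
    simpa using this
  have h2 : IsLocalMax (fun t => φ t - (A * t + C * t ^ 2)) 0 := by
    refine Eventually.of_forall fun t => ?_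
    have := hle t
    simp only [h0]
    linarith
  have := h2.hasDerivAt_eq_zero h1
  linarith

lemma norm_shift {ξ : ℝ} (x0 : 0 < ξ) {v : E2} (hv : ‖v‖ = 1) (h : E2) :
    ‖ξ • v + h‖ ≤ ξ + (⟪v, h⟫ + ‖h‖ ^ 2 / (2 * ξ)) := by
  have h1 : ‖ξ • v + h‖ ^ 2 = ξ ^ 2 + 2 * ξ * ⟪v, h⟫ + ‖h‖ ^ 2 := by
    rw [norm_add_sq_real, norm_smul, hv, inner_smul_left, Real.norm_eq_abs, abs_of_pos x0]
    simp; ring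
  have h2 : ξ + (⟪v, h⟫ + ‖h‖ ^ 2 / (2 * ξ)) = (‖ξ • v + h‖ ^ 2 + ξ ^ 2) / (2 * ξ) := by
    rw [h1]; field_simp; ring
  rw [h2, le_div_iff₀ (by positivity)]
  nlinarith [sq_nonneg (‖ξ • v + h‖ - ξ)]

lemma shift_fderiv {g : E2 → ℝ} (dg : Differentiable ℝ g) (c z : E2) :
    HasFDerivAt (fun z => g (z + c)) (fderiv ℝ g (z + c)) z := by
  have h1 : HasFDerivAt (fun z : E2 => z + c) (ContinuousLinearMap.id ℝ E2) z :=
    (hasFDerivAt_id z).add_const c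
  have := (dg (z + c)).hasFDerivAt.comp z h1
  rwa [ContinuousLinearMap.comp_id] at this

namespace Touch
variable {δ γ M L : ℝ} {g : E2 → ℝ} {e v x y : E2} {ξ : ℝ}

/-- slope of the modulus -/
def pp (δ γ L ξ : ℝ) : ℝ := L * omegaP δ γ (L * ξ)

lemma pp_pos (H : Touch δ γ M L g e v x y ξ) : 0 < pp δ γ L ξ :=
  mul_pos H.L0 (omegaP_pos H.ph)

lemma modE (H : Touch δ γ M L g e v x y ξ) (z z' : E2) :
    fderiv ℝ g z e - fderiv ℝ g z' e ≤ omegaMod δ γ (L * ‖z - z'‖) :=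
  (le_abs_self _).trans (apply_le' H.he (H.mod z z'))

lemma Ax_le0 (H : Touch δ γ M L g e v x y ξ) (h : E2) :
    dAe g e x h ≤ omegaMod δ γ (L * ‖ξ • v + h‖) - omegaMod δ γ (L * ξ) := by
  have h1 := H.modE (x + h) y
  have e1 : x + h - y = ξ • v + h := by rw [H.xy]; abel
  rw [e1] at h1
  rw [dAe]; linarith [H.eq]

lemma Ay_le0 (H : Touch δ γ M L g e v x y ξ) (h : E2) :
    -dAe g e y h ≤ omegaMod δ γ (L * ‖ξ • v + -h‖) - omegaMod δ γ (L * ξ) := by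
  have h1 := H.modE x (y + h)
  have e1 : x - (y + h) = ξ • v + -h := by rw [H.xy]; abel
  rw [e1] at h1
  rw [dAe]; linarith [H.eq]

lemma W_sup (H : Touch δ γ M L g e v x y ξ) (h : E2) :
    omegaMod δ γ (L * ‖ξ • v + h‖) - omegaMod δ γ (L * ξ) ≤
      pp δ γ L ξ * (⟪v, h⟫ + ‖h‖ ^ 2 / (2 * ξ)) := by
  have L0 := H.L0
  have x0 := H.x0
  have h1 := omega_sup (s := L * ‖ξ • v + h‖) H.ph (mul_pos L0 x0) (by positivity)
  have h2 := norm_shift x0 H.hv h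
  have h3 : omegaP δ γ (L * ξ) * (L * ‖ξ • v + h‖ - L * ξ) =
    pp δ γ L ξ * (‖ξ • v + h‖ - ξ) := by unfold pp; ring
  have h4 : pp δ γ L ξ * (‖ξ • v + h‖ - ξ) ≤ pp δ γ L ξ * (⟪v, h⟫ + ‖h‖ ^ 2 / (2 * ξ)) :=
    mul_le_mul_of_nonneg_left (by linarith) H.pp_pos.le
  linarith

lemma W_far (H : Touch δ γ M L g e v x y ξ) (h : E2) :
    omegaMod δ γ (L * ‖ξ • v + h‖) ≤ omegaMod δ γ (L * (ξ + ‖h‖)) := by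
  have L0 := H.L0
  apply omega_mono H.ph (by positivity)
  gcongr
  refine (norm_add_le _ _).trans ?_
  rw [norm_smul, H.hv, Real.norm_eq_abs, abs_of_pos H.x0, mul_one]

lemma Ax_le (H : Touch δ γ M L g e v x y ξ) (h : E2) :
    dAe g e x h ≤ pp δ γ L ξ * (⟪v, h⟫ + ‖h‖ ^ 2 / (2 * ξ)) := (H.Ax_le0 h).trans (H.W_sup h)

lemma Ay_le (H : Touch δ γ M L g e v x y ξ) (h : E2) :
    -dAe g e y h ≤ pp δ γ L ξ * (-⟪v, h⟫ + ‖h‖ ^ 2 / (2 * ξ)) := by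
  have := (H.Ay_le0 h).trans (H.W_sup (-h))
  rwa [inner_neg_right, norm_neg] at this

lemma dline (H : Touch δ γ M L g e v x y ξ) (z h : E2) :
    HasDerivAt (fun t : ℝ => dAe g e z (t • h)) (dBe g e z h) 0 := by
  have d1 := hasDeriv_line (u := fderiv ℝ g) (x := z) (e := h) (σ := 0)
    ((cd_fderiv H.cd).differentiable (by norm_num) _)
  have d2 := d1.clm_apply (hasDerivAt_const (0 : ℝ) e)
  have d3 := d2.sub_const (fderiv ℝ g z e)
  rw [dBe, symm2 H.cd]
  simpa [dAe] using d3

lemma Bx (H : Touch δ γ M L g e v x y ξ) (h : E2) : dBe g e x h = pp δ γ L ξ * ⟪v, h⟫ := by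
  refine deriv_touch (C := pp δ γ L ξ * (‖h‖ ^ 2 / (2 * ξ))) (by simp [dAe]) (H.dline x h) (fun t => ?_)
  refine (H.Ax_le (t • h)).trans (le_of_eq ?_)
  rw [inner_smul_right, norm_smul, mul_pow, Real.norm_eq_abs, sq_abs]
  ring

lemma By (H : Touch δ γ M L g e v x y ξ) (h : E2) : dBe g e y h = pp δ γ L ξ * ⟪v, h⟫ := by
  have := deriv_touch (A := - (pp δ γ L ξ * ⟪v, h⟫)) (C := pp δ γ L ξ * (‖h‖ ^ 2 / (2 * ξ)))
    (by simp [dAe]) (H.dline y h).fun_neg (fun t => by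
      refine (H.Ay_le (t • h)).trans (le_of_eq ?_)
      rw [inner_smul_right, norm_smul, mul_pow, Real.norm_eq_abs, sq_abs]
      ring)
  linarith

/-- the dissipative difference -/
def TT (g : E2 → ℝ) (e x y h : E2) : ℝ := dAe g e x h - dAe g e y h

lemma TT_le (H : Touch δ γ M L g e v x y ξ) (h : E2) : TT g e x y h ≤ 0 := by
  have h1 := H.modE (x + h) (y + h)
  have e1 : x + h - (y + h) = ξ • v := by rw [H.xy]; abel
  rw [e1, norm_smul, H.hv, Real.norm_eq_abs, abs_of_pos H.x0, mul_one] at h1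
  rw [TT, dAe, dAe]; linarith [H.eq]

lemma slope_a (H : Touch δ γ M L g e v x y ξ) (z : E2) {h : E2} (hh : h ≠ 0) :
    |dA g z h / ‖h‖| ≤ M := by
  have n0 : 0 < ‖h‖ := norm_pos_iff.2 hh
  rw [abs_div, abs_norm, div_le_iff₀ n0]
  have := lip_of_fderiv (H.cd.differentiable (by norm_num)) H.slope z (z + h)
  rwa [add_sub_cancel_left] at this

lemma slope_b (H : Touch δ γ M L g e v x y ξ) (z : E2) {h : E2} (hh : h ≠ 0) :
    |fderiv ℝ g z h / ‖h‖| ≤ M := by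
  have n0 : 0 < ‖h‖ := norm_pos_iff.2 hh
  rw [abs_div, abs_norm, div_le_iff₀ n0]
  exact ((fderiv ℝ g z).le_opNorm h).trans (by gcongr; exact H.slope z)

lemma xy_norm (H : Touch δ γ M L g e v x y ξ) : ‖x - y‖ = ξ := by
  rw [H.xy, add_sub_cancel_left, norm_smul, H.hv, Real.norm_eq_abs, abs_of_pos H.x0, mul_one]

lemma diff_b (H : Touch δ γ M L g e v x y ξ) {h : E2} (hh : h ≠ 0) :
    |fderiv ℝ g x h / ‖h‖ - fderiv ℝ g y h / ‖h‖| ≤ omegaMod δ γ (L * ξ) := by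
  have n0 : 0 < ‖h‖ := norm_pos_iff.2 hh
  rw [← sub_div, abs_div, abs_norm, div_le_iff₀ n0]
  have h1 := (fderiv ℝ g x - fderiv ℝ g y).le_opNorm h
  have h2 := H.mod x y
  rw [H.xy_norm] at h2
  exact h1.trans (by gcongr)

lemma diff_a (H : Touch δ γ M L g e v x y ξ) {h : E2} (hh : h ≠ 0) :
    |dA g x h / ‖h‖ - dA g y h / ‖h‖| ≤ omegaMod δ γ (L * ξ) := by
  have n0 : 0 < ‖h‖ := norm_pos_iff.2 hh
  have dg : Differentiable ℝ g := H.cd.differentiable (by norm_num)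
  rw [← sub_div, abs_div, abs_norm, div_le_iff₀ n0]
  have d1 : ∀ z, HasFDerivAt (fun z => g z - g (z - ξ • v)) (fderiv ℝ g z - fderiv ℝ g (z - ξ • v)) z := by
    intro z
    refine (dg z).hasFDerivAt.fun_sub ?_
    simpa only [sub_eq_add_neg] using shift_fderiv dg (-(ξ • v)) z
  have h1 := lip_of_fderiv (u := fun z => g z - g (z - ξ • v)) (B := omegaMod δ γ (L * ξ))
    (fun z => (d1 z).differentiableAt) (fun z => by
      rw [(d1 z).fderiv]
      have := H.mod z (z - ξ • v)
      rwa [sub_sub_cancel, norm_smul, H.hv, Real.norm_eq_abs, abs_of_pos H.x0, mul_one] at this) x (x + h)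
  rw [add_sub_cancel_left, Real.norm_eq_abs] at h1
  have e1 : x - ξ • v = y := by rw [H.xy]; abel
  have e2 : x + h - ξ • v = y + h := by rw [H.xy]; abel
  rw [e1, e2] at h1
  have e3 : dA g x h - dA g y h = g (x + h) - g (y + h) - (g x - g y) := by
    simp only [dA]; ring
  rw [e3]
  exact h1

lemma diff_a' (H : Touch δ γ M L g e v x y ξ) {h : E2} (hh : h ≠ 0) :
    |dA g x h / ‖h‖ - dA g y h / ‖h‖| ≤ omegaMod δ γ (L * ‖h‖) * ξ / ‖h‖ := by
  have n0 : 0 < ‖h‖ := norm_pos_iff.2 hh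
  have dg : Differentiable ℝ g := H.cd.differentiable (by norm_num)
  rw [← sub_div, abs_div, abs_norm]
  gcongr
  have d1 : ∀ z, HasFDerivAt (fun z => g (z + h) - g z) (fderiv ℝ g (z + h) - fderiv ℝ g z) z := by
    intro z
    refine HasFDerivAt.fun_sub ?_ (dg z).hasFDerivAt
    exact shift_fderiv dg h z
  have h1 := lip_of_fderiv (u := fun z => g (z + h) - g z) (B := omegaMod δ γ (L * ‖h‖))
    (fun z => (d1 z).differentiableAt) (fun z => by
      rw [(d1 z).fderiv]
      have := H.mod (z + h) z
      rwa [add_sub_cancel_left] at this) y x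
  rw [H.xy_norm] at h1
  exact h1

lemma diff_ab (H : Touch δ γ M L g e v x y ξ) (z : E2) {h : E2} (hh : h ≠ 0) :
    |dA g z h / ‖h‖ - fderiv ℝ g z h / ‖h‖| ≤ omegaMod δ γ (L * ‖h‖) := by
  have n0 : 0 < ‖h‖ := norm_pos_iff.2 hh
  have L0 := H.L0
  rw [← sub_div, abs_div, abs_norm, div_le_iff₀ n0]
  refine taylor1 (H.cd.differentiable (by norm_num)) z h (fun k hk => ?_)
  have := H.mod (z + k) z
  rw [add_sub_cancel_left] at this
  exact this.trans (omega_mono H.ph (by positivity) (by gcongr))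

/-- abstract kernel inequality -/
lemma kernel_ineq {Ax Ay Kx Ky X Y lam : ℝ} (hT : Ax - Ay ≤ 0) (h1 : Ax ≤ X + Y) (h2 : -Ay ≤ -X + Y)
    (kx : lam ≤ Kx) (ky : lam ≤ Ky) :
    Ax * Kx - Ay * Ky ≤ lam * (Ax - Ay) + (Kx - Ky) * X + |Kx - Ky| * Y := by
  rcases le_total Ky Kx with h | h
  · rw [abs_of_nonneg (by linarith)]
    nlinarith [mul_nonneg (sub_nonneg.2 h) (sub_nonneg.2 h1), mul_nonneg (sub_nonneg.2 ky) (neg_nonneg.2 hT)]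
  · rw [abs_of_nonpos (by linarith)]
    nlinarith [mul_nonneg (sub_nonneg.2 h) (sub_nonneg.2 h2), mul_nonneg (sub_nonneg.2 kx) (neg_nonneg.2 hT)]

lemma inner_le (H : Touch δ γ M L g e v x y ξ) (h : E2) : |⟪v, h⟫| ≤ ‖h‖ := by
  have := abs_real_inner_le_norm v h
  rwa [H.hv, one_mul] at this

lemma near (H : Touch δ γ M L g e v x y ξ) {h : E2} (hh : h ≠ 0) :
    Jint g e x h - Jint g e y h ≤ (1 - 5 * M ^ 2) / 2 * (TT g e x y h * (‖h‖ ^ 3)⁻¹) +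
      (14 * pp δ γ L ξ * omegaMod δ γ (L * ξ) / ξ * ‖h‖⁻¹ +
        3 * pp δ γ L ξ * (omegaMod δ γ (L * ‖h‖) * (‖h‖ ^ 2)⁻¹)) := by
  have n0 : 0 < ‖h‖ := norm_pos_iff.2 hh
  have p0 := H.pp_pos
  have x0 := H.x0
  have ine := H.inner_le h
  rw [Jint_eq g e x hh, Jint_eq g e y hh, H.Bx, H.By]
  have kx := KK_ge H.M5 (H.slope_a x hh) (H.slope_b x hh)
  have ky := KK_ge H.M5 (H.slope_a y hh) (H.slope_b y hh)
  have kl := KK_lip H.M0 H.M5 (H.slope_a x hh) (H.slope_b x hh) (H.slope_a y hh) (H.slope_b y hh)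
  have da := H.diff_a hh
  have db := H.diff_b hh
  have sx := KK_sub H.M0 H.M5 (H.slope_a x hh) (H.diff_ab x hh)
  have sy := KK_sub H.M0 H.M5 (H.slope_a y hh) (H.diff_ab y hh)
  have hT := H.TT_le h
  have ax := H.Ax_le h
  have ay := H.Ay_le h
  rw [TT] at *
  rw [mul_add] at ax ay
  rw [mul_neg] at ay
  have main := kernel_ineq hT ax ay kx ky
  generalize KK (dA g x h / ‖h‖) (fderiv ℝ g x h / ‖h‖) = Kx at *
  generalize KK (dA g y h / ‖h‖) (fderiv ℝ g y h / ‖h‖) = Ky at *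
  generalize cK (dA g x h / ‖h‖) ^ 3 = cx at *
  generalize cK (dA g y h / ‖h‖) ^ 3 = cy at *
  generalize pp δ γ L ξ = p at *
  generalize ⟪v, h⟫ = i at *
  generalize dAe g e x h = Ax at *
  generalize dAe g e y h = Ay at *
  generalize omegaMod δ γ (L * ξ) = w at *
  generalize omegaMod δ γ (L * ‖h‖) = Wn at *
  have b1 : |Kx - Ky| * (p * (‖h‖ ^ 2 / (2 * ξ))) ≤ (28 * w) * (p * (‖h‖ ^ 2 / (2 * ξ))) := by
    gcongr; linarith
  have b2 : (Kx - Ky - (cx - cy)) * (p * i) ≤ (3 * Wn) * (p * ‖h‖) := by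
    refine (le_abs_self _).trans ?_
    rw [abs_mul, abs_mul, abs_of_pos p0]
    have : |Kx - Ky - (cx - cy)| ≤ 3 * Wn := by
      rw [abs_le] at *
      constructor <;> linarith [sx.1, sx.2, sy.1, sy.2]
    gcongr
    exact (abs_nonneg _).trans this
  have b3 : Ax * Kx - p * i * cx - (Ay * Ky - p * i * cy) ≤ (1 - 5 * M ^ 2) / 2 * (Ax - Ay) +
      (28 * w) * (p * (‖h‖ ^ 2 / (2 * ξ))) + (3 * Wn) * (p * ‖h‖) := by linarith
  have b4 := mul_le_mul_of_nonneg_right b3 (by positivity : 0 ≤ (‖h‖ ^ 3)⁻¹)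
  calc _ = (Ax * Kx - p * i * cx - (Ay * Ky - p * i * cy)) * (‖h‖ ^ 3)⁻¹ := by ring
    _ ≤ _ := b4
    _ = _ := by field_simp; ring

lemma far (H : Touch δ γ M L g e v x y ξ) {h : E2} (hh : h ≠ 0) :
    Jint g e x h - Jint g e y h ≤ (1 - 5 * M ^ 2) / 2 * (TT g e x y h * (‖h‖ ^ 3)⁻¹) +
      (28 * omegaMod δ γ (L * ξ) * ((omegaMod δ γ (L * (ξ + ‖h‖)) - omegaMod δ γ (L * ξ)) * (‖h‖ ^ 3)⁻¹) +
        3 * pp δ γ L ξ * ξ * (omegaMod δ γ (L * ‖h‖) * (‖h‖ ^ 3)⁻¹)) := by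
  have n0 : 0 < ‖h‖ := norm_pos_iff.2 hh
  have p0 := H.pp_pos
  have x0 := H.x0
  have L0 := H.L0
  have ine := H.inner_le h
  rw [Jint_eq g e x hh, Jint_eq g e y hh, H.Bx, H.By]
  have kx := KK_ge H.M5 (H.slope_a x hh) (H.slope_b x hh)
  have ky := KK_ge H.M5 (H.slope_a y hh) (H.slope_b y hh)
  have kl := KK_lip H.M0 H.M5 (H.slope_a x hh) (H.slope_b x hh) (H.slope_a y hh) (H.slope_b y hh)
  have da := H.diff_a hh
  have db := H.diff_b hh
  have da' := H.diff_a' hh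
  have cc := c3_lip (dA g x h / ‖h‖) (dA g y h / ‖h‖)
  have hT := H.TT_le h
  have ax := (H.Ax_le0 h).trans (sub_le_sub_right (H.W_far h) _)
  have ay := (H.Ay_le0 h).trans (sub_le_sub_right (H.W_far (-h)) _)
  rw [norm_neg] at ay
  have Wm : 0 ≤ omegaMod δ γ (L * (ξ + ‖h‖)) - omegaMod δ γ (L * ξ) :=
    sub_nonneg.2 (omega_mono H.ph (by positivity) (by gcongr; linarith))
  rw [TT] at *
  have main := kernel_ineq (X := 0) (Y := omegaMod δ γ (L * (ξ + ‖h‖)) - omegaMod δ γ (L * ξ)) hT (by rwa [zero_add]) (by rwa [neg_zero, zero_add]) kx ky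
  generalize KK (dA g x h / ‖h‖) (fderiv ℝ g x h / ‖h‖) = Kx at *
  generalize KK (dA g y h / ‖h‖) (fderiv ℝ g y h / ‖h‖) = Ky at *
  generalize cK (dA g x h / ‖h‖) ^ 3 = cx at *
  generalize cK (dA g y h / ‖h‖) ^ 3 = cy at *
  generalize pp δ γ L ξ = p at *
  generalize ⟪v, h⟫ = i at *
  generalize dAe g e x h = Ax at *
  generalize dAe g e y h = Ay at *
  generalize omegaMod δ γ (L * (ξ + ‖h‖)) - omegaMod δ γ (L * ξ) = D at *
  generalize omegaMod δ γ (L * ξ) = w at *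
  generalize omegaMod δ γ (L * ‖h‖) = Wn at *
  have b1 : |Kx - Ky| * D ≤ (28 * w) * D := by
    gcongr; linarith
  have b2 : -(cx - cy) * (p * i) ≤ (3 * (Wn * ξ / ‖h‖)) * (p * ‖h‖) := by
    refine (le_abs_self _).trans ?_
    rw [abs_mul, abs_mul, abs_of_pos p0, abs_neg]
    have : |cx - cy| ≤ 3 * (Wn * ξ / ‖h‖) := by linarith
    gcongr
    exact (abs_nonneg _).trans this
  have b3 : Ax * Kx - p * i * cx - (Ay * Ky - p * i * cy) ≤ (1 - 5 * M ^ 2) / 2 * (Ax - Ay) +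
      (28 * w) * D + (3 * (Wn * ξ / ‖h‖)) * (p * ‖h‖) := by linarith
  have b4 := mul_le_mul_of_nonneg_right b3 (by positivity : 0 ≤ (‖h‖ ^ 3)⁻¹)
  calc _ = (Ax * Kx - p * i * cx - (Ay * Ky - p * i * cy)) * (‖h‖ ^ 3)⁻¹ := by ring
    _ ≤ _ := b4
    _ = _ := by field_simp; ring

end Touch

/-! ### Part 7: integrated static estimates -/

lemma om_cont {δ γ L : ℝ} (hp : PH δ γ) (hL : 0 ≤ L) {c : ℝ} (hc : 0 ≤ c) :
    Continuous (fun h : E2 => omegaMod δ γ (L * (c + ‖h‖))) := by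
  refine (omega_cont hp).comp_continuous (by fun_prop) (fun h => ?_)
  show 0 ≤ L * (c + ‖h‖)
  positivity

lemma om_cont0 {δ γ L : ℝ} (hp : PH δ γ) (hL : 0 ≤ L) :
    Continuous (fun h : E2 => omegaMod δ γ (L * ‖h‖)) := by
  simpa using om_cont hp hL le_rfl

lemma int_le {a b : ℝ} {F G : E2 → ℝ} (ha : 0 < a) (hF : ContinuousOn F {h | h ≠ 0})
    (hG : ContinuousOn G {h | h ≠ 0}) (h : ∀ h ∈ ann a b, F h ≤ G h) :
    ∫ h in ann a b, F h ≤ ∫ h in ann a b, G h :=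
  setIntegral_mono_on (ann_int ha hF) (ann_int ha hG) (ann_meas _ _) h

lemma int_lin3 {s : Set E2} {F G K : E2 → ℝ} (a b c : ℝ) (hF : IntegrableOn F s)
    (hG : IntegrableOn G s) (hK : IntegrableOn K s) :
    ∫ h in s, (a * F h + (b * G h + c * K h)) =
      a * (∫ h in s, F h) + (b * (∫ h in s, G h) + c * ∫ h in s, K h) := by
  have h1 : IntegrableOn (fun h => b * G h + c * K h) s := (hG.const_mul b).add (hK.const_mul c)
  rw [integral_add (hF.const_mul a) h1, integral_add (hG.const_mul b) (hK.const_mul c),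
    integral_const_mul, integral_const_mul, integral_const_mul]

lemma sqrt3_cont : ContinuousOn (fun h : E2 => Real.sqrt ‖h‖ * (‖h‖ ^ 3)⁻¹) {h | h ≠ 0} :=
  (by fun_prop : Continuous (fun h : E2 => Real.sqrt ‖h‖)).continuousOn.mul (cont_inv 3)

namespace Touch
variable {δ γ M L : ℝ} {g : E2 → ℝ} {e v x y : E2} {ξ : ℝ}

lemma TT_cont (H : Touch δ γ M L g e v x y ξ) :
    ContinuousOn (fun h => TT g e x y h * (‖h‖ ^ 3)⁻¹) {h | h ≠ 0} := by
  refine ContinuousOn.mul ?_ (cont_inv 3)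
  exact ((dAe_cont H.cd e x).sub (dAe_cont H.cd e y)).continuousOn

lemma total (H : Touch δ γ M L g e v x y ξ) {R : ℝ} (R0 : 0 < R) (h1 : R⁻¹ ≤ ξ) (h2 : ξ ≤ R) :
    JR g e x R - JR g e y R ≤
      (1 - 5 * M ^ 2) / 2 * (∫ h in ann R⁻¹ R, TT g e x y h * (‖h‖ ^ 3)⁻¹) +
      (28 * Real.pi * pp δ γ L ξ * omegaMod δ γ (L * ξ) +
        3 * pp δ γ L ξ * ∫ h in ann R⁻¹ ξ, (omegaMod δ γ (L * ‖h‖) * (‖h‖ ^ 2)⁻¹)) +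
      (28 * omegaMod δ γ (L * ξ) * (∫ h in ann ξ R,
          (omegaMod δ γ (L * (ξ + ‖h‖)) - omegaMod δ γ (L * ξ)) * (‖h‖ ^ 3)⁻¹) +
        3 * pp δ γ L ξ * ξ * ∫ h in ann ξ R, (omegaMod δ γ (L * ‖h‖) * (‖h‖ ^ 3)⁻¹)) := by
  have ri : 0 < R⁻¹ := by positivity
  have x0 := H.x0
  have p0 := H.pp_pos
  have w0 := omega_nonneg H.ph (mul_pos H.L0 x0).le
  have cJx := Jint_cont H.cd e x
  have cJy := Jint_cont H.cd e y
  have cT := H.TT_cont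
  have co := (om_cont0 H.ph H.L0.le).continuousOn (s := {h | h ≠ 0})
  have co' := (om_cont H.ph H.L0.le x0.le).continuousOn (s := {h | h ≠ 0})
  have c1 := cont_inv 1
  simp only [pow_one] at c1
  have c2 : ContinuousOn (fun h : E2 => omegaMod δ γ (L * ‖h‖) * (‖h‖ ^ 2)⁻¹) {h | h ≠ 0} :=
    co.mul (cont_inv 2)
  have c3 : ContinuousOn (fun h : E2 => omegaMod δ γ (L * ‖h‖) * (‖h‖ ^ 3)⁻¹) {h | h ≠ 0} :=
    co.mul (cont_inv 3)
  have c4 : ContinuousOn (fun h : E2 => (omegaMod δ γ (L * (ξ + ‖h‖)) - omegaMod δ γ (L * ξ)) *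
      (‖h‖ ^ 3)⁻¹) {h | h ≠ 0} :=
    (co'.sub continuousOn_const).mul (cont_inv 3)
  have s1 : JR g e x R - JR g e y R = ∫ h in ann R⁻¹ R, (Jint g e x h - Jint g e y h) :=
    (integral_sub (ann_int ri cJx) (ann_int ri cJy)).symm
  have cJ : ContinuousOn (fun h => Jint g e x h - Jint g e y h) {h | h ≠ 0} := cJx.sub cJy
  rw [s1, ann_split x0 h1 h2 (ann_int ri cJ), ann_split x0 h1 h2 (ann_int ri cT)]
  have n1 : ∫ h in ann R⁻¹ ξ, (Jint g e x h - Jint g e y h) ≤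
      (1 - 5 * M ^ 2) / 2 * (∫ h in ann R⁻¹ ξ, TT g e x y h * (‖h‖ ^ 3)⁻¹) +
      (28 * Real.pi * pp δ γ L ξ * omegaMod δ γ (L * ξ) +
        3 * pp δ γ L ξ * ∫ h in ann R⁻¹ ξ, (omegaMod δ γ (L * ‖h‖) * (‖h‖ ^ 2)⁻¹)) := by
    refine (int_le (G := fun h => (1 - 5 * M ^ 2) / 2 * (TT g e x y h * (‖h‖ ^ 3)⁻¹) +
      (14 * pp δ γ L ξ * omegaMod δ γ (L * ξ) / ξ * ‖h‖⁻¹ +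
        3 * pp δ γ L ξ * (omegaMod δ γ (L * ‖h‖) * (‖h‖ ^ 2)⁻¹))) ri cJ ((cT.const_smul ((1 - 5 * M ^ 2) / 2)).add
      ((c1.const_smul (14 * pp δ γ L ξ * omegaMod δ γ (L * ξ) / ξ)).add
        (c2.const_smul (3 * pp δ γ L ξ)))) (fun h hh => H.near (ann_ne ri.le hh))).trans ?_
    rw [int_lin3 _ _ _ (ann_int ri cT) (ann_int ri c1) (ann_int ri c2), ann_inv1 ri h1]
    have : 14 * pp δ γ L ξ * omegaMod δ γ (L * ξ) / ξ * (2 * Real.pi * (ξ - R⁻¹)) ≤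
      14 * pp δ γ L ξ * omegaMod δ γ (L * ξ) / ξ * (2 * Real.pi * ξ) := by
      have := Real.pi_pos
      gcongr; linarith
    have e1 : 14 * pp δ γ L ξ * omegaMod δ γ (L * ξ) / ξ * (2 * Real.pi * ξ) =
      28 * Real.pi * pp δ γ L ξ * omegaMod δ γ (L * ξ) := by field_simp; ring
    linarith
  have n2 : ∫ h in ann ξ R, (Jint g e x h - Jint g e y h) ≤
      (1 - 5 * M ^ 2) / 2 * (∫ h in ann ξ R, TT g e x y h * (‖h‖ ^ 3)⁻¹) +
      (28 * omegaMod δ γ (L * ξ) * (∫ h in ann ξ R,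
          (omegaMod δ γ (L * (ξ + ‖h‖)) - omegaMod δ γ (L * ξ)) * (‖h‖ ^ 3)⁻¹) +
        3 * pp δ γ L ξ * ξ * ∫ h in ann ξ R, (omegaMod δ γ (L * ‖h‖) * (‖h‖ ^ 3)⁻¹)) := by
    refine (int_le (G := fun h => (1 - 5 * M ^ 2) / 2 * (TT g e x y h * (‖h‖ ^ 3)⁻¹) +
      (28 * omegaMod δ γ (L * ξ) *
          ((omegaMod δ γ (L * (ξ + ‖h‖)) - omegaMod δ γ (L * ξ)) * (‖h‖ ^ 3)⁻¹) +
        3 * pp δ γ L ξ * ξ * (omegaMod δ γ (L * ‖h‖) * (‖h‖ ^ 3)⁻¹))) x0 cJ ((cT.const_smul ((1 - 5 * M ^ 2) / 2)).add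
      ((c4.const_smul (28 * omegaMod δ γ (L * ξ))).add
        (c3.const_smul (3 * pp δ γ L ξ * ξ)))) (fun h hh => H.far (ann_ne x0.le hh))).trans ?_
    rw [int_lin3 _ _ _ (ann_int x0 cT) (ann_int x0 c4) (ann_int x0 c3)]
  linarith

lemma diss (H : Touch δ γ M L g e v x y ξ) {R ρ θ : ℝ} (R0 : 0 < R) (ρ0 : 0 < ρ) (Ψ : E2 ≃ₜ E2)
    (hΨ : MeasurePreserving Ψ volume volume)
    (b1 : ∀ h ∈ Metric.ball ((ξ / 4) • v) (ξ / 8), h ∈ ann R⁻¹ R ∧ Ψ h ∈ ann R⁻¹ R ∧ ‖h‖ ≤ ρ ∧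
      ‖Ψ h‖ ≤ ρ ∧ TT g e x y h + TT g e x y (Ψ h) ≤ -θ) :
    ∫ h in ann R⁻¹ R, TT g e x y h * (‖h‖ ^ 3)⁻¹ ≤ -(θ / ρ ^ 3 * (Real.pi * ξ ^ 2 / 128)) := by
  have ri : 0 < R⁻¹ := by positivity
  have x0 := H.x0
  set φ : E2 → ℝ := fun h => TT g e x y h * (‖h‖ ^ 3)⁻¹ with hφ
  have φ0 : ∀ h, 0 ≤ -φ h := fun h => by
    rw [hφ, ← neg_mul]
    exact mul_nonneg (neg_nonneg.2 (H.TT_le h)) (by positivity)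
  have hi : IntegrableOn φ (ann R⁻¹ R) := ann_int ri H.TT_cont
  have em := Ψ.measurableEmbedding
  set B := Metric.ball ((ξ / 4) • v) (ξ / 8) with hB
  have hi2 : IntegrableOn (fun h => φ (Ψ h)) (Ψ ⁻¹' ann R⁻¹ R) :=
    (hΨ.integrableOn_comp_preimage em).2 hi
  have i1 : ∫ h in ann R⁻¹ R, φ h ≤ ∫ h in B, φ h := by
    have := setIntegral_mono_set (s := B) hi.neg (Eventually.of_forall φ0)
      (Eventually.of_forall fun h hh => (b1 h hh).1)
    simp only [Pi.neg_apply, integral_neg] at this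
    linarith
  have i2 : ∫ h in ann R⁻¹ R, φ h ≤ ∫ h in B, φ (Ψ h) := by
    rw [← hΨ.setIntegral_preimage_emb em]
    have := setIntegral_mono_set (s := B) hi2.neg (Eventually.of_forall fun h => φ0 (Ψ h))
      (Eventually.of_forall fun h hh => (b1 h hh).2.1)
    simp only [Pi.neg_apply, integral_neg] at this
    linarith
  have j1 : IntegrableOn φ B := hi.mono_set fun h hh => (b1 h hh).1
  have j2 : IntegrableOn (fun h => φ (Ψ h)) B := hi2.mono_set fun h hh => (b1 h hh).2.1
  have i3 : (∫ h in B, φ h) + ∫ h in B, φ (Ψ h) ≤ ∫ h in B, -(θ / ρ ^ 3) := by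
    rw [← integral_add j1 j2]
    refine setIntegral_mono_on (j1.add j2) (integrableOn_const measure_ball_lt_top.ne)
      measurableSet_ball (fun h hh => ?_)
    obtain ⟨q1, q2, q3, q4, q5⟩ := b1 h hh
    have key : ∀ k ∈ ann R⁻¹ R, ‖k‖ ≤ ρ → φ k ≤ TT g e x y k * (ρ ^ 3)⁻¹ := by
      intro k hk hk'
      have k0 : 0 < ‖k‖ := norm_pos_iff.2 (ann_ne ri.le hk)
      refine mul_le_mul_of_nonpos_left ?_ (H.TT_le k)
      gcongr
    have := key h q1 q3
    have := key _ q2 q4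
    have r3 : 0 ≤ (ρ ^ 3)⁻¹ := by positivity
    have := mul_le_mul_of_nonneg_right q5 r3
    rw [div_eq_mul_inv]
    linarith
  have vol : volume.real B = Real.pi * ξ ^ 2 / 64 := by
    rw [Measure.real, hB, EuclideanSpace.volume_ball_fin_two]
    rw [ENNReal.toReal_mul, ENNReal.toReal_pow, ENNReal.toReal_ofReal (by positivity),
      ENNReal.toReal_ofReal Real.pi_pos.le]
    ring
  rw [setIntegral_const, vol, smul_eq_mul] at i3
  have : -(θ / ρ ^ 3 * (Real.pi * ξ ^ 2 / 128)) = (Real.pi * ξ ^ 2 / 64 * -(θ / ρ ^ 3)) / 2 := by ring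
  rw [this]
  linarith

lemma ball_facts (H : Touch δ γ M L g e v x y ξ) {h : E2}
    (hh : h ∈ Metric.ball ((ξ / 4) • v) (ξ / 8)) :
    ξ / 8 < ‖h‖ ∧ ‖h‖ < 3 * ξ / 8 ∧ ξ / 8 ≤ ⟪v, h⟫ ∧ ⟪v, h⟫ ≤ 3 * ξ / 8 := by
  have x0 := H.x0
  rw [mem_ball_iff_norm] at hh
  have nv : ‖(ξ / 4) • v‖ = ξ / 4 := by
    rw [norm_smul, H.hv, Real.norm_eq_abs, abs_of_pos (by positivity), mul_one]
  have a1 := norm_sub_norm_le ((ξ / 4) • v) h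
  rw [norm_sub_rev] at a1
  have a2 := norm_sub_norm_le h ((ξ / 4) • v)
  have a3 := H.inner_le (h - (ξ / 4) • v)
  rw [inner_sub_right, inner_smul_right, real_inner_self_eq_norm_sq, H.hv] at a3
  have := abs_le.1 a3
  refine ⟨by linarith, by linarith, ?_, ?_⟩ <;> linarith

/-- the reflection -/
def refl (v : E2) : E2 ≃ₗᵢ[ℝ] E2 := (Submodule.reflection (ℝ ∙ v)).trans (LinearIsometryEquiv.neg ℝ)

lemma refl_apply (H : Touch δ γ M L g e v x y ξ) (h : E2) : refl v h = h - (2 * ⟪v, h⟫) • v := by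
  simp only [refl, LinearIsometryEquiv.trans_apply, LinearIsometryEquiv.coe_neg,
    Submodule.reflection_singleton_apply, H.hv]
  simp [two_smul, two_mul, add_smul]

lemma diss_small (H : Touch δ γ M L g e v x y ξ) {R : ℝ} (h1 : R⁻¹ ≤ ξ / 8) (h2 : 2 * ξ ≤ R)
    (hu : L * ξ ≤ δ) :
    ∫ h in ann R⁻¹ R, TT g e x y h * (‖h‖ ^ 3)⁻¹ ≤ -(Real.pi / 3200 * L * Real.sqrt (L * ξ)) := by
  have x0 := H.x0
  have L0 := H.L0
  have R0 : 0 < R := by linarith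
  have := H.diss (R := R) (ρ := ξ / 2) (θ := 1 / 200 * ((L * ξ) * Real.sqrt (L * ξ))) R0
    (by positivity) (refl v).toHomeomorph (refl v).measurePreserving (fun h hh => ?_)
  · refine this.trans (le_of_eq ?_)
    field_simp
    norm_num
  · obtain ⟨f1, f2, f3, f4⟩ := H.ball_facts hh
    have nr : ‖(refl v).toHomeomorph h‖ = ‖h‖ := (refl v).norm_map h
    refine ⟨⟨by linarith, by linarith⟩, ⟨by rw [nr]; linarith, by rw [nr]; linarith⟩, by linarith,
      by rw [nr]; linarith, ?_⟩
    have er : (refl v).toHomeomorph h = h - (2 * ⟪v, h⟫) • v := H.refl_apply h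
    rw [er]
    set i := ⟪v, h⟫
    have m1 := H.modE (x + h) (y + (h - (2 * i) • v))
    have m2 := H.modE (x + (h - (2 * i) • v)) (y + h)
    have e1 : x + h - (y + (h - (2 * i) • v)) = (ξ + 2 * i) • v := by
      rw [H.xy, add_smul]; abel
    have e2 : x + (h - (2 * i) • v) - (y + h) = (ξ - 2 * i) • v := by
      rw [H.xy, sub_smul]; abel
    rw [e1, norm_smul, H.hv, Real.norm_eq_abs, abs_of_pos (by linarith), mul_one, mul_add] at m1
    rw [e2, norm_smul, H.hv, Real.norm_eq_abs, abs_of_pos (by linarith), mul_one, mul_sub] at m2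
    have s := omega_second (r := L * ξ) (s := L * (2 * i)) H.ph (by positivity) hu
      (by nlinarith) (by nlinarith)
    have := H.eq
    simp only [TT, dAe]
    linarith

lemma diss_large (H : Touch δ γ M L g e v x y ξ) {R : ℝ} (h1 : R⁻¹ ≤ ξ / 8) (h2 : 2 * ξ ≤ R)
    (hu : δ ≤ L * ξ) :
    ∫ h in ann R⁻¹ R, TT g e x y h * (‖h‖ ^ 3)⁻¹ ≤
      -(Real.pi / 2048 * (omegaMod δ γ (L * ξ) / ξ)) := by
  have x0 := H.x0
  have L0 := H.L0
  have R0 : 0 < R := by linarith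
  have nxv : ‖ξ • v‖ = ξ := by
    rw [norm_smul, H.hv, Real.norm_eq_abs, abs_of_pos x0, mul_one]
  have := H.diss (R := R) (ρ := 2 * ξ) (θ := omegaMod δ γ (L * ξ) / 2) R0
    (by positivity) (Homeomorph.addRight (ξ • v)) (measurePreserving_add_right volume (ξ • v))
    (fun h hh => ?_)
  · refine this.trans (le_of_eq ?_)
    field_simp
    ring
  · obtain ⟨f1, f2, f3, f4⟩ := H.ball_facts hh
    rw [Homeomorph.coe_addRight]
    have a1 := norm_add_le h (ξ • v)
    have a2 := norm_sub_norm_le (ξ • v) (-h)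
    rw [sub_neg_eq_add, norm_neg, add_comm (ξ • v)] at a2
    refine ⟨⟨by linarith, by linarith⟩, ⟨by linarith, by linarith⟩, by linarith,
      by linarith, ?_⟩
    have m1 := H.modE (x + (h + ξ • v)) (y + h)
    have e1 : x + (h + ξ • v) - (y + h) = (2 * ξ) • v := by
      rw [H.xy, two_mul, add_smul]; abel
    have e2 : y + (h + ξ • v) = x + h := by rw [H.xy]; abel
    rw [e1, norm_smul, H.hv, Real.norm_eq_abs, abs_of_pos (by linarith), mul_one] at m1
    have s := omega_double H.ph hu
    have := H.eq
    rw [show L * (2 * ξ) = 2 * (L * ξ) by ring] at m1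
    simp only [TT, dAe, e2]
    linarith

end Touch

/-! ### Part 8: the static inequality -/

lemma int_le52 {a b K : ℝ} {F : E2 → ℝ} (ha : 0 < a) (hab : a ≤ b) (hK : 0 ≤ K)
    (hF : Continuous F) (h : ∀ h ∈ ann a b, F h ≤ K * Real.sqrt ‖h‖) :
    ∫ h in ann a b, F h * (‖h‖ ^ 3)⁻¹ ≤ K * (4 * Real.pi / Real.sqrt a) := by
  have c1 : ContinuousOn (fun h : E2 => K * (Real.sqrt ‖h‖ * (‖h‖ ^ 3)⁻¹)) {h | h ≠ 0} :=
    sqrt3_cont.const_smul K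
  have c2 : ContinuousOn (fun h : E2 => F h * (‖h‖ ^ 3)⁻¹) {h | h ≠ 0} :=
    hF.continuousOn.mul (cont_inv 3)
  refine (int_le ha c2 c1 (fun h' hh => ?_)).trans ?_
  · rw [← mul_assoc]
    exact mul_le_mul_of_nonneg_right (h h' hh) (by positivity)
  · rw [integral_const_mul]
    exact mul_le_mul_of_nonneg_left (ann_inv52 ha hab) hK

namespace Touch
variable {δ γ M L : ℝ} {g : E2 → ℝ} {e v x y : E2} {ξ : ℝ}

lemma w_le (H : Touch δ γ M L g e v x y ξ) : omegaMod δ γ (L * ξ) ≤ 2 * M := by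
  have h1 := abs_le.1 (apply_le' H.he (H.slope x))
  have h2 := abs_le.1 (apply_le' H.he (H.slope y))
  linarith [H.eq]

lemma err_small (H : Touch δ γ M L g e v x y ξ) {R : ℝ} (h1 : R⁻¹ ≤ ξ / 8) (h2 : 2 * ξ ≤ R)
    (hu : L * ξ ≤ δ) :
    JR g e x R - JR g e y R ≤ -((1 - 5 * M ^ 2) / 2 * (Real.pi / 3200 * L * Real.sqrt (L * ξ))) +
      394 * Real.pi * L * Real.sqrt δ * Real.sqrt (L * ξ) := by
  have x0 := H.x0
  have L0 := H.L0
  have d0 := H.ph.pos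
  have R0 : 0 < R := by linarith
  have ri : 0 < R⁻¹ := by positivity
  have pi0 := Real.pi_pos
  have t := H.total R0 (by linarith) (by linarith)
  have d := mul_le_mul_of_nonneg_left (H.diss_small h1 h2 hu)
    (by linarith [H.M5] : 0 ≤ (1 - 5 * M ^ 2) / 2)
  have w1 := omega_le_id H.ph (mul_pos L0 x0).le
  have w0 := omega_nonneg H.ph (mul_pos L0 x0).le
  have p0 := H.pp_pos
  have p1 : pp δ γ L ξ ≤ L := by
    unfold pp
    nlinarith [omegaP_le_one H.ph (r := L * ξ)]
  set w := omegaMod δ γ (L * ξ) with hw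
  set p := pp δ γ L ξ with hp
  have n2 : ∫ h in ann R⁻¹ ξ, (omegaMod δ γ (L * ‖h‖) * (‖h‖ ^ 2)⁻¹) ≤ L * (2 * Real.pi * ξ) := by
    have c1 := cont_inv 1
    simp only [pow_one] at c1
    have c1' : ContinuousOn (fun h : E2 => L * ‖h‖⁻¹) {h | h ≠ 0} := c1.const_smul L
    have c2 : ContinuousOn (fun h : E2 => omegaMod δ γ (L * ‖h‖) * (‖h‖ ^ 2)⁻¹) {h | h ≠ 0} :=
      (om_cont0 H.ph H.L0.le).continuousOn.mul (cont_inv 2)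
    refine (int_le ri c2 c1' (fun h hh => ?_)).trans ?_
    · have n0 : 0 < ‖h‖ := norm_pos_iff.2 (ann_ne ri.le hh)
      have := omega_le_id H.ph (r := L * ‖h‖) (by positivity)
      calc omegaMod δ γ (L * ‖h‖) * (‖h‖ ^ 2)⁻¹ ≤ L * ‖h‖ * (‖h‖ ^ 2)⁻¹ := by gcongr
        _ = _ := by field_simp
    · rw [integral_const_mul, ann_inv1 ri (by linarith)]
      gcongr
      linarith
  have f1 := int_le52 (F := fun h => omegaMod δ γ (L * (ξ + ‖h‖)) - w)
    (K := 3 * (Real.sqrt δ * Real.sqrt L)) x0 (by linarith : ξ ≤ R) (by positivity)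
    ((om_cont H.ph L0.le x0.le).sub continuous_const) (fun h hh => by
      have a1 := omega_mono H.ph (r := L * (ξ + ‖h‖)) (s := L * (2 * ‖h‖)) (by positivity)
        (by have := hh.1; gcongr; linarith)
      have a2 := omega_sqrt H.ph (r := L * (2 * ‖h‖)) (by positivity)
      rw [show δ * (L * (2 * ‖h‖)) = δ * (L * (‖h‖ * 2)) by ring, Real.sqrt_mul d0.le,
        Real.sqrt_mul L0.le, Real.sqrt_mul (norm_nonneg _)] at a2
      have a3 : Real.sqrt 2 ≤ 3 / 2 := Real.sqrt_le_iff.2 (by norm_num)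
      have a4 : 2 * (Real.sqrt δ * (Real.sqrt L * (Real.sqrt ‖h‖ * Real.sqrt 2))) ≤
        2 * (Real.sqrt δ * (Real.sqrt L * (Real.sqrt ‖h‖ * (3 / 2)))) := by gcongr
      show omegaMod δ γ (L * (ξ + ‖h‖)) - w ≤ _
      linarith)
  have f2 := int_le52 (F := fun h => omegaMod δ γ (L * ‖h‖))
    (K := 2 * (Real.sqrt δ * Real.sqrt L)) x0 (by linarith : ξ ≤ R) (by positivity)
    (om_cont0 H.ph L0.le) (fun h hh => by
      have a2 := omega_sqrt H.ph (r := L * ‖h‖) (by positivity)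
      rw [Real.sqrt_mul d0.le, Real.sqrt_mul L0.le] at a2
      linarith)
  set I2 := ∫ h in ann R⁻¹ ξ, (omegaMod δ γ (L * ‖h‖) * (‖h‖ ^ 2)⁻¹)
  set I3 := ∫ h in ann ξ R, (omegaMod δ γ (L * (ξ + ‖h‖)) - w) * (‖h‖ ^ 3)⁻¹
  set I4 := ∫ h in ann ξ R, (omegaMod δ γ (L * ‖h‖) * (‖h‖ ^ 3)⁻¹)
  have e1 : p * w ≤ L * (L * ξ) := mul_le_mul p1 w1 w0 L0.le
  have e2 : p * I2 ≤ L * (L * (2 * Real.pi * ξ)) := by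
    calc p * I2 ≤ p * (L * (2 * Real.pi * ξ)) := by gcongr
      _ ≤ _ := by gcongr
  have e3 : w * I3 ≤ L * ξ * (3 * (Real.sqrt δ * Real.sqrt L) * (4 * Real.pi / Real.sqrt ξ)) := by
    calc w * I3 ≤ w * (3 * (Real.sqrt δ * Real.sqrt L) * (4 * Real.pi / Real.sqrt ξ)) := by gcongr
      _ ≤ _ := by gcongr
  have e4 : p * ξ * I4 ≤ L * ξ * (2 * (Real.sqrt δ * Real.sqrt L) * (4 * Real.pi / Real.sqrt ξ)) := by
    calc p * ξ * I4 ≤ p * ξ * (2 * (Real.sqrt δ * Real.sqrt L) * (4 * Real.pi / Real.sqrt ξ)) := by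
          gcongr
      _ ≤ _ := by gcongr
  have q : ξ / Real.sqrt ξ = Real.sqrt ξ := Real.div_sqrt
  have q2 : Real.sqrt (L * ξ) = Real.sqrt L * Real.sqrt ξ := Real.sqrt_mul L0.le ξ
  have e3' : L * ξ * (3 * (Real.sqrt δ * Real.sqrt L) * (4 * Real.pi / Real.sqrt ξ)) =
      12 * Real.pi * L * Real.sqrt δ * Real.sqrt (L * ξ) := by
    rw [q2]; linear_combination (12 * Real.pi * L * Real.sqrt δ * Real.sqrt L) * q
  have e4' : L * ξ * (2 * (Real.sqrt δ * Real.sqrt L) * (4 * Real.pi / Real.sqrt ξ)) =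
      8 * Real.pi * L * Real.sqrt δ * Real.sqrt (L * ξ) := by
    rw [q2]; linear_combination (8 * Real.pi * L * Real.sqrt δ * Real.sqrt L) * q
  have u1 : L * ξ ≤ Real.sqrt δ * Real.sqrt (L * ξ) := by
    have := Real.sqrt_le_sqrt hu
    have := Real.mul_self_sqrt (mul_pos L0 x0).le
    nlinarith [Real.sqrt_nonneg (L * ξ)]
  have u2 : Real.pi * L * (L * ξ) ≤ Real.pi * L * (Real.sqrt δ * Real.sqrt (L * ξ)) := by gcongr
  have e1' : Real.pi * (p * w) ≤ Real.pi * (L * (L * ξ)) := by gcongr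
  rw [e3'] at e3
  rw [e4'] at e4
  nlinarith

lemma err_large (H : Touch δ γ M L g e v x y ξ) {R : ℝ} (h1 : R⁻¹ ≤ ξ / 8) (h2 : 2 * ξ ≤ R)
    (h3 : R⁻¹ ≤ δ / L) (hu : δ < L * ξ) :
    JR g e x R - JR g e y R ≤
      (-((1 - 5 * M ^ 2) / 2 * (Real.pi / 2048)) + 75 * Real.pi * γ) *
        (omegaMod δ γ (L * ξ) / ξ) := by
  have x0 := H.x0
  have L0 := H.L0
  have d0 := H.ph.pos
  have g0 := H.ph.gpos
  have R0 : 0 < R := by linarith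
  have ri : 0 < R⁻¹ := by positivity
  have pi0 := Real.pi_pos
  have t := H.total R0 (by linarith) (by linarith)
  have d := mul_le_mul_of_nonneg_left (H.diss_large h1 h2 hu.le)
    (by linarith [H.M5] : 0 ≤ (1 - 5 * M ^ 2) / 2)
  have w0 := omega_nonneg H.ph (mul_pos L0 x0).le
  have p0 := H.pp_pos
  have l0 := logdiv_nonneg H.ph hu.le
  have p1 : pp δ γ L ξ * ξ ≤ γ / 4 := by
    unfold pp
    have := omegaP_large H.ph hu
    calc L * omegaP δ γ (L * ξ) * ξ ≤ L * (γ / (4 * (L * ξ))) * ξ := by gcongr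
      _ = γ / 4 := by field_simp
  have p2 : pp δ γ L ξ * (4 + Real.log (L * ξ / δ)) * ξ = γ := by
    unfold pp
    rw [omegaP, if_neg (not_le.2 hu)]
    field_simp
  have wd := omega_ge_half H.ph hu.le
  set w := omegaMod δ γ (L * ξ) with hw
  set p := pp δ γ L ξ with hp
  set ℓ := Real.log (L * ξ / δ) with hl
  have n2 : ∫ h in ann R⁻¹ ξ, (omegaMod δ γ (L * ‖h‖) * (‖h‖ ^ 2)⁻¹) ≤
      2 * Real.pi * w * (4 + ℓ) := by
    have c1 := cont_inv 1
    simp only [pow_one] at c1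
    have dl : 0 < δ / L := by positivity
    have dx : δ / L ≤ ξ := by rw [div_le_iff₀ L0]; linarith
    have c1' : ContinuousOn (fun h : E2 => L * ‖h‖⁻¹) {h | h ≠ 0} := c1.const_smul L
    have c3' : ContinuousOn (fun h : E2 => w * (‖h‖ ^ 2)⁻¹) {h | h ≠ 0} :=
      (cont_inv 2).const_smul w
    have c2 : ContinuousOn (fun h : E2 => omegaMod δ γ (L * ‖h‖) * (‖h‖ ^ 2)⁻¹) {h | h ≠ 0} :=
      (om_cont0 H.ph H.L0.le).continuousOn.mul (cont_inv 2)
    rw [ann_split dl h3 dx (ann_int ri c2)]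
    have m1 : ∫ h in ann R⁻¹ (δ / L), (omegaMod δ γ (L * ‖h‖) * (‖h‖ ^ 2)⁻¹) ≤
        2 * Real.pi * δ := by
      refine (int_le ri c2 c1' (fun h hh => ?_)).trans ?_
      · have n0 : 0 < ‖h‖ := norm_pos_iff.2 (ann_ne ri.le hh)
        have := omega_le_id H.ph (r := L * ‖h‖) (by positivity)
        calc omegaMod δ γ (L * ‖h‖) * (‖h‖ ^ 2)⁻¹ ≤ L * ‖h‖ * (‖h‖ ^ 2)⁻¹ := by gcongr
          _ = _ := by field_simp
      · rw [integral_const_mul, ann_inv1 ri h3]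
        calc L * (2 * Real.pi * (δ / L - R⁻¹)) ≤ L * (2 * Real.pi * (δ / L)) := by
              gcongr; linarith
          _ = _ := by field_simp
    have m2 : ∫ h in ann (δ / L) ξ, (omegaMod δ γ (L * ‖h‖) * (‖h‖ ^ 2)⁻¹) ≤
        w * (2 * Real.pi * ℓ) := by
      refine (int_le dl c2 c3' (fun h hh => ?_)).trans ?_
      · have := omega_mono H.ph (r := L * ‖h‖) (s := L * ξ) (by positivity)
          (by have := hh.2.le; gcongr)
        gcongr
      · rw [integral_const_mul, ann_inv2 dl dx, hl]
        rw [show ξ / (δ / L) = L * ξ / δ by field_simp]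
    have : 2 * Real.pi * δ ≤ 2 * Real.pi * (2 * w) := by gcongr; linarith
    nlinarith [mul_nonneg pi0.le w0]
  have f1 := int_le52 (F := fun h => omegaMod δ γ (L * (ξ + ‖h‖)) - w)
    (K := γ / 2 / Real.sqrt ξ) x0 (by linarith : ξ ≤ R) (by positivity)
    ((om_cont H.ph L0.le x0.le).sub continuous_const) (fun h hh => by
      have a1 := omega_incr H.ph hu.le (s := L * ‖h‖) (by positivity)
      rw [mul_div_mul_left _ _ L0.ne', Real.sqrt_div (norm_nonneg _), ← mul_add] at a1
      show omegaMod δ γ (L * (ξ + ‖h‖)) - w ≤ _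
      refine a1.trans (le_of_eq ?_)
      ring)
  have f2 := int_le52 (F := fun h => omegaMod δ γ (L * ‖h‖))
    (K := 2 * w / Real.sqrt ξ) x0 (by linarith : ξ ≤ R) (by positivity)
    (om_cont0 H.ph L0.le) (fun h hh => by
      have a2 := omega_rel H.ph hu.le (s := L * ‖h‖) (by have := hh.1.le; gcongr)
      rw [mul_div_mul_left _ _ L0.ne', Real.sqrt_div (norm_nonneg _)] at a2
      refine a2.trans (le_of_eq ?_)
      ring)
  have sq : Real.sqrt ξ * Real.sqrt ξ = ξ := Real.mul_self_sqrt x0.le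
  have k1 : γ / 2 / Real.sqrt ξ * (4 * Real.pi / Real.sqrt ξ) = 2 * Real.pi * γ / ξ := by
    rw [div_mul_div_comm, sq]; ring
  have k2 : 2 * w / Real.sqrt ξ * (4 * Real.pi / Real.sqrt ξ) = 8 * Real.pi * (w / ξ) := by
    rw [div_mul_div_comm, sq]; ring
  rw [k1] at f1
  rw [k2] at f2
  set I2 := ∫ h in ann R⁻¹ ξ, (omegaMod δ γ (L * ‖h‖) * (‖h‖ ^ 2)⁻¹)
  set I3 := ∫ h in ann ξ R, (omegaMod δ γ (L * (ξ + ‖h‖)) - w) * (‖h‖ ^ 3)⁻¹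
  set I4 := ∫ h in ann ξ R, (omegaMod δ γ (L * ‖h‖) * (‖h‖ ^ 3)⁻¹)
  have W0 : 0 ≤ w / ξ := by positivity
  have ww : w = w / ξ * ξ := by field_simp
  have e1 : p * w ≤ γ / 4 * (w / ξ) := by
    calc p * w = p * ξ * (w / ξ) := by field_simp
      _ ≤ _ := by gcongr
  have e2 : p * I2 ≤ 2 * Real.pi * γ * (w / ξ) := by
    calc p * I2 ≤ p * (2 * Real.pi * w * (4 + ℓ)) := by gcongr
      _ = 2 * Real.pi * (p * (4 + ℓ) * ξ) * (w / ξ) := by field_simp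
      _ = _ := by rw [p2]
  have e3 : w * I3 ≤ 2 * Real.pi * γ * (w / ξ) := by
    calc w * I3 ≤ w * (2 * Real.pi * γ / ξ) := by gcongr
      _ = _ := by ring
  have e4 : p * ξ * I4 ≤ γ / 4 * (8 * Real.pi * (w / ξ)) := by
    calc p * ξ * I4 ≤ p * ξ * (8 * Real.pi * (w / ξ)) := by gcongr
      _ ≤ _ := by gcongr
  have e1' : Real.pi * (p * w) ≤ Real.pi * (γ / 4 * (w / ξ)) := by gcongr
  nlinarith

lemma static (H : Touch δ γ M L g e v x y ξ) {R0 : ℝ} (hM : 0 < M) (r0 : 0 < R0)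
    (hR : omegaMod δ γ R0 = 2 * M) (hd : 4000000 * Real.sqrt δ ≤ (1 - 5 * M ^ 2) / 2) :
    ∃ κ > 0, ∃ R1, ∀ R ≥ R1, JR g e x R - JR g e y R +
      2 * omegaP δ γ (L * ξ) * (L * ξ) * (L / (R0 / (2 * M))) ≤ -κ := by
  have x0 := H.x0
  have L0 := H.L0
  have d0 := H.ph.pos
  have g0 := H.ph.gpos
  have pi0 := Real.pi_pos
  have pi3 := Real.pi_gt_three
  have P0 := omegaP_pos H.ph (r := L * ξ)
  have P1 := omegaP_le_one H.ph (r := L * ξ)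
  have u0 := mul_pos L0 x0
  have s0 : 0 < Real.sqrt (L * ξ) := Real.sqrt_pos.2 u0
  have sd0 : 0 < Real.sqrt δ := Real.sqrt_pos.2 d0
  have lam : 0 < (1 - 5 * M ^ 2) / 2 := by linarith [H.M5]
  set lm := (1 - 5 * M ^ 2) / 2
  have hC : L / (R0 / (2 * M)) = L * (2 * M / R0) := by field_simp
  rw [hC]
  have key : ∃ κ > 0, ∀ R, R⁻¹ ≤ ξ / 8 → 2 * ξ ≤ R → R⁻¹ ≤ δ / L →
      JR g e x R - JR g e y R + 2 * omegaP δ γ (L * ξ) * (L * ξ) * (L * (2 * M / R0)) ≤ -κ := by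
    rcases le_or_gt (L * ξ) δ with hu | hu
    · refine ⟨lm * (Real.pi / 20000) * L * Real.sqrt (L * ξ), by positivity, fun R a b _ => ?_⟩
      have er := H.err_small a b hu
      change _ ≤ -(lm * _) + _ at er
      have c1 : 2 * M / R0 ≤ 1 := by
        rw [div_le_one r0, ← hR]; exact omega_le_id H.ph r0.le
      have u1 : L * ξ ≤ Real.sqrt δ * Real.sqrt (L * ξ) := by
        have := Real.sqrt_le_sqrt hu
        have := Real.mul_self_sqrt u0.le
        nlinarith
      have tm : 2 * omegaP δ γ (L * ξ) * (L * ξ) * (L * (2 * M / R0)) ≤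
          2 * 1 * (Real.sqrt δ * Real.sqrt (L * ξ)) * (L * 1) := by gcongr
      have b1 : L * Real.sqrt (L * ξ) * (4000000 * Real.sqrt δ) ≤ L * Real.sqrt (L * ξ) * lm := by
        gcongr
      have b2 := mul_le_mul_of_nonneg_left b1 pi0.le
      have b3 : 2 * (L * Real.sqrt (L * ξ) * Real.sqrt δ) ≤
        Real.pi * (L * Real.sqrt (L * ξ) * Real.sqrt δ) := by
        gcongr; linarith
      have b4 : 0 ≤ Real.pi * (L * Real.sqrt (L * ξ) * lm) := by positivity
      linarith
    · have w0 := omega_pos H.ph u0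
      set w := omegaMod δ γ (L * ξ) with hw
      refine ⟨lm * (Real.pi / 4096) * (w / ξ), by positivity, fun R a b c => ?_⟩
      have er := H.err_large a b c hu
      have uR : L * ξ ≤ R0 := by
        by_contra hh
        have := omega_lt H.ph r0.le (not_le.1 hh)
        linarith [H.w_le]
      have sc := omega_scale H.ph r0.le (θ := L * ξ / R0) (by positivity) ((div_le_one r0).2 uR)
      rw [div_mul_cancel₀ _ r0.ne', hR, ← hw] at sc
      have sc2 : L * (2 * M / R0) ≤ w / ξ := by
        rw [le_div_iff₀ x0]
        refine le_trans (le_of_eq ?_) sc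
        ring
      have pl := omegaP_large H.ph hu
      have pl2 : omegaP δ γ (L * ξ) * (L * ξ) ≤ γ / 4 := by
        calc omegaP δ γ (L * ξ) * (L * ξ) ≤ γ / (4 * (L * ξ)) * (L * ξ) := by gcongr
          _ = γ / 4 := by field_simp
      have tm : 2 * omegaP δ γ (L * ξ) * (L * ξ) * (L * (2 * M / R0)) ≤ 2 * (γ / 4) * (w / ξ) := by
        rw [mul_assoc 2]
        gcongr
      have gl : 4000000 * γ ≤ lm := by
        have h1 : Real.sqrt δ * Real.sqrt δ = δ := Real.mul_self_sqrt d0.le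
        have h2 := sqrt_le_of_PH H.ph le_rfl
        have h3 := H.ph.eq
        nlinarith
      have b2 : Real.pi * (w / ξ) * (4000000 * γ) ≤ Real.pi * (w / ξ) * lm := by gcongr
      have b3 : 1 * (γ * (w / ξ)) ≤ Real.pi * (γ * (w / ξ)) := by
        gcongr; linarith
      have b4 : 0 ≤ Real.pi * (w / ξ) * lm := by positivity
      change _ ≤ (-(lm * _) + _) * _ at er
      linarith
  obtain ⟨κ, κ0, hk⟩ := key
  refine ⟨κ, κ0, max (2 * ξ) (max (ξ / 8)⁻¹ (δ / L)⁻¹), fun R hR => hk R ?_ ?_ ?_⟩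
  · have : (ξ / 8)⁻¹ ≤ R := le_trans (le_trans (le_max_left _ _) (le_max_right _ _)) hR
    exact inv_le_of_inv_le₀ (by positivity) this
  · exact le_trans (le_max_left _ _) hR
  · have : (δ / L)⁻¹ ≤ R := le_trans (le_trans (le_max_right _ _) (le_max_right _ _)) hR
    exact inv_le_of_inv_le₀ (by positivity) this

end Touch

/-- at a maximum of `∂ₑ g` the flux is nonpositive -/
lemma slope_static {g : E2 → ℝ} (cd : ContDiff ℝ 3 g) {M : ℝ} (M5 : 5 * M ^ 2 < 1)
    (sl : ∀ z, ‖fderiv ℝ g z‖ ≤ M) {e x : E2}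
    (hx : ∀ z, fderiv ℝ g z e ≤ fderiv ℝ g x e) {R : ℝ} (hR : 0 < R) : JR g e x R ≤ 0 := by
  have ri : 0 < R⁻¹ := by positivity
  have dA0 : ∀ h, dAe g e x h ≤ 0 := fun h => by rw [dAe]; linarith [hx (x + h)]
  have dB0 : ∀ h, dBe g e x h = 0 := by
    intro h
    have d1 := hasDeriv_line (u := fderiv ℝ g) (x := x) (e := h) (σ := 0)
      ((cd_fderiv cd).differentiable (by norm_num) _)
    have d2 := d1.clm_apply (hasDerivAt_const (0 : ℝ) e)
    have d3 := d2.sub_const (fderiv ℝ g x e)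
    have d4 : HasDerivAt (fun t : ℝ => dAe g e x (t • h)) (dBe g e x h) 0 := by
      rw [dBe, symm2 cd]
      simpa [dAe] using d3
    refine deriv_touch (A := 0) (C := 0) (by simp [dAe]) d4 (fun t => ?_)
    simpa using dA0 (t • h)
  have M0 : 0 ≤ M := (norm_nonneg _).trans (sl x)
  refine setIntegral_nonpos (ann_meas _ _) (fun h hh => ?_)
  have h0 := ann_ne ri.le hh
  have n0 : 0 < ‖h‖ := norm_pos_iff.2 h0
  rw [Jint_eq g e x h0, dB0, zero_mul, sub_zero]
  have k : 0 ≤ KK (dA g x h / ‖h‖) (fderiv ℝ g x h / ‖h‖) := by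
    have a1 : |dA g x h / ‖h‖| ≤ M := by
      rw [abs_div, abs_norm, div_le_iff₀ n0]
      have := lip_of_fderiv (u := g) (B := M) (cd.differentiable (by norm_num)) sl x (x + h)
      simpa [dA] using this
    have a2 : |fderiv ℝ g x h / ‖h‖| ≤ M := by
      rw [abs_div, abs_norm, div_le_iff₀ n0]
      exact (fderiv ℝ g x).le_of_opNorm_le (sl x) h
    have := KK_ge M5 a1 a2
    linarith
  exact mul_nonpos_of_nonpos_of_nonneg (mul_nonpos_of_nonpos_of_nonneg (dA0 h) k) (by positivity)

/-! ### Part 9: continuation arguments -/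

lemma continuation {t0 T : ℝ} {P : ℝ → Prop} (h0 : P t0)
    (hopen : ∀ t, t0 ≤ t → t < T → P t → ∃ ε > 0, ∀ s, t < s → s < t + ε → s < T → P s)
    (hclosed : ∀ t, t0 < t → t < T → (∀ s, t0 ≤ s → s < t → P s) → P t) :
    ∀ t, t0 ≤ t → t < T → P t := by
  intro t1 h1 h1T
  by_contra hn
  set S := {t | t0 ≤ t ∧ t < T ∧ ¬ P t} with hS
  have t1S : t1 ∈ S := ⟨h1, h1T, hn⟩
  have bb : BddBelow S := ⟨t0, fun s hs => hs.1⟩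
  set τ := sInf S
  have τ1 : τ ≤ t1 := csInf_le bb t1S
  have τ0 : t0 ≤ τ := le_csInf ⟨t1, t1S⟩ fun s hs => hs.1
  have τT : τ < T := lt_of_le_of_lt τ1 h1T
  have before : ∀ s, t0 ≤ s → s < τ → P s := by
    intro s hs hsτ
    by_contra hh
    exact absurd (csInf_le bb (show s ∈ S from ⟨hs, hsτ.trans τT, hh⟩)) (not_le.2 hsτ)
  have Pτ : P τ := by
    rcases τ0.eq_or_lt with h | h
    · rw [← h]; exact h0
    · exact hclosed τ h τT before
  obtain ⟨ε, e0, he⟩ := hopen τ τ0 τT Pτ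
  obtain ⟨s, sS, hs⟩ := exists_lt_of_csInf_lt ⟨t1, t1S⟩ (show sInf S < τ + ε by linarith)
  have : τ ≤ s := csInf_le bb sS
  rcases this.eq_or_lt with h | h
  · exact sS.2.2 (h ▸ Pτ)
  · exact sS.2.2 (he s h hs sS.2.1)

lemma exists_dual (φ : E2 →L[ℝ] ℝ) : ∃ e : E2, ‖e‖ ≤ 1 ∧ φ e = ‖φ‖ := by
  set z := (InnerProductSpace.toDual ℝ E2).symm φ with hz
  have h1 : ∀ v, ⟪z, v⟫ = φ v := fun v => InnerProductSpace.toDual_symm_apply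
  have h2 : ‖z‖ = ‖φ‖ := LinearIsometryEquiv.norm_map _ _
  rcases eq_or_ne z 0 with h | h
  · refine ⟨0, by simp, ?_⟩
    rw [← h2, h]; simp
  · have n0 : ‖z‖ ≠ 0 := norm_ne_zero_iff.2 h
    refine ⟨‖z‖⁻¹ • z, ?_, ?_⟩
    · rw [norm_smul, norm_inv, norm_norm, inv_mul_cancel₀ n0]
    · rw [← h1, inner_smul_right, real_inner_self_eq_norm_sq, ← h2]
      field_simp

lemma margin {u : E2 → ℝ} (hc : Continuous u) (h0 : Tendsto u (cocompact E2) (𝓝 0)) {m : ℝ}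
    (hm : 0 < m) (hu : ∀ x, u x < m) : ∃ μ < m, ∀ x, u x ≤ μ := by
  by_cases h : ∀ x, u x ≤ 0
  · exact ⟨0, hm, h⟩
  · push Not at h
    obtain ⟨x0, hx0⟩ := h
    obtain ⟨z, hz⟩ := hc.exists_forall_ge' x0 ((h0.eventually_lt_const hx0).mono fun _ h => h.le)
    exact ⟨u z, hu z, hz⟩

section
variable {T : ℝ} {f : ℝ → E2 → ℝ}

lemma sol_decay (hs : SmoothDecaySol T f) {t : ℝ} (ht : t ∈ Icc 0 T) :
    Tendsto (fun x => ‖fderiv ℝ (f t) x‖) (cocompact E2) (𝓝 0) := by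
  have := hs.2.1 t ht 1 (by norm_num)
  simpa only [norm_iteratedFDeriv_one] using this

lemma sol_cont (hs : SmoothDecaySol T f) {t : ℝ} (ht : t ∈ Icc 0 T) :
    Continuous (fderiv ℝ (f t)) := (cd_fderiv (hs.1 t ht)).continuous

lemma sol_contW (hs : SmoothDecaySol T f) {t : ℝ} (ht : t ∈ Icc 0 T) (x : E2) :
    ContinuousWithinAt (fun s => fderiv ℝ (f s) x) (Icc 0 T) t := by
  rw [Metric.continuousWithinAt_iff]
  intro ε e0
  obtain ⟨d, d0, hd⟩ := (sol_close hs ht).2.1 (ε / 2) (by positivity)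
  refine ⟨d, d0, fun s hs' hst => ?_⟩
  have := hd s hs' (by simpa [Real.dist_eq] using hst) x
  rw [dist_eq_norm]
  linarith

/-- passing to the limit from the left -/
lemma left_limit {t0 t : ℝ} {F G : ℝ → ℝ} (h : t0 < t) (hF : ContinuousWithinAt F (Ico t0 t) t)
    (hG : ContinuousWithinAt G (Ico t0 t) t) (hle : ∀ s, t0 ≤ s → s < t → F s ≤ G s) : F t ≤ G t := by
  refine ContinuousWithinAt.closure_le ?_ hF hG (fun s hs => hle s hs.1 hs.2)
  rw [closure_Ico h.ne]
  exact right_mem_Icc.2 h.le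

lemma slope_step (hs : SmoothDecaySol T f) {M ε : ℝ} (hM : 0 < M) (e0 : 0 < ε)
    (h5 : 5 * (M + ε * (1 + T)) ^ 2 < 1) (hi : ∀ x, ‖fderiv ℝ (f 0) x‖ ≤ M) :
    ∀ t, 0 ≤ t → t < T → ∀ x, ‖fderiv ℝ (f t) x‖ < M + ε * (1 + t) := by
  refine continuation ?_ ?_ ?_
  · intro x
    have := hi x
    linarith
  · intro t t0 tT hP
    have ht : t ∈ Icc 0 T := ⟨t0, tT.le⟩
    have m0 : 0 < M + ε * (1 + t) := by positivity
    obtain ⟨μ, hμ, hμ'⟩ := margin (sol_cont hs ht).norm (sol_decay hs ht) m0 hP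
    obtain ⟨d, d0, hd⟩ := (sol_close hs ht).2.1 ((M + ε * (1 + t) - μ) / 2) (by linarith)
    refine ⟨d, d0, fun s h1 h2 h3 x => ?_⟩
    have a := hd s ⟨by linarith, h3.le⟩ (by rw [abs_lt]; constructor <;> linarith) x
    have b := norm_le_norm_add_norm_sub' (fderiv ℝ (f s) x) (fderiv ℝ (f t) x)
    have c := hμ' x
    have : ε * t < ε * s := by gcongr
    linarith
  · intro t t0 tT hP x
    have ht : t ∈ Icc 0 T := ⟨t0.le, tT.le⟩
    have weak : ∀ z, ‖fderiv ℝ (f t) z‖ ≤ M + ε * (1 + t) := by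
      intro z
      refine left_limit (F := fun s => ‖fderiv ℝ (f s) z‖) (G := fun s => M + ε * (1 + s)) t0
        (((sol_contW hs ht z).mono (fun s hs' => ⟨hs'.1, (hs'.2.trans tT).le⟩)).norm)
        (by fun_prop) (fun s h1 h2 => (hP s h1 h2 z).le)
    refine lt_of_le_of_ne (weak x) (fun heq => ?_)
    obtain ⟨e, he, hφ⟩ := exists_dual (fderiv ℝ (f t) x)
    have hmax : ∀ z, fderiv ℝ (f t) z e ≤ fderiv ℝ (f t) x e := by
      intro z
      rw [hφ, heq]
      exact (le_abs_self _).trans (apply_le' he (weak z))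
    have m5 : 5 * (M + ε * (1 + t)) ^ 2 < 1 := by
      refine lt_of_le_of_lt ?_ h5
      gcongr
    obtain ⟨R1, hR1⟩ := evol1 hs ⟨t0, tT⟩ he x (η := ε / 2) (by positivity)
    obtain ⟨d, d0, hd⟩ := hR1 (max R1 1) (le_max_left _ _)
    have J := slope_static (hs.1 t ht) m5 weak hmax (R := max R1 1)
      (lt_of_lt_of_le one_pos (le_max_right _ _))
    obtain ⟨s, s1, s2⟩ := exists_between (max_lt (show t - d < t by linarith) t0)
    have s3 : t - d < s := lt_of_le_of_lt (le_max_left _ _) s1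
    have s4 : 0 < s := lt_of_le_of_lt (le_max_right _ _) s1
    have q := (abs_le.1 (hd s ⟨s3, s2⟩)).2
    have q2 := (le_abs_self _).trans (apply_le' he (hP s s4.le s2 x).le)
    have q3 : (t - s) * JR (f t) e x (max R1 1) ≤ 0 :=
      mul_nonpos_of_nonneg_of_nonpos (by linarith) J
    rw [hφ, heq] at q
    nlinarith

lemma slope_max (hs : SmoothDecaySol T f) (hT : 0 < T) {M : ℝ} (hM : 0 < M) (h5 : 5 * M ^ 2 < 1)
    (hi : ∀ x, ‖fderiv ℝ (f 0) x‖ ≤ M) : ∀ t ∈ Icc 0 T, ∀ x, ‖fderiv ℝ (f t) x‖ ≤ M := by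
  have key : ∀ t, 0 ≤ t → t < T → ∀ x, ‖fderiv ℝ (f t) x‖ ≤ M := by
    intro t t0 tT x
    have c1 : Tendsto (fun ε : ℝ => 5 * (M + ε * (1 + T)) ^ 2) (𝓝[>] 0) (𝓝 (5 * (M + 0 * (1 + T)) ^ 2)) :=
      (Continuous.tendsto (by fun_prop) 0).mono_left nhdsWithin_le_nhds
    have c2 : Tendsto (fun ε : ℝ => M + ε * (1 + t)) (𝓝[>] 0) (𝓝 (M + 0 * (1 + t))) :=
      (Continuous.tendsto (by fun_prop) 0).mono_left nhdsWithin_le_nhds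
    have c3 := c1.eventually_lt_const (u := 1) (by simpa using h5)
    have := ge_of_tendsto c2 (b := ‖fderiv ℝ (f t) x‖) (by
      filter_upwards [c3, self_mem_nhdsWithin] with ε h1 h2
      exact (slope_step hs hM h2 h1 hi t t0 tT x).le)
    simpa using this
  intro t ht x
  rcases ht.2.eq_or_lt with h | h
  · refine left_limit (t0 := 0) (F := fun s => ‖fderiv ℝ (f s) x‖) (G := fun _ => M) (h ▸ hT)
      (((sol_contW hs ht x).mono (fun s hs' => ⟨hs'.1, (hs'.2.trans_le ht.2).le⟩)).norm)
      continuousWithinAt_const (fun s h1 h2 => key s h1 (h2.trans_le ht.2) x)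
  · exact key t ht.1 h x

end

/-- strict modulus -/
def Strict (δ γ L : ℝ) (g : E2 → ℝ) : Prop :=
  ∀ x y, x ≠ y → ‖fderiv ℝ g x - fderiv ℝ g y‖ < omegaMod δ γ (L * ‖x - y‖)

lemma strict_D2 {δ γ L B : ℝ} {g : E2 → ℝ} (hp : PH δ γ) (L0 : 0 < L) (hb : Bd g B)
    (hst : Strict δ γ L g) : ∃ κ, 0 < κ ∧ ∀ x, ‖fderiv ℝ (fderiv ℝ g) x‖ ≤ L - κ := by
  have d0 := hp.pos
  have B0 : 0 < B := lt_of_lt_of_le one_pos hb.one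
  obtain ⟨σ, s0, s1, s2⟩ : ∃ σ > 0, σ ^ 2 ≤ δ ∧ B * σ ≤ L ^ 2 / 2 := by
    refine ⟨min (Real.sqrt δ) (L ^ 2 / 2 / B), lt_min (Real.sqrt_pos.2 d0) (by positivity), ?_, ?_⟩
    · calc (min (Real.sqrt δ) (L ^ 2 / 2 / B)) ^ 2 ≤ Real.sqrt δ ^ 2 := by
            gcongr; exact min_le_left _ _
        _ = δ := Real.sq_sqrt d0.le
    · calc B * min (Real.sqrt δ) (L ^ 2 / 2 / B) ≤ B * (L ^ 2 / 2 / B) := by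
            gcongr; exact min_le_right _ _
        _ = _ := by field_simp
  have sd : σ ≤ 1 / 30 := by
    have := sqrt_le_of_PH hp s1
    rwa [Real.sqrt_sq s0.le] at this
  have r0 : 0 < σ ^ 2 / L := by positivity
  refine ⟨L * σ / 2, by positivity, fun x => ?_⟩
  refine ContinuousLinearMap.opNorm_le_of_unit_norm (by nlinarith) (fun v hv => ?_)
  set h := (σ ^ 2 / L) • v with hh
  have nh : ‖h‖ = σ ^ 2 / L := by
    rw [hh, norm_smul, hv, Real.norm_eq_abs, abs_of_pos r0, mul_one]
  have h0 : h ≠ 0 := by rw [← norm_pos_iff, nh]; exact r0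
  have a1 := taylor1 (u := fderiv ℝ g) (C := B * ‖h‖) hb.dg1 x h (fun k hk => by
    have := hb.b3 x (x + k)
    rw [add_sub_cancel_left] at this
    exact this.trans (by gcongr))
  have a2 := hst (x + h) x (by simpa using h0)
  rw [add_sub_cancel_left, nh, mul_div_cancel₀ _ L0.ne', omega_small (by positivity) s1,
    Real.sqrt_sq s0.le] at a2
  have a3 : fderiv ℝ (fderiv ℝ g) x h = (σ ^ 2 / L) • fderiv ℝ (fderiv ℝ g) x v := by
    rw [hh, map_smul]
  have a4 := norm_sub_norm_le (fderiv ℝ (fderiv ℝ g) x h) (fderiv ℝ g (x + h) - fderiv ℝ g x)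
  rw [norm_sub_rev (fderiv ℝ (fderiv ℝ g) x h)] at a4
  rw [a3, norm_smul, Real.norm_eq_abs, abs_of_pos r0, ← a3] at a4
  rw [nh] at a1
  have a5 : σ ^ 2 / L * ‖fderiv ℝ (fderiv ℝ g) x v‖ ≤ σ ^ 2 / L * (L - L * σ / 2) := by
    have e1 : σ ^ 2 / L * (L - L * σ / 2) = σ ^ 2 - σ ^ 2 * σ + σ ^ 2 * σ / 2 := by
      field_simp; ring
    have e2 : B * (σ ^ 2 / L) * (σ ^ 2 / L) ≤ σ ^ 2 * σ / 2 := by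
      calc B * (σ ^ 2 / L) * (σ ^ 2 / L) = (B * σ) * (σ ^ 3 / L ^ 2) := by field_simp
        _ ≤ (L ^ 2 / 2) * (σ ^ 3 / L ^ 2) := by gcongr
        _ = _ := by field_simp
    linarith
  exact le_of_mul_le_mul_left a5 r0

lemma strict_mid {δ γ L r0 R2 : ℝ} {g : E2 → ℝ} (hp : PH δ γ) (L0 : 0 < L) (h0 : 0 < r0)
    (hc : Continuous (fderiv ℝ g)) (hd : Tendsto (fun x => ‖fderiv ℝ g x‖) (cocompact E2) (𝓝 0))
    (hst : Strict δ γ L g) : ∃ μ > 0, ∀ x y, r0 ≤ ‖x - y‖ → ‖x - y‖ ≤ R2 →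
      ‖fderiv ℝ g x - fderiv ℝ g y‖ + μ ≤ omegaMod δ γ (L * ‖x - y‖) := by
  set m := omegaMod δ γ (L * r0) with hm
  have m0 : 0 < m := omega_pos hp (by positivity)
  have ev := hd.eventually_lt_const (show 0 < m / 4 by positivity)
  rw [← Metric.cobounded_eq_cocompact] at ev
  obtain ⟨N, -, hN⟩ := (Metric.hasBasis_cobounded_compl_closedBall (0 : E2)).eventually_iff.1 ev
  have far : ∀ z : E2, N < ‖z‖ → ‖fderiv ℝ g z‖ < m / 4 := fun z hz => hN (by simpa using hz)
  set K : Set (E2 × E2) := Metric.closedBall 0 (N + R2) ×ˢ Metric.closedBall 0 (N + R2) ∩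
    {p | r0 ≤ ‖p.1 - p.2‖} with hK
  have Kc : IsCompact K := by
    refine ((isCompact_closedBall _ _).prod (isCompact_closedBall _ _)).inter_right ?_
    exact isClosed_le continuous_const (by fun_prop)
  set Φ : E2 × E2 → ℝ := fun p =>
    omegaMod δ γ (L * ‖p.1 - p.2‖) - ‖fderiv ℝ g p.1 - fderiv ℝ g p.2‖ with hΦ
  have Φc : Continuous Φ := by
    have c1 : Continuous (fun p : E2 × E2 => omegaMod δ γ (L * ‖p.1 - p.2‖)) := by
      refine (omega_cont hp).comp_continuous (by fun_prop) (fun p => ?_)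
      show 0 ≤ L * ‖p.1 - p.2‖
      positivity
    exact c1.sub ((hc.comp continuous_fst).sub (hc.comp continuous_snd)).norm
  obtain ⟨μ1, m1, hμ1⟩ : ∃ μ1 > 0, ∀ p ∈ K, μ1 ≤ Φ p := by
    rcases K.eq_empty_or_nonempty with h | h
    · exact ⟨1, one_pos, fun p hp' => by rw [h] at hp'; exact hp'.elim⟩
    · obtain ⟨q, qK, hq⟩ := Kc.exists_isMinOn h Φc.continuousOn
      refine ⟨Φ q, ?_, fun p hp' => hq hp'⟩
      have hne : q.1 ≠ q.2 := by
        intro h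
        have h2 : r0 ≤ ‖q.1 - q.2‖ := qK.2
        rw [h, sub_self, norm_zero] at h2
        linarith
      have := hst q.1 q.2 hne
      simp only [hΦ]; linarith
  refine ⟨min μ1 (m / 2), lt_min m1 (by positivity), fun x y h1 h2 => ?_⟩
  by_cases hxy : (x, y) ∈ K
  · have := hμ1 _ hxy
    simp only [hΦ] at this
    have := min_le_left μ1 (m / 2)
    linarith
  · have hxy2 : N < ‖x‖ ∧ N < ‖y‖ := by
      by_contra hcon
      apply hxy
      have t1 : ‖x‖ ≤ ‖y‖ + ‖x - y‖ := norm_le_norm_add_norm_sub' x y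
      have t2 : ‖y‖ ≤ ‖x‖ + ‖x - y‖ := norm_le_norm_add_norm_sub x y
      have R20 : 0 ≤ R2 := (norm_nonneg _).trans h2
      refine ⟨⟨?_, ?_⟩, h1⟩ <;> simp only [Metric.mem_closedBall, dist_zero_right] <;>
        · by_contra hh
          apply hcon
          constructor <;> linarith
    have a1 := far x hxy2.1
    have a2 := far y hxy2.2
    have a3 := norm_sub_le (fderiv ℝ g x) (fderiv ℝ g y)
    have a4 := omega_mono hp (r := L * r0) (s := L * ‖x - y‖) (by positivity) (by gcongr)
    have := min_le_right μ1 (m / 2)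
    linarith

lemma open_static {δ γ L B M R0 : ℝ} {g : E2 → ℝ} (hp : PH δ γ) (L0 : 0 < L) (hb : Bd g B)
    (r0 : 0 < R0) (hR : omegaMod δ γ R0 = 2 * M)
    (hd : Tendsto (fun x => ‖fderiv ℝ g x‖) (cocompact E2) (𝓝 0))
    (hst : Strict δ γ L g) : ∃ η > 0, ∀ (g' : E2 → ℝ) (L' : ℝ), ContDiff ℝ 3 g' →
      (∀ x, ‖fderiv ℝ g' x - fderiv ℝ g x‖ ≤ η) →
      (∀ x, ‖fderiv ℝ (fderiv ℝ g') x - fderiv ℝ (fderiv ℝ g) x‖ ≤ η) →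
      (∀ x, ‖fderiv ℝ g' x‖ ≤ M) → L - η ≤ L' → L' ≤ L → Strict δ γ L' g' := by
  have d0 := hp.pos
  obtain ⟨κ, k0, hκ⟩ := strict_D2 hp L0 hb hst
  obtain ⟨σ, s0, s1, s2⟩ : ∃ σ > 0, σ ^ 2 ≤ δ ∧ L * σ ≤ κ / 8 := by
    refine ⟨min (Real.sqrt δ) (κ / 8 / L), lt_min (Real.sqrt_pos.2 d0) (by positivity), ?_, ?_⟩
    · calc (min (Real.sqrt δ) (κ / 8 / L)) ^ 2 ≤ Real.sqrt δ ^ 2 := by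
            gcongr; exact min_le_left _ _
        _ = δ := Real.sq_sqrt d0.le
    · calc L * min (Real.sqrt δ) (κ / 8 / L) ≤ L * (κ / 8 / L) := by
            gcongr; exact min_le_right _ _
        _ = _ := by field_simp
  set ρ := σ ^ 2 / L with hρ
  have ρ0 : 0 < ρ := by positivity
  set R2 := 2 * (R0 + 1) / L with hR2
  have R20 : 0 < R2 := by positivity
  obtain ⟨μ, m0, hμ⟩ := strict_mid (R2 := R2) hp L0 ρ0 (cd_fderiv hb.cd).continuous hd hst
  obtain ⟨η, e0, e1, e2, e3, e4⟩ : ∃ η > 0, η ≤ κ / 8 ∧ η ≤ L / 2 ∧ η ≤ μ / 8 ∧ η * R2 ≤ μ / 8 := by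
    refine ⟨min (min (κ / 8) (L / 2)) (min (μ / 8) (μ / 8 / R2)), by positivity, ?_, ?_, ?_, ?_⟩
    · exact (min_le_left _ _).trans (min_le_left _ _)
    · exact (min_le_left _ _).trans (min_le_right _ _)
    · exact (min_le_right _ _).trans (min_le_left _ _)
    · rw [← le_div_iff₀ R20]
      exact (min_le_right _ _).trans (min_le_right _ _)
  refine ⟨η, e0, fun g' L' cd h1 h2 h3 h4 h5 x y hxy => ?_⟩
  have L0' : 0 < L' := by linarith
  have n0 : 0 < ‖x - y‖ := norm_pos_iff.2 (sub_ne_zero.2 hxy)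
  rcases le_or_gt ‖x - y‖ ρ with ha | ha
  · have b2 : ∀ z, ‖fderiv ℝ (fderiv ℝ g') z‖ ≤ L - κ / 2 := by
      intro z
      have := norm_le_norm_add_norm_sub' (fderiv ℝ (fderiv ℝ g') z) (fderiv ℝ (fderiv ℝ g) z)
      linarith [hκ z, h2 z]
    have li := lip_of_fderiv ((cd_fderiv cd).differentiable (by norm_num)) b2 y x
    have q1 : L' * ‖x - y‖ ≤ σ ^ 2 := by
      calc L' * ‖x - y‖ ≤ L * ρ := by gcongr
        _ = σ ^ 2 := by rw [hρ]; field_simp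
    rw [omega_small (by positivity) (q1.trans s1)]
    have q2 : Real.sqrt (L' * ‖x - y‖) ≤ σ := Real.sqrt_le_iff.2 ⟨s0.le, q1⟩
    have q3 : L' * ‖x - y‖ * Real.sqrt (L' * ‖x - y‖) ≤ ‖x - y‖ * (κ / 8) := by
      calc L' * ‖x - y‖ * Real.sqrt (L' * ‖x - y‖) ≤ L * ‖x - y‖ * σ := by gcongr
        _ = ‖x - y‖ * (L * σ) := by ring
        _ ≤ _ := by gcongr
    have q4 : (L - κ / 8) * ‖x - y‖ ≤ L' * ‖x - y‖ := by gcongr; linarith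
    nlinarith [mul_pos n0 k0]
  · rcases le_or_gt ‖x - y‖ R2 with hb' | hb'
    · have q := hμ x y ha.le hb'
      have t1 : ‖fderiv ℝ g' x - fderiv ℝ g' y‖ ≤ ‖fderiv ℝ g x - fderiv ℝ g y‖ + 2 * η := by
        have e : fderiv ℝ g' x - fderiv ℝ g' y = (fderiv ℝ g x - fderiv ℝ g y) +
          ((fderiv ℝ g' x - fderiv ℝ g x) - (fderiv ℝ g' y - fderiv ℝ g y)) := by abel
        rw [e]
        have a1 := norm_add_le (fderiv ℝ g x - fderiv ℝ g y)
          ((fderiv ℝ g' x - fderiv ℝ g x) - (fderiv ℝ g' y - fderiv ℝ g y))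
        have a2 := norm_sub_le (fderiv ℝ g' x - fderiv ℝ g x) (fderiv ℝ g' y - fderiv ℝ g y)
        linarith [h1 x, h1 y]
      have t2 := omega_lip hp (r := L' * ‖x - y‖) (s := L * ‖x - y‖) (by positivity) (by gcongr)
      have t3 : (L - L') * ‖x - y‖ ≤ η * R2 := by
        apply mul_le_mul (by linarith) hb' n0.le e0.le
      linarith
    · have t1 := norm_sub_le (fderiv ℝ g' x) (fderiv ℝ g' y)
      have t2 : R0 < L' * ‖x - y‖ := by
        calc R0 < R0 + 1 := by linarith
          _ = L / 2 * R2 := by rw [hR2]; field_simp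
          _ ≤ L' * ‖x - y‖ := by gcongr; linarith
      have t3 := omega_lt hp r0.le t2
      linarith [h3 x, h3 y]

/-! ### Part 10: the moving modulus and the conclusion -/

section
variable {T : ℝ} {f : ℝ → E2 → ℝ} {δ γ M R0 : ℝ}

lemma omega_time_cont (hp : PH δ γ) {C a t r : ℝ} (C0 : 0 < C) (r0 : 0 ≤ r) (hat : 0 < a + 2 * t)
    (s : Set ℝ) : ContinuousWithinAt (fun s => omegaMod δ γ (C / (a + 2 * s) * r)) s t := by
  apply ContinuousAt.continuousWithinAt
  have c1 : ContinuousAt (fun s : ℝ => C / (a + 2 * s) * r) t := by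
    have : a + 2 * t ≠ 0 := hat.ne'
    fun_prop (disch := assumption)
  have m0 : (0 : ℝ) ≤ C / (a + 2 * t) * r := by positivity
  have c2 := omega_cont hp _ (show C / (a + 2 * t) * r ∈ Ici 0 from m0)
  have ev : ∀ᶠ s in 𝓝 t, C / (a + 2 * s) * r ∈ Ici (0 : ℝ) := by
    have : ∀ᶠ s in 𝓝 t, 0 < a + 2 * s :=
      (Continuous.tendsto (by fun_prop : Continuous fun s : ℝ => a + 2 * s) t).eventually_const_lt hat
    filter_upwards [this] with s hs
    exact Set.mem_Ici.2 (by positivity)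
  exact c2.tendsto.comp (tendsto_nhdsWithin_iff.2 ⟨c1, ev⟩)

/-- weak modulus at the right end of an interval -/
lemma weak_limit (hp : PH δ γ) (hs : SmoothDecaySol T f) {C a t0 t : ℝ} (C0 : 0 < C)
    (h0 : 0 ≤ t0) (ha : 0 ≤ a) (htt : t0 < t) (tT : t ≤ T)
    (h : ∀ s, t0 ≤ s → s < t → ∀ x y, x ≠ y →
      ‖fderiv ℝ (f s) x - fderiv ℝ (f s) y‖ ≤ omegaMod δ γ (C / (a + 2 * s) * ‖x - y‖)) (x y : E2) :
    ‖fderiv ℝ (f t) x - fderiv ℝ (f t) y‖ ≤ omegaMod δ γ (C / (a + 2 * t) * ‖x - y‖) := by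
  have ht : t ∈ Icc 0 T := ⟨by linarith, tT⟩
  rcases eq_or_ne x y with rfl | hxy
  · simp [omega_zero hp]
  have sub : Ico t0 t ⊆ Icc 0 T := fun s hs' => ⟨h0.trans hs'.1, (hs'.2.trans_le tT).le⟩
  refine left_limit (t0 := t0) (F := fun s => ‖fderiv ℝ (f s) x - fderiv ℝ (f s) y‖)
    (G := fun s => omegaMod δ γ (C / (a + 2 * s) * ‖x - y‖)) htt
    ((((sol_contW hs ht x).mono sub).sub ((sol_contW hs ht y).mono sub)).norm)
    (omega_time_cont hp C0 (norm_nonneg _) (by linarith) _) (fun s h1 h2 => h s h1 h2 x y hxy)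

set_option maxHeartbeats 2000000 in
lemma touch_absurd (hp : PH δ γ) (hs : SmoothDecaySol T f) (hM : 0 < M) (h5 : 5 * M ^ 2 < 1)
    (sl : ∀ t ∈ Icc 0 T, ∀ x, ‖fderiv ℝ (f t) x‖ ≤ M) (r0 : 0 < R0)
    (hR : omegaMod δ γ R0 = 2 * M) (hd : 4000000 * Real.sqrt δ ≤ (1 - 5 * M ^ 2) / 2)
    {a t0 t : ℝ} (ha : 0 ≤ a) (h0 : 0 ≤ t0) (ha0 : 0 < a + 2 * t0) (htt : t0 < t) (tT : t < T)
    (hP : ∀ s, t0 ≤ s → s < t → Strict δ γ (R0 / (2 * M) / (a + 2 * s)) (f s)) :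
    Strict δ γ (R0 / (2 * M) / (a + 2 * t)) (f t) := by
  set C := R0 / (2 * M) with hC
  have C0 : 0 < C := by positivity
  have t0' : 0 < t := by linarith
  have ht : t ∈ Icc 0 T := ⟨t0'.le, tT.le⟩
  have weak := weak_limit hp hs C0 h0 ha htt tT.le (fun s h1 h2 x y hxy => (hP s h1 h2 x y hxy).le)
  intro x y hxy
  refine lt_of_le_of_ne (weak x y) (fun heq => ?_)
  have D0 : 0 < a + 2 * t := by linarith
  set L := C / (a + 2 * t) with hL
  have L0 : 0 < L := by positivity
  set ξ := ‖x - y‖ with hξ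
  have x0 : 0 < ξ := norm_pos_iff.2 (sub_ne_zero.2 hxy)
  obtain ⟨e, he, hφ⟩ := exists_dual (fderiv ℝ (f t) x - fderiv ℝ (f t) y)
  have H : Touch δ γ M L (f t) e (ξ⁻¹ • (x - y)) x y ξ :=
    { ph := hp, cd := hs.1 t ht, L0 := L0, M0 := hM.le, M5 := h5, slope := sl t ht, he := he
      hv := by rw [norm_smul, norm_inv, Real.norm_eq_abs, abs_of_pos x0, ← hξ, inv_mul_cancel₀ x0.ne']
      x0 := x0
      xy := by rw [smul_smul, mul_inv_cancel₀ x0.ne', one_smul]; abel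
      mod := weak
      eq := by rw [← heq, ← hφ]; rfl }
  obtain ⟨κ, k0, R1, hR1⟩ := H.static hM r0 hR hd
  obtain ⟨R2, hR2⟩ := evol1 hs ⟨t0', tT⟩ he x (η := κ / 8) (by positivity)
  obtain ⟨R3, hR3⟩ := evol1 hs ⟨t0', tT⟩ he y (η := κ / 8) (by positivity)
  set R := max R1 (max R2 R3)
  have st := hR1 R (le_max_left _ _)
  obtain ⟨d2, d20, hd2⟩ := hR2 R ((le_max_left _ _).trans (le_max_right _ _))
  obtain ⟨d3, d30, hd3⟩ := hR3 R ((le_max_right _ _).trans (le_max_right _ _))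
  set P := omegaP δ γ (L * ξ) with hPdef
  have P0 : 0 < P := omegaP_pos hp
  have c1 : ContinuousAt (fun s : ℝ => 2 * P * ξ * (L / C) * (C / (a + 2 * s) - L)) t := by
    have : a + 2 * t ≠ 0 := D0.ne'
    fun_prop (disch := assumption)
  have ev1 : ∀ᶠ s in 𝓝[<] t, 2 * P * ξ * (L / C) * (C / (a + 2 * s) - L) < κ / 4 := by
    refine (c1.tendsto.mono_left nhdsWithin_le_nhds).eventually_lt_const ?_
    rw [← hL]; simpa using k0
  have ev2 : ∀ᶠ s in 𝓝[<] t, s ∈ Ioo (max t0 (max (t - d2) (t - d3))) t :=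
    Ioo_mem_nhdsLT (max_lt htt (max_lt (by linarith) (by linarith)))
  obtain ⟨s, e1, e2⟩ := (ev1.and ev2).exists
  have s1 : t0 < s := lt_of_le_of_lt (le_max_left _ _) e2.1
  have s2 : t - d2 < s := lt_of_le_of_lt ((le_max_left _ _).trans (le_max_right _ _)) e2.1
  have s3 : t - d3 < s := lt_of_le_of_lt ((le_max_right _ _).trans (le_max_right _ _)) e2.1
  have s4 : s < t := e2.2
  have q2 := (abs_le.1 (hd2 s ⟨s2, s4⟩)).2
  have q3 := (abs_le.1 (hd3 s ⟨s3, s4⟩)).1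
  have Ds : 0 < a + 2 * s := by linarith
  set Ls := C / (a + 2 * s) with hLs
  have Ls0 : 0 < Ls := by positivity
  have m1 : fderiv ℝ (f s) x e - fderiv ℝ (f s) y e ≤ omegaMod δ γ (Ls * ξ) :=
    (le_abs_self _).trans (apply_le' he (hP s s1.le s4 x y hxy).le)
  have m2 := omega_sup hp (mul_pos L0 x0) (mul_pos Ls0 x0).le
  rw [← hPdef] at m2
  have m3 : Ls - L = 2 * (t - s) * (Ls * L / C) := by
    rw [hLs, hL]; field_simp; ring
  have m4 : P * (Ls * ξ - L * ξ) = (t - s) * (2 * P * ξ * (L / C) * Ls) := by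
    calc P * (Ls * ξ - L * ξ) = P * ξ * (Ls - L) := by ring
      _ = _ := by rw [m3]; ring
  have m5 : 2 * P * (L * ξ) * (L / C) = 2 * P * ξ * (L / C) * L := by ring
  rw [m5] at st
  have ts : 0 < t - s := by linarith
  have eq := H.eq
  have fin : (t - s) * (2 * P * ξ * (L / C) * Ls + (JR (f t) e x R - JR (f t) e y R) + κ / 4) ≥ 0 := by
    rw [mul_add, mul_add, ← m4]
    linarith
  have neg : 2 * P * ξ * (L / C) * Ls + (JR (f t) e x R - JR (f t) e y R) + κ / 4 < 0 := by
    have : 2 * P * ξ * (L / C) * (Ls - L) =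
      2 * P * ξ * (L / C) * Ls - 2 * P * ξ * (L / C) * L := by ring
    linarith
  exact absurd fin (not_le.2 (mul_neg_of_pos_of_neg ts neg))

lemma strict_prop (hp : PH δ γ) (hs : SmoothDecaySol T f) (hM : 0 < M) (h5 : 5 * M ^ 2 < 1)
    (sl : ∀ t ∈ Icc 0 T, ∀ x, ‖fderiv ℝ (f t) x‖ ≤ M) (r0 : 0 < R0)
    (hR : omegaMod δ γ R0 = 2 * M) (hd : 4000000 * Real.sqrt δ ≤ (1 - 5 * M ^ 2) / 2)
    {a t0 : ℝ} (ha : 0 ≤ a) (h0 : 0 ≤ t0) (ha0 : 0 < a + 2 * t0)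
    (hst : Strict δ γ (R0 / (2 * M) / (a + 2 * t0)) (f t0)) :
    ∀ t, t0 ≤ t → t < T → Strict δ γ (R0 / (2 * M) / (a + 2 * t)) (f t) := by
  have C0 : 0 < R0 / (2 * M) := by positivity
  refine continuation hst ?_ ?_
  · intro t t1 tT hP
    have ht : t ∈ Icc 0 T := ⟨by linarith, tT.le⟩
    have D0 : 0 < a + 2 * t := by linarith
    set C := R0 / (2 * M)
    obtain ⟨B, ε0, e00, hB⟩ := sol_bd hs ht
    have hb := hB t ht (by simpa using e00)
    obtain ⟨η, η0, hη⟩ := open_static hp (by positivity) hb r0 hR (sol_decay hs ht) hP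
    obtain ⟨d1, d10, hd1⟩ := (sol_close hs ht).2.1 η η0
    obtain ⟨d2, d20, hd2⟩ := (sol_close hs ht).2.2 η η0
    have c1 : ContinuousAt (fun s : ℝ => C / (a + 2 * s)) t := by
      have : a + 2 * t ≠ 0 := D0.ne'
      fun_prop (disch := assumption)
    obtain ⟨d3, d30, hd3⟩ := Metric.continuousAt_iff.1 c1 η η0
    refine ⟨min d1 (min d2 d3), by positivity, fun s h1 h2 h3 => ?_⟩
    have k1 : s < t + d1 := lt_of_lt_of_le h2 (by gcongr; exact min_le_left _ _)
    have k2 : s < t + d2 := lt_of_lt_of_le h2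
      (by gcongr; exact (min_le_right _ _).trans (min_le_left _ _))
    have k3 : s < t + d3 := lt_of_lt_of_le h2
      (by gcongr; exact (min_le_right _ _).trans (min_le_right _ _))
    have hs' : s ∈ Icc 0 T := ⟨by linarith, h3.le⟩
    have k4 := hd3 (show dist s t < d3 by rw [Real.dist_eq, abs_lt]; constructor <;> linarith)
    rw [Real.dist_eq, abs_lt] at k4
    refine hη (f s) _ (hs.1 s hs') (hd1 s hs' (by rw [abs_lt]; constructor <;> linarith))
      (hd2 s hs' (by rw [abs_lt]; constructor <;> linarith)) (sl s hs') (by linarith [k4.1]) ?_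
    have : (0 : ℝ) < a + 2 * t := D0
    gcongr
  · intro t h1 h2 h3
    exact touch_absurd hp hs hM h5 sl r0 hR hd ha h0 ha0 h1 h2 h3

lemma weak_prop (hp : PH δ γ) (hs : SmoothDecaySol T f) (hM : 0 < M) (h5 : 5 * M ^ 2 < 1)
    (sl : ∀ t ∈ Icc 0 T, ∀ x, ‖fderiv ℝ (f t) x‖ ≤ M) (r0 : 0 < R0)
    (hR : omegaMod δ γ R0 = 2 * M) (hd : 4000000 * Real.sqrt δ ≤ (1 - 5 * M ^ 2) / 2)
    {a t0 : ℝ} (ha : 0 ≤ a) (h0 : 0 ≤ t0) (ha0 : 0 < a + 2 * t0)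
    (hst : Strict δ γ (R0 / (2 * M) / (a + 2 * t0)) (f t0)) {t : ℝ} (htt : t0 ≤ t) (tT : t ≤ T)
    (x y : E2) : ‖fderiv ℝ (f t) x - fderiv ℝ (f t) y‖ ≤
      omegaMod δ γ (R0 / (2 * M) / (a + 2 * t) * ‖x - y‖) := by
  have key := strict_prop hp hs hM h5 sl r0 hR hd ha h0 ha0 hst
  have C0 : 0 < R0 / (2 * M) := by positivity
  rcases eq_or_ne x y with rfl | hxy
  · simp [omega_zero hp]
  rcases tT.eq_or_lt with h | h
  · rcases htt.eq_or_lt with h' | h'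
    · rw [← h']; exact (hst x y hxy).le
    · exact weak_limit hp hs C0 h0 ha h' tT
        (fun s h1 h2 x y hxy => (key s h1 (h2.trans_le tT) x y hxy).le) x y
  · exact (key t htt h x y hxy).le

/-- conclusion (ii) -/
lemma concl_two (hp : PH δ γ) (hs : SmoothDecaySol T f) (hT : 0 < T) (hM : 0 < M)
    (h5 : 5 * M ^ 2 < 1)
    (sl : ∀ t ∈ Icc 0 T, ∀ x, ‖fderiv ℝ (f t) x‖ ≤ M) (r0 : 0 < R0)
    (hR : omegaMod δ γ R0 = 2 * M) (hd : 4000000 * Real.sqrt δ ≤ (1 - 5 * M ^ 2) / 2)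
    {t : ℝ} (t0 : 0 < t) (tT : t ≤ T) {x y : E2} (hxy : x ≠ y) :
    ‖fderiv ℝ (f t) x - fderiv ℝ (f t) y‖ < omegaMod δ γ (R0 / (2 * M) * (‖x - y‖ / t)) := by
  have z : (0 : ℝ) ∈ Icc 0 T := ⟨le_rfl, hT.le⟩
  obtain ⟨B, ε0, e00, hB⟩ := sol_bd hs z
  have B1 : 1 ≤ B := (hB 0 z (by simpa using e00)).one
  have B0 : 0 < B := by linarith
  obtain ⟨τ, τ0, τ1, τ2, τ3⟩ : ∃ τ > 0, τ < ε0 ∧ τ ≤ t ∧ B * (2 * τ) < 1 := by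
    refine ⟨min (ε0 / 2) (min t (1 / (4 * B))), by positivity, ?_, ?_, ?_⟩
    · exact lt_of_le_of_lt (min_le_left _ _) (by linarith)
    · exact (min_le_right _ _).trans (min_le_left _ _)
    · calc B * (2 * min (ε0 / 2) (min t (1 / (4 * B)))) ≤ B * (2 * (1 / (4 * B))) := by
            gcongr; exact (min_le_right _ _).trans (min_le_right _ _)
        _ = 1 / 2 := by field_simp; norm_num
        _ < 1 := by norm_num
  have hτ : τ ∈ Icc 0 T := ⟨τ0.le, τ2.trans tT⟩
  have hb := hB τ hτ (by rwa [sub_zero, abs_of_pos τ0])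
  have C0 : 0 < R0 / (2 * M) := by positivity
  have st : Strict δ γ (R0 / (2 * M) / (0 + 2 * τ)) (f τ) := by
    intro u v huv
    have n0 : 0 < ‖u - v‖ := norm_pos_iff.2 (sub_ne_zero.2 huv)
    rw [zero_add]
    rcases le_or_gt (R0 / (2 * M) / (2 * τ) * ‖u - v‖) R0 with h | h
    · have li := lip_of_fderiv hb.dg1 hb.b2 v u
      have sc := omega_scale hp r0.le (θ := R0 / (2 * M) / (2 * τ) * ‖u - v‖ / R0) (by positivity)
        ((div_le_one r0).2 h)
      rw [div_mul_cancel₀ _ r0.ne', hR] at sc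
      refine lt_of_lt_of_le ?_ sc
      refine lt_of_le_of_lt li ?_
      have e1 : R0 / (2 * M) / (2 * τ) * ‖u - v‖ / R0 * (2 * M) = 1 / (2 * τ) * ‖u - v‖ := by
        field_simp
      rw [e1]
      have : B < 1 / (2 * τ) := by rw [lt_div_iff₀ (by positivity)]; exact τ3
      gcongr
    · have t1 := norm_sub_le (fderiv ℝ (f τ) u) (fderiv ℝ (f τ) v)
      have t3 := omega_lt hp r0.le h
      linarith [sl τ hτ u, sl τ hτ v]
  have w := weak_prop hp hs hM h5 sl r0 hR hd le_rfl τ0.le (by linarith) st τ2 tT x y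
  refine lt_of_le_of_lt w (omega_lt hp (by positivity) ?_)
  have n0 : 0 < ‖x - y‖ := norm_pos_iff.2 (sub_ne_zero.2 hxy)
  rw [zero_add]
  have : R0 / (2 * M) / (2 * t) * ‖x - y‖ = R0 / (2 * M) * (‖x - y‖ / t) / 2 := by
    field_simp
  rw [this]
  exact half_lt_self (by positivity)

/-- conclusion (i) for positive shift -/
lemma concl_one (hp : PH δ γ) (hs : SmoothDecaySol T f) (hT : 0 < T) (hM : 0 < M)
    (h5 : 5 * M ^ 2 < 1)
    (sl : ∀ t ∈ Icc 0 T, ∀ x, ‖fderiv ℝ (f t) x‖ ≤ M) (r0 : 0 < R0)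
    (hR : omegaMod δ γ R0 = 2 * M) (hd : 4000000 * Real.sqrt δ ≤ (1 - 5 * M ^ 2) / 2)
    {b : ℝ} (b0 : 0 < b)
    (hi : ∀ x y : E2, x ≠ y →
      ‖fderiv ℝ (f 0) x - fderiv ℝ (f 0) y‖ ≤ omegaMod δ γ (R0 / (2 * M) * (‖x - y‖ / b)))
    {t : ℝ} (t0 : 0 ≤ t) (tT : t ≤ T) {x y : E2} (hxy : x ≠ y) :
    ‖fderiv ℝ (f t) x - fderiv ℝ (f t) y‖ ≤ omegaMod δ γ (R0 / (2 * M) * (‖x - y‖ / (t + b))) := by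
  have C0 : 0 < R0 / (2 * M) := by positivity
  have n0 : 0 < ‖x - y‖ := norm_pos_iff.2 (sub_ne_zero.2 hxy)
  rcases t0.eq_or_lt with h | h
  · rw [← h, zero_add]; exact hi x y hxy
  · set a := max (b / 2) (b - t) with ha
    have a0 : 0 < a := lt_of_lt_of_le (by positivity) (le_max_left _ _)
    have ab : a < b := max_lt (by linarith) (by linarith)
    have st : Strict δ γ (R0 / (2 * M) / (a + 2 * 0)) (f 0) := by
      intro u v huv
      have n1 : 0 < ‖u - v‖ := norm_pos_iff.2 (sub_ne_zero.2 huv)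
      refine lt_of_le_of_lt (hi u v huv) (omega_lt hp (by positivity) ?_)
      have e1 : R0 / (2 * M) / (a + 2 * 0) * ‖u - v‖ = R0 / (2 * M) * (‖u - v‖ / a) := by ring
      rw [e1]
      gcongr
    have w := weak_prop hp hs hM h5 sl r0 hR hd a0.le le_rfl (by linarith) st t0 tT x y
    refine w.trans (omega_mono hp (by positivity) ?_)
    have e1 : R0 / (2 * M) / (a + 2 * t) * ‖x - y‖ = R0 / (2 * M) * (‖x - y‖ / (a + 2 * t)) := by ring
    rw [e1]
    have : b - t ≤ a := le_max_right _ _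
    exact mul_le_mul_of_nonneg_left
      (div_le_div_of_nonneg_left n0.le (by linarith) (by linarith)) C0.le

end

lemma exists_params {M : ℝ} (h5 : 5 * M ^ 2 < 1) :
    ∃ δ γ : ℝ, PH δ γ ∧ 4000000 * Real.sqrt δ ≤ (1 - 5 * M ^ 2) / 2 := by
  have l0 : 0 < (1 - 5 * M ^ 2) / 2 := by linarith
  have l1 : (1 - 5 * M ^ 2) / 2 ≤ 1 / 2 := by nlinarith [sq_nonneg M]
  set l := (1 - 5 * M ^ 2) / 2
  refine ⟨(l / 4000000) ^ 2, (l / 4000000) ^ 2 / 16, ⟨by positivity, by nlinarith, rfl⟩, ?_⟩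
  rw [Real.sqrt_sq (by positivity)]
  linarith

/-- **Lemma 6.2 of the paper (generation of a modulus of continuity).** Let
`‖∇f(0,·)‖_{L∞} ≤ M < 1/√5`. There are parameters `δ, γ ∈ (0,1)` (for which the strict
modulus inequality of Lemma 5.4 holds, with constants determined by `M`) such that,
setting `C := ω^{-1}(2M)/(2M)` and `ω̄(r) := ω_{δ,γ}(C r)`: (i) for any `δ' ≥ 0`, if
`∇f(0,·)` has modulus `ω̄(·/δ')` then `∇f(t,·)` has modulus `ω̄(·/(t+δ'))` for all
`t ∈ [0,T]`; and (ii) in particular `|∇f(t,x) − ∇f(t,y)| < ω̄(|x−y|/t)` for all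
`t ∈ (0,T]` and `x ≠ y`. -/
theorem muskat_generation_of_modulus (M : ℝ) (hM0 : 0 < M) (hM : M < 1 / Real.sqrt 5) :
    ∃ δ ∈ Ioo (0 : ℝ) 1, ∃ γ ∈ Ioo (0 : ℝ) 1,
      ∀ (T : ℝ) (f : ℝ → E2 → ℝ), 0 < T → SmoothDecaySol T f →
        (∀ x, ‖gradient (f 0) x‖ ≤ M) →
        ∀ ωbar : ℝ → ℝ,
          (∀ r, ωbar r =
            omegaMod δ γ (Function.invFun (omegaMod δ γ) (2 * M) / (2 * M) * r)) →
          ((∀ δ' : ℝ, 0 ≤ δ' →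
              (∀ x y : E2, x ≠ y →
                ‖gradient (f 0) x - gradient (f 0) y‖ ≤ ωbar (‖x - y‖ / δ')) →
              ∀ t ∈ Icc 0 T, ∀ x y : E2, x ≠ y →
                ‖gradient (f t) x - gradient (f t) y‖ ≤ ωbar (‖x - y‖ / (t + δ'))) ∧
            (∀ t ∈ Ioc 0 T, ∀ x y : E2, x ≠ y →
              ‖gradient (f t) x - gradient (f t) y‖ < ωbar (‖x - y‖ / t))) := by
  have h5 : 5 * M ^ 2 < 1 := by
    have s5 : (0 : ℝ) < Real.sqrt 5 := Real.sqrt_pos.2 (by norm_num)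
    have q := Real.sq_sqrt (show (0 : ℝ) ≤ 5 by norm_num)
    rw [lt_div_iff₀ s5] at hM
    have p : 0 < M * Real.sqrt 5 := by positivity
    have e : 5 * M ^ 2 = (M * Real.sqrt 5) ^ 2 := by rw [mul_pow, q]; ring
    rw [e]
    nlinarith
  obtain ⟨δ, γ, hp, hd⟩ := exists_params h5
  have d0 := hp.pos
  have d1 := hp.le
  have g1 := hp.eq
  refine ⟨δ, ⟨d0, by linarith⟩, γ, ⟨by linarith, by linarith⟩, ?_⟩
  intro T f hT hs hi ωbar hω
  obtain ⟨r0, hR⟩ := omega_invFun hp (show 0 < 2 * M by linarith)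
  have sl : ∀ t ∈ Icc 0 T, ∀ x, ‖fderiv ℝ (f t) x‖ ≤ M :=
    slope_max hs hT hM0 h5 (fun x => by rw [← norm_grad]; exact hi x)
  have two : ∀ t ∈ Ioc 0 T, ∀ x y : E2, x ≠ y →
      ‖gradient (f t) x - gradient (f t) y‖ < ωbar (‖x - y‖ / t) := by
    intro t ht x y hxy
    rw [norm_grad_sub, hω]
    exact concl_two hp hs hT hM0 h5 sl r0 hR hd ht.1 ht.2 hxy
  refine ⟨?_, two⟩
  intro b hb hib t ht x y hxy
  rcases hb.eq_or_lt with h | h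
  · subst h
    rcases ht.1.eq_or_lt with h' | h'
    · subst h'
      rw [add_zero]
      exact hib x y hxy
    · rw [add_zero]
      exact (two t ⟨h', ht.2⟩ x y hxy).le
  · rw [norm_grad_sub, hω]
    refine concl_one hp hs hT hM0 h5 sl r0 hR hd h (fun u v huv => ?_) ht.1 ht.2 hxy
    have := hib u v huv
    rwa [norm_grad_sub, hω] at this
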